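/- Let n be an integer with 1000 < n < 1.03·10^{15}, let F_n be the n-th Fibonacci number, and let α^(1) < α^(2) < α^(3) be the three real roots of f_n(X) = X·(X − F_n)·(X − 2^n) − 1. Then there is no integer solution (x, y) of x·(x − F_n·y)·(x − 2^n·y) − y³ = ±1 with |y| ≥ 2 whose type j (defined by |β^(j)| = min{|β^(1)|, |β^(2)|, |β^(3)|}, where β^(i) = x − α^(i)·y) belongs to {1, 2}. -/

import Mathlib

open Finset Matrix

namespace T12

/-- Taylor expansion with entire remainder. -/
lemma taylor_entire (f : ℂ → ℂ) (hf : Differentiable ℂ f) (N : ℕ) :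
    ∃ (c : ℕ → ℂ) (g : ℂ → ℂ), Differentiable ℂ g ∧
      ∀ x, f x = ∑ m ∈ range N, c m * x ^ m + x ^ N * g x := by
  induction N with
  | zero => exact ⟨fun _ => 0, f, hf, by simp⟩
  | succ N ih =>
    obtain ⟨c, g, hg, h⟩ := ih
    refine ⟨fun m => if m = N then g 0 else c m, dslope g 0, ?_, ?_⟩
    · have := (Complex.differentiableOn_dslope (s := Set.univ) (c := (0:ℂ)) (f := g)
        Filter.univ_mem).2 hg.differentiableOn
      exact differentiableOn_univ.1 this
    · intro x
      have h1 : g x = g 0 + x * dslope g 0 x := by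
        have := sub_smul_dslope g 0 x
        simp only [sub_zero, smul_eq_mul] at this
        rw [this]; ring
      rw [sum_range_succ, h x]
      have h2 : ∑ m ∈ range N, (if m = N then g 0 else c m) * x ^ m
          = ∑ m ∈ range N, c m * x ^ m := by
        apply sum_congr rfl
        intro m hm
        rw [if_neg (by have := mem_range.1 hm; omega)]
      rw [h2, h1]; simp only [if_true]; ring

/-- Schwarz type bound for interpolation determinants with a perturbation. -/
lemma det_upper (N : ℕ) (f : Fin N → ℂ → ℂ) (hf : ∀ j, Differentiable ℂ (f j))
    (z : Fin N → ℂ) (hz : Function.Injective z) (e : Fin N → Fin N → ℂ)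
    (ρ : ℝ) (hρ : 1 ≤ ρ) (M : Fin N → ℝ)
    (hM : ∀ i j, ∀ x : ℂ, ‖x‖ = ρ → ‖f j (z i * x)‖ + ρ ^ N * ‖e i j‖ ≤ M j) :
    ‖(Matrix.of fun i j => f j (z i) + e i j).det‖ * ρ ^ (∑ i : Fin N, (i : ℕ)) ≤
      (N.factorial : ℝ) * ∏ j, M j := by
  choose c g hg hc using fun j => taylor_entire (f j) (hf j) N
  set V : Matrix (Fin N) (Fin N) ℂ := Matrix.vandermonde z with hV
  have hVdet : V.det ≠ 0 := Matrix.det_vandermonde_ne_zero_iff.2 hz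
  have hVu : IsUnit V.det := isUnit_iff_ne_zero.2 hVdet
  set R : ℂ → Matrix (Fin N) (Fin N) ℂ := fun x =>
    Matrix.of fun i j => z i ^ N * g j (z i * x) + e i j with hR
  set W : Matrix (Fin N) (Fin N) ℂ := Matrix.of fun m j => c j m with hW
  set H : ℂ → Matrix (Fin N) (Fin N) ℂ := fun x =>
    Matrix.of fun i j => f j (z i * x) + x ^ N * e i j with hH
  set B : ℂ → Matrix (Fin N) (Fin N) ℂ := fun x =>
    W + Matrix.diagonal (fun m : Fin N => x ^ (N - (m : ℕ))) * (V⁻¹ * R x) with hB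
  have key : ∀ x, H x = V * (Matrix.diagonal (fun m : Fin N => x ^ (m : ℕ)) * B x) := by
    intro x
    have h1 : Matrix.diagonal (fun m : Fin N => x ^ (m : ℕ)) * B x
        = Matrix.diagonal (fun m : Fin N => x ^ (m : ℕ)) * W + V⁻¹ * (x ^ N • R x) := by
      rw [hB]
      simp only
      rw [Matrix.mul_add, ← Matrix.mul_assoc, Matrix.diagonal_mul_diagonal]
      congr 1
      have : (fun i : Fin N => x ^ (i : ℕ) * x ^ (N - (i : ℕ))) = fun _ => x ^ N := by
        funext i
        rw [← pow_add]; congr 1; have := i.2; omega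
      rw [this, Matrix.mul_smul]
      ext a b
      simp [Matrix.diagonal_mul]
    rw [h1, Matrix.mul_add, ← Matrix.mul_assoc V V⁻¹, Matrix.mul_nonsing_inv _ hVu, Matrix.one_mul]
    ext i j
    simp only [hH, hR, hV, hW, Matrix.add_apply, Matrix.smul_apply, Matrix.of_apply,
      Matrix.mul_apply, Matrix.vandermonde_apply, Matrix.diagonal_apply, smul_eq_mul]
    rw [hc j (z i * x)]
    have : ∑ m ∈ range N, c j m * (z i * x) ^ m = ∑ m : Fin N, c j m * (z i * x) ^ (m : ℕ) := by
      rw [Fin.sum_univ_eq_sum_range (fun m => c j m * (z i * x) ^ m)]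
    rw [this]
    simp only [ite_mul, zero_mul, Finset.sum_ite_eq, Finset.mem_univ, if_true]
    have h3 : ∀ m : Fin N, c j m * (z i * x) ^ (m : ℕ) = z i ^ (m : ℕ) * (x ^ (m : ℕ) * c j m) := by
      intro m; rw [mul_pow]; ring
    rw [Finset.sum_congr rfl (fun m _ => h3 m), mul_pow]
    ring
  set D : ℕ := ∑ i : Fin N, (i : ℕ) with hD
  set Q : ℂ → ℂ := fun x => V.det * (B x).det with hQ
  have hdet : ∀ x, (H x).det = x ^ D * Q x := by
    intro x
    rw [key, Matrix.det_mul, Matrix.det_mul, Matrix.det_diagonal, Finset.prod_pow_eq_pow_sum]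
    simp only [hQ, hD]; ring
  have hBdiff : ∀ i j, Differentiable ℂ (fun x => B x i j) := by
    intro i j
    simp only [hB, hR, Matrix.add_apply, Matrix.diagonal_mul]
    simp only [Matrix.mul_apply, Matrix.of_apply]
    have hgg : ∀ k, Differentiable ℂ (fun x => g j (z k * x)) := fun k =>
      (hg j).comp (differentiable_id.const_mul (z k))
    fun_prop
  have hQd : Differentiable ℂ Q := by
    simp only [hQ, Matrix.det_apply]
    apply Differentiable.const_mul
    apply Differentiable.fun_sum
    intro σ _
    apply Differentiable.const_smul
    apply Differentiable.fun_finsetProd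
    intro i _
    exact hBdiff _ _
  have hρ0 : 0 < ρ := by linarith
  have hHb : ∀ x : ℂ, ‖x‖ = ρ → ‖(H x).det‖ ≤ (N.factorial : ℝ) * ∏ j, M j := by
    intro x hx
    rw [Matrix.det_apply]
    refine (norm_sum_le _ _).trans ?_
    have : ∀ σ ∈ (Finset.univ : Finset (Equiv.Perm (Fin N))),
        ‖Equiv.Perm.sign σ • ∏ i, H x (σ i) i‖ ≤ ∏ j, M j := by
      intro σ _
      have h1 : ‖Equiv.Perm.sign σ • ∏ i, H x (σ i) i‖ = ∏ i, ‖H x (σ i) i‖ := by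
        rw [Units.smul_def, ← norm_prod]
        rcases Int.units_eq_one_or (Equiv.Perm.sign σ) with h | h <;> rw [h] <;> simp
      rw [h1]
      apply Finset.prod_le_prod
      · intro i _; exact norm_nonneg _
      · intro i _
        refine le_trans ?_ (hM (σ i) i x hx)
        simp only [hH, Matrix.of_apply]
        refine (norm_add_le _ _).trans ?_
        rw [norm_mul, norm_pow, hx]
    refine (Finset.sum_le_sum this).trans ?_
    simp [Fintype.card_perm]
  have hQb : ∀ x : ℂ, ‖x‖ = ρ → ‖Q x‖ ≤ (N.factorial : ℝ) * (∏ j, M j) / ρ ^ D := by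
    intro x hx
    rw [le_div_iff₀ (by positivity)]
    have := hHb x hx
    rw [hdet x, norm_mul, norm_pow, hx] at this
    linarith
  have h1 : ‖Q 1‖ ≤ (N.factorial : ℝ) * (∏ j, M j) / ρ ^ D := by
    apply Complex.norm_le_of_forall_mem_frontier_norm_le (U := Metric.ball (0:ℂ) ρ)
      Metric.isBounded_ball hQd.diffContOnCl
    · intro x hx
      rw [frontier_ball _ hρ0.ne'] at hx
      exact hQb x (by simpa using hx)
    · rw [closure_ball _ hρ0.ne']; simpa using hρ
  have h2 : (Matrix.of fun i j => f j (z i) + e i j).det = Q 1 := by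
    have := hdet 1
    simp only [hH, mul_one, one_pow, one_mul] at this
    exact this
  rw [h2]
  rwa [le_div_iff₀ (by positivity)] at h1

end T12


open Finset Matrix

namespace T12

lemma exists_minor {X ι : Type*} [Fintype X] [Fintype ι] [DecidableEq ι] (M : Matrix X ι ℝ)
    (h : ∀ c : ι → ℝ, M *ᵥ c = 0 → c = 0) :
    ∃ pt : ι → X, (M.submatrix pt id).det ≠ 0 := by
  have hinj : Function.Injective M.mulVecLin := by
    rw [← LinearMap.ker_eq_bot, LinearMap.ker_eq_bot']
    intro c hc
    exact h c hc
  have hrank : M.rank = Fintype.card ι := by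
    rw [Matrix.rank, LinearMap.finrank_range_of_inj hinj, Module.finrank_fintype_fun_eq_card]
  rw [M.rank_eq_finrank_span_row] at hrank
  obtain ⟨f, hf, -, hli⟩ := Submodule.exists_fun_fin_finrank_span_eq ℝ (Set.range M.row)
  choose p hp using hf
  let e : ι ≃ Fin (Module.finrank ℝ (Submodule.span ℝ (Set.range M.row))) :=
    (Fintype.equivFin ι).trans (finCongr hrank.symm)
  refine ⟨fun i => p (e i), ?_⟩
  have h1 : LinearIndependent ℝ (M.submatrix (fun i => p (e i)) id).row := by
    have : (M.submatrix (fun i => p (e i)) id).row = f ∘ e := by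
      funext i
      have := hp (e i)
      simp only [Function.comp]
      rw [← this]; rfl
    rw [this]
    exact hli.comp e e.injective
  have h2 := Matrix.linearIndependent_rows_iff_isUnit.1 h1
  rw [Matrix.isUnit_iff_isUnit_det] at h2
  exact h2.ne_zero

open Polynomial in
lemma coeff_prod_top {ι : Type*} (s : Finset ι) (p : ι → ℝ[X]) (d : ι → ℕ)
    (hd : ∀ i ∈ s, (p i).natDegree ≤ d i) :
    (∏ i ∈ s, p i).natDegree ≤ ∑ i ∈ s, d i ∧
    (∏ i ∈ s, p i).coeff (∑ i ∈ s, d i) = ∏ i ∈ s, (p i).coeff (d i) := by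
  classical
  induction s using Finset.induction_on with
  | empty => simp
  | insert a s ha ih =>
    obtain ⟨h1, h2⟩ := ih (fun i hi => hd i (Finset.mem_insert_of_mem hi))
    have h3 := hd a (Finset.mem_insert_self a s)
    rw [Finset.prod_insert ha, Finset.sum_insert ha, Finset.prod_insert ha]
    exact ⟨(natDegree_mul_le).trans (add_le_add h3 h1), by
      rw [coeff_mul_add_eq_of_natDegree_le h3 h1, h2]⟩

open Polynomial in
lemma coeff_det_top {m : ℕ} (A : Matrix (Fin m) (Fin m) ℝ[X]) (d : Fin m → ℕ)
    (hd : ∀ i j, (A i j).natDegree ≤ d j) :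
    A.det.natDegree ≤ ∑ j, d j ∧
    A.det.coeff (∑ j, d j) = (Matrix.of fun i j => (A i j).coeff (d j)).det := by
  constructor
  · rw [Matrix.det_apply]
    apply natDegree_sum_le_of_forall_le
    intro σ _
    refine (natDegree_smul_le _ _).trans ?_
    exact (coeff_prod_top Finset.univ (fun i => A (σ i) i) d (fun i _ => hd _ _)).1
  · rw [Matrix.det_apply, Matrix.det_apply, finsetSum_coeff]
    apply Finset.sum_congr rfl
    intro σ _
    rw [coeff_smul, (coeff_prod_top Finset.univ (fun i => A (σ i) i) d (fun i _ => hd _ _)).2]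
    rfl

open Polynomial in
lemma zero_estimate_aux (K L S T r : ℕ) (E G : ℝ) (hE : 0 < E) (hE1 : E ≠ 1) (hG : 0 < G)
    (hS : S + L ≤ r) (hK : 0 < K) (hL : 0 < L) (hc : K * L ≤ S * T) (p : Fin L → ℝ[X])
    (hp : ∀ l, (p l).natDegree ≤ K - 1)
    (hv : ∀ s t : ℕ, s < S + L → t < T →
      ∑ l, (p l).eval ((s : ℝ) - r * t) * (E ^ s * G ^ t) ^ (l : ℕ) = 0) : ∀ l, p l = 0 := by
  classical
  by_contra hcon
  push Not at hcon
  obtain ⟨l0, hl0⟩ := hcon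
  set s := (Finset.univ : Finset (Fin L)).filter (fun l => p l ≠ 0) with hs
  have hl0s : l0 ∈ s := by simp [hs, hl0]
  set m := s.card with hm
  have hmpos : 0 < m := Finset.card_pos.2 ⟨l0, hl0s⟩
  have hmL : m ≤ L := by
    have := Finset.card_le_univ s
    simpa using this
  let e : Fin m ≃ s := (s.equivFin).symm
  let q : Fin m → Fin L := fun i => (e i).1
  have hqinj : Function.Injective q := fun i j h => e.injective (Subtype.ext h)
  have hqne : ∀ i, p (q i) ≠ 0 := fun i => (Finset.mem_filter.1 (e i).2).2
  have hsum : ∀ F : Fin L → ℝ, (∀ l, p l = 0 → F l = 0) → ∑ i, F (q i) = ∑ l, F l := by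
    intro F hF
    have h1 : ∑ l ∈ s, F l = ∑ l, F l := by
      apply Finset.sum_subset (Finset.subset_univ _)
      intro l _ hl
      apply hF
      by_contra h
      exact hl (by simp [hs, h])
    rw [← h1, ← Finset.sum_coe_sort s]
    exact Equiv.sum_comp e (fun l : s => F l)
  let A : Matrix (Fin m) (Fin m) ℝ[X] := Matrix.of fun j i =>
    C ((E ^ (q i : ℕ)) ^ (j : ℕ)) * taylor ((j : ℕ) : ℝ) (p (q i))
  obtain ⟨hdeg, hco⟩ := coeff_det_top A (fun i => (p (q i)).natDegree) (by
    intro j i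
    simp only [A, Matrix.of_apply]
    refine (natDegree_C_mul_le _ _).trans ?_
    rw [natDegree_taylor])
  have hne : A.det ≠ 0 := by
    intro h0
    rw [h0, coeff_zero] at hco
    have h1 : (Matrix.of fun j i : Fin m => (A j i).coeff (p (q i)).natDegree)
        = (Matrix.vandermonde fun i => E ^ (q i : ℕ))ᵀ * Matrix.diagonal
          (fun i => (p (q i)).leadingCoeff) := by
      ext j i
      rw [Matrix.mul_diagonal]
      simp only [A, Matrix.of_apply, Matrix.transpose_apply, Matrix.vandermonde_apply, coeff_C_mul]
      congr 1
      rw [← leadingCoeff_taylor (r := ((j : ℕ) : ℝ)), leadingCoeff, natDegree_taylor]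
    rw [h1, Matrix.det_mul, Matrix.det_transpose, Matrix.det_diagonal] at hco
    have h2 : (Matrix.vandermonde fun i => E ^ (q i : ℕ)).det ≠ 0 := by
      rw [Matrix.det_vandermonde_ne_zero_iff]
      intro i j hij
      simp only at hij
      have := pow_right_injective₀ hE hE1 hij
      exact hqinj (Fin.ext this)
    have h3 : (∏ i, (p (q i)).leadingCoeff) ≠ 0 := by
      rw [Finset.prod_ne_zero_iff]
      intro i _
      exact leadingCoeff_ne_zero.2 (hqne i)
    exact mul_ne_zero h2 h3 hco.symm
  have hroot : ∀ a t : ℕ, a < S → t < T → A.det.eval ((a : ℝ) - r * t) = 0 := by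
    intro a t ha ht
    have h1 : A.det.eval ((a : ℝ) - r * t) =
        (Matrix.of fun j i : Fin m => (A j i).eval ((a : ℝ) - r * t)).det := by
      rw [← coe_evalRingHom, RingHom.map_det]
      rfl
    rw [h1, ← Matrix.exists_mulVec_eq_zero_iff]
    refine ⟨fun i => (E ^ a * G ^ t) ^ (q i : ℕ), ?_, ?_⟩
    · intro h
      have := congrFun h ⟨0, hmpos⟩
      simp only [Pi.zero_apply] at this
      have hpos : (0:ℝ) < (E ^ a * G ^ t) ^ (q ⟨0, hmpos⟩ : ℕ) := by positivity
      linarith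
    · funext j
      simp only [Matrix.mulVec, dotProduct, Matrix.of_apply, A, Pi.zero_apply, eval_mul, eval_C,
        taylor_eval]
      have h2 := hv (a + j) t (by have := j.2; omega) ht
      rw [← hsum (fun l => (p l).eval (((a + j : ℕ) : ℝ) - r * t) *
        (E ^ (a + (j:ℕ)) * G ^ t) ^ (l : ℕ)) (by intro l hl; simp [hl])] at h2
      rw [← h2]
      apply Finset.sum_congr rfl
      intro i _
      have e1 : ((a : ℝ) - r * t + (j : ℕ)) = ((a + j : ℕ) : ℝ) - r * t := by push_cast; ring
      rw [e1, pow_add E a]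
      rw [← pow_mul, mul_pow, mul_pow, mul_pow, ← pow_mul, ← pow_mul, ← pow_mul]
      ring_nf
  -- count roots
  let φ : Fin S × Fin T → ℝ := fun x => ((x.1 : ℕ) : ℝ) - r * ((x.2 : ℕ) : ℝ)
  have hφ : Function.Injective φ := by
    rintro ⟨a, t⟩ ⟨a', t'⟩ h
    simp only [φ] at h
    have h' : ((a : ℕ) : ℤ) - r * ((t : ℕ) : ℤ) = (a' : ℕ) - r * ((t' : ℕ) : ℤ) := by exact_mod_cast h
    have ha := a.2
    have ha' := a'.2
    have ht : ((t : ℕ) : ℤ) = (t' : ℕ) := by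
      by_contra hne
      have h3 : (r : ℤ) * (((t : ℕ) : ℤ) - (t' : ℕ)) = (a : ℕ) - ((a' : ℕ) : ℤ) := by linarith
      rcases lt_or_gt_of_ne hne with h4 | h4
      · have : (r : ℤ) * (((t : ℕ) : ℤ) - (t' : ℕ)) ≤ r * (-1) :=
          mul_le_mul_of_nonneg_left (by omega) (by omega)
        omega
      · have : (r : ℤ) * 1 ≤ (r : ℤ) * (((t : ℕ) : ℤ) - (t' : ℕ))  :=
          mul_le_mul_of_nonneg_left (by omega) (by omega)
        omega
    rw [ht] at h'
    have h5 : ((a : ℕ) : ℤ) = (a' : ℕ) := by linarith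
    ext
    · exact_mod_cast h5
    · exact_mod_cast ht
  have hcard : A.det.natDegree < Fintype.card (Fin S × Fin T) := by
    have h1 : ∑ i, (p (q i)).natDegree ≤ ∑ i : Fin m, (K - 1) :=
      Finset.sum_le_sum (fun i _ => hp _)
    simp only [Finset.sum_const, Finset.card_univ, Fintype.card_fin, smul_eq_mul] at h1
    have h2 : m * (K - 1) ≤ L * (K - 1) := Nat.mul_le_mul_right _ hmL
    have h3 : L * (K - 1) < K * L := by
      rw [mul_comm K L]; exact Nat.mul_lt_mul_of_pos_left (by omega) hL
    simp only [Fintype.card_prod, Fintype.card_fin]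
    omega
  exact hne (Polynomial.eq_zero_of_natDegree_lt_card_of_eval_eq_zero A.det hφ
    (fun x => hroot x.1 x.2 x.1.2 x.2.2) hcard)

open Polynomial in
lemma zero_estimate (K L S T r : ℕ) (E G : ℝ) (hE : 0 < E) (hE1 : E ≠ 1) (hG : 0 < G)
    (hS : S + L ≤ r) (hK : 0 < K) (hL : 0 < L) (hc : K * L ≤ S * T) :
    ∃ pt : Fin K × Fin L → Fin (S + L) × Fin T,
      (Matrix.of fun i j : Fin K × Fin L =>
        (((pt i).1 : ℕ) - (r : ℝ) * ((pt i).2 : ℕ)) ^ (j.1 : ℕ) *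
          (E ^ ((pt i).1 : ℕ) * G ^ ((pt i).2 : ℕ)) ^ (j.2 : ℕ)).det ≠ 0 := by
  let M : Matrix (Fin (S + L) × Fin T) (Fin K × Fin L) ℝ := Matrix.of fun x j =>
        ((x.1 : ℕ) - (r : ℝ) * (x.2 : ℕ)) ^ (j.1 : ℕ) *
          (E ^ (x.1 : ℕ) * G ^ (x.2 : ℕ)) ^ (j.2 : ℕ)
  obtain ⟨pt, hpt⟩ := exists_minor M (by
    intro c hc0
    let p : Fin L → ℝ[X] := fun l => ∑ k : Fin K, C (c (k, l)) * X ^ (k : ℕ)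
    have hz := zero_estimate_aux K L S T r E G hE hE1 hG hS hK hL hc p (by
      intro l
      apply natDegree_sum_le_of_forall_le
      intro k _
      refine (natDegree_C_mul_X_pow_le _ _).trans ?_
      have := k.2; omega) (by
      intro s t hs ht
      have := congrFun hc0 (⟨s, hs⟩, ⟨t, ht⟩)
      simp only [Matrix.mulVec, dotProduct, Pi.zero_apply, M, Matrix.of_apply] at this
      rw [Fintype.sum_prod_type, Finset.sum_comm] at this
      rw [← this]
      apply Finset.sum_congr rfl
      intro l _
      simp only [p, eval_finsetSum, eval_mul, eval_C, eval_pow, eval_X, Finset.sum_mul]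
      apply Finset.sum_congr rfl
      intro k _
      ring)
    funext ⟨k, l⟩
    have h1 := hz l
    have h2 := congrArg (fun P => P.coeff (k : ℕ)) h1
    simp only [p, finsetSum_coeff, coeff_C_mul, coeff_X_pow, coeff_zero] at h2
    rw [Finset.sum_eq_single k] at h2
    · simpa using h2
    · intro b _ hb
      rw [if_neg (fun h => hb (Fin.ext h.symm))]; simp
    · simp)
  exact ⟨pt, hpt⟩

end T12


open Finset Matrix

namespace T12

lemma liouville (α : Fin 3 → ℝ) (hα : Function.Injective α)
    (f : Polynomial ℤ) (hmon : f.Monic) (hroot : ∀ i, Polynomial.aeval (α i) f = 0)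
    (hall : ∀ x : ℂ, Polynomial.aeval x f = 0 → ∃ i, x = (α i : ℂ))
    (P : MvPolynomial (Fin 3) ℤ) (hP : MvPolynomial.aeval α P ≠ 0) (M : ℝ) (hM1 : 1 ≤ M)
    (hM : ∀ σ : Equiv.Perm (Fin 3), |MvPolynomial.aeval (fun i => α (σ i)) P| ≤ M) :
    1 ≤ |MvPolynomial.aeval α P| * M ^ 5 := by
  classical
  have hInteg : ∀ i, IsIntegral ℤ (α i) := fun i => ⟨f, hmon, by simpa [Polynomial.aeval_def] using hroot i⟩
  have hintQ : ∀ i, IsIntegral ℚ (α i) := fun i => (hInteg i).tower_top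
  let K : IntermediateField ℚ ℝ := IntermediateField.adjoin ℚ (Set.range α)
  have : FiniteDimensional ℚ K := by
    apply IntermediateField.finiteDimensional_adjoin
    rintro x ⟨i, rfl⟩
    exact hintQ i
  let β : Fin 3 → K := fun i => ⟨α i, IntermediateField.subset_adjoin ℚ _ ⟨i, rfl⟩⟩
  have hβint : ∀ i, IsIntegral ℤ (β i) := by
    intro i
    have : IsIntegral ℤ (algebraMap K ℝ (β i)) := hInteg i
    exact (isIntegral_algebraMap_iff (algebraMap K ℝ).injective).1 this
  let x : K := MvPolynomial.aeval β P
  have hxα : (x : ℝ) = MvPolynomial.aeval α P := by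
    have := MvPolynomial.aeval_algebraMap_apply (R := ℤ) (A := K) ℝ β P
    exact this.symm
  have hxne : x ≠ 0 := by
    intro h
    apply hP
    rw [← hxα, h]; rfl
  have hxint : IsIntegral ℤ x := by
    have : x ∈ integralClosure ℤ K := by
      have := (MvPolynomial.aeval (R := ℤ) (fun i => (⟨β i, hβint i⟩ : integralClosure ℤ K)) P).2
      have h2 := MvPolynomial.aeval_algebraMap_apply (R := ℤ) (A := integralClosure ℤ K) K
        (fun i => (⟨β i, hβint i⟩ : integralClosure ℤ K)) P
      have h3 : x = ((MvPolynomial.aeval (R := ℤ) (fun i => (⟨β i, hβint i⟩ : integralClosure ℤ K)) P : integralClosure ℤ K) : K) := h2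
      rw [h3]; exact this
    exact this
  -- the norm
  have hnint : IsIntegral ℤ (Algebra.norm ℚ x) := Algebra.isIntegral_norm ℚ hxint
  obtain ⟨z, hz⟩ := IsIntegrallyClosed.isIntegral_iff.1 hnint
  have hzne : z ≠ 0 := by
    intro h
    rw [h, map_zero] at hz
    exact (Algebra.norm_ne_zero_iff.2 hxne) hz.symm
  have hprod := Algebra.norm_eq_prod_embeddings ℚ ℂ x
  -- permutations
  have hperm : ∀ σ : K →ₐ[ℚ] ℂ, ∃ π : Equiv.Perm (Fin 3), ∀ i, σ (β i) = (α (π i) : ℂ) := by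
    intro σ
    have h1 : ∀ i, ∃ j, σ (β i) = (α j : ℂ) := by
      intro i
      apply hall
      have h2 : Polynomial.aeval (β i) f = 0 := by
        have h3 := Polynomial.aeval_algebraMap_apply (R := ℤ) (A := K) ℝ (β i) f
        have h4 : Polynomial.aeval (algebraMap K ℝ (β i)) f = 0 := hroot i
        rw [h4] at h3
        exact (algebraMap K ℝ).injective (by rw [← h3, map_zero])
      have h5 := Polynomial.aeval_algHom_apply (σ.restrictScalars ℤ) (β i) f
      rw [h2, map_zero] at h5
      exact h5
    choose j hj using h1
    have hinj : Function.Injective j := by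
      intro a b hab
      have : σ (β a) = σ (β b) := by rw [hj, hj, hab]
      have := σ.injective this
      exact hα (congrArg Subtype.val this)
    exact ⟨Equiv.ofBijective j (Finite.injective_iff_bijective.1 hinj), hj⟩
  choose π hπ using hperm
  have hσx : ∀ σ : K →ₐ[ℚ] ℂ, ‖σ x‖ = |MvPolynomial.aeval (fun i => α (π σ i)) P| := by
    intro σ
    have h1 : σ x = MvPolynomial.aeval (fun i => σ (β i)) P := by
      have := MvPolynomial.comp_aeval_apply (R := ℤ) β (σ.restrictScalars ℤ) P
      exact this
    have h2 : (fun i => σ (β i)) = fun i => algebraMap ℝ ℂ (α (π σ i)) := by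
      funext i; exact hπ σ i
    rw [h1, h2]
    have := MvPolynomial.aeval_algebraMap_apply (R := ℤ) (A := ℝ) ℂ (fun i => α (π σ i)) P
    have h3 : MvPolynomial.aeval (fun i => algebraMap ℝ ℂ (α (π σ i))) P = algebraMap ℝ ℂ (MvPolynomial.aeval (fun i => α (π σ i)) P) := this
    rw [h3, Complex.coe_algebraMap, Complex.norm_real, Real.norm_eq_abs]
  have hinjπ : Function.Injective π := by
    intro σ τ h
    have h1 : ∀ i, σ (β i) = τ (β i) := by intro i; rw [hπ, hπ, h]
    apply IntermediateField.algHom_ext_of_eq_adjoin (hS := rfl)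
    rintro x ⟨i, rfl⟩
    exact h1 i
  have hcard : Fintype.card (K →ₐ[ℚ] ℂ) ≤ 6 := by
    have := Fintype.card_le_of_injective π hinjπ
    simpa [Fintype.card_perm, Nat.factorial] using this
  let σ₀ : K →ₐ[ℚ] ℂ := (Algebra.ofId ℝ ℂ).restrictScalars ℚ |>.comp K.val
  have hσ₀ : ‖σ₀ x‖ = |MvPolynomial.aeval α P| := by
    have : σ₀ x = ((x : ℝ) : ℂ) := rfl
    rw [this, hxα]; simp
  have h1 : (1:ℝ) ≤ ‖∏ σ : K →ₐ[ℚ] ℂ, σ x‖ := by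
    rw [← hprod, ← hz]
    simp only [algebraMap_int_eq, eq_intCast, map_intCast]
    rw [Complex.norm_intCast]
    exact_mod_cast Int.one_le_abs hzne
  rw [norm_prod, ← Finset.mul_prod_erase _ _ (Finset.mem_univ σ₀), hσ₀] at h1
  have h2 : ∏ σ ∈ Finset.univ.erase σ₀, ‖σ x‖ ≤ M ^ 5 := by
    calc ∏ σ ∈ Finset.univ.erase σ₀, ‖σ x‖ ≤ ∏ σ ∈ Finset.univ.erase σ₀, M := by
          apply Finset.prod_le_prod
          · intro i _; exact norm_nonneg _
          · intro σ _; rw [hσx]; exact hM _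
      _ = M ^ (Finset.univ.erase σ₀).card := by rw [Finset.prod_const]
      _ ≤ M ^ 5 := by
          apply pow_le_pow_right₀ hM1
          rw [Finset.card_erase_of_mem (Finset.mem_univ _), Finset.card_univ]
          omega
  exact h1.trans (mul_le_mul_of_nonneg_left h2 (abs_nonneg _))

end T12


open Finset Matrix

namespace T12

lemma sum_fin_cast (K : ℕ) : ∑ k : Fin K, ((k:ℕ):ℝ) = K * ((K:ℝ) - 1) / 2 := by
  rw [Fin.sum_univ_eq_sum_range (fun i => (i:ℝ)) K]
  induction K with
  | zero => simp
  | succ n ih => rw [Finset.sum_range_succ, ih]; push_cast; ring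

lemma sumKL (K L : ℕ) (a b c : ℝ) :
    ∑ j : Fin K × Fin L, (((j.1:ℕ):ℝ) * a + ((j.2:ℕ):ℝ) * b + c)
      = (K * L : ℝ) * (((K:ℝ) - 1) / 2 * a + ((L:ℝ) - 1) / 2 * b + c) := by
  rw [Fintype.sum_prod_type]
  simp only [Finset.sum_add_distrib, ← Finset.sum_mul, Finset.sum_const, Finset.card_univ,
    Fintype.card_fin, nsmul_eq_mul, ← Finset.mul_sum, sum_fin_cast]
  ring

lemma det_abs_le {ι : Type*} [Fintype ι] [DecidableEq ι] (A : Matrix ι ι ℝ) (m : ι → ℝ)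
    (h : ∀ i j, |A i j| ≤ Real.exp (m j)) :
    |A.det| ≤ (Fintype.card ι).factorial * Real.exp (∑ j, m j) := by
  rw [Matrix.det_apply]
  calc |∑ σ : Equiv.Perm ι, Equiv.Perm.sign σ • ∏ i, A (σ i) i|
      ≤ ∑ σ : Equiv.Perm ι, |Equiv.Perm.sign σ • ∏ i, A (σ i) i| := Finset.abs_sum_le_sum_abs _ _
    _ ≤ ∑ σ : Equiv.Perm ι, Real.exp (∑ j, m j) := by
        apply Finset.sum_le_sum
        intro σ _
        have : |Equiv.Perm.sign σ • ∏ i, A (σ i) i| = ∏ i, |A (σ i) i| := by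
          rcases Int.units_eq_one_or (Equiv.Perm.sign σ) with h | h <;>
            simp [h, Finset.abs_prod]
        rw [this, Real.exp_sum]
        exact Finset.prod_le_prod (fun _ _ => abs_nonneg _) (fun i _ => h _ _)
    _ = _ := by
        rw [Finset.sum_const, Finset.card_univ, Fintype.card_perm, nsmul_eq_mul]

/-- upper bound of the interpolation determinant -/
lemma delta_upper (K L S T r : ℕ) (c g Zl : ℝ)
    (pt : Fin K × Fin L → Fin S × Fin T) (hSr : S ≤ r) (hT : 1 ≤ T) (hK : 0 < K) (hL : 0 < L)
    (hZ : ((r:ℝ) * T) = Real.exp Zl)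
    (hΛ : 2 * (L * T * |r * c + g|) * Real.exp (2 * (K * L)) ≤ 1)
    (hpt : Function.Injective pt) :
    |(Matrix.of fun i j : Fin K × Fin L => (((pt i).1:ℕ) - (r:ℝ) * ((pt i).2:ℕ))^(j.1:ℕ) *
      (Real.exp c ^((pt i).1:ℕ) * Real.exp g ^((pt i).2:ℕ))^(j.2:ℕ)).det|
      * Real.exp ((K * L) * (K * L - 1)) ≤
    (K * L).factorial * Real.exp ((K * L : ℝ) * (((K:ℝ) - 1) / 2 * (2 + Zl) +
      ((L:ℝ) - 1) / 2 * (Real.exp 2 * |c| * (r * T)) + Real.log 2)) := by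
  classical
  set ρ : ℝ := Real.exp 2 with hρ
  have hρ1 : 1 ≤ ρ := Real.one_le_exp (by norm_num)
  let ep : Fin (K * L) ≃ Fin K × Fin L := finProdFinEquiv.symm
  let zr : Fin K × Fin L → ℝ := fun i => ((pt i).1:ℕ) - (r:ℝ) * ((pt i).2:ℕ)
  have hzr : ∀ i, |zr i| ≤ r * T := by
    intro i
    have h1 : (((pt i).1:ℕ):ℝ) ≤ r := by
      have := (pt i).1.2
      exact_mod_cast (by omega : ((pt i).1:ℕ) ≤ r)
    have h2 : (((pt i).2:ℕ):ℝ) ≤ T := by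
      have := (pt i).2.2
      exact_mod_cast (by omega : ((pt i).2:ℕ) ≤ T)
    have h3 : (0:ℝ) ≤ (((pt i).1:ℕ):ℝ) := by positivity
    have h4 : (0:ℝ) ≤ (((pt i).2:ℕ):ℝ) := by positivity
    have h5 : (0:ℝ) ≤ r := by positivity
    have h6 : (1:ℝ) ≤ T := by exact_mod_cast hT
    rw [abs_le]
    constructor <;> simp only [zr] <;> nlinarith
  have hzinj : Function.Injective zr := by
    intro i j hij
    apply hpt
    simp only [zr] at hij
    have hij' : (((pt i).1:ℕ):ℤ) - (r:ℤ) * (((pt i).2:ℕ):ℤ) = (((pt j).1:ℕ):ℤ) - (r:ℤ) * (((pt j).2:ℕ):ℤ) := by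
      exact_mod_cast hij
    have hi := (pt i).1.2
    have hj := (pt j).1.2
    have key : (((pt i).1:ℕ):ℤ) - (((pt j).1:ℕ):ℤ) = r * ((((pt i).2:ℕ):ℤ) - (((pt j).2:ℕ):ℤ)) := by linarith
    have : (((pt i).2:ℕ):ℤ) - (((pt j).2:ℕ):ℤ) = 0 := by
      by_contra hne
      have h1 : (1:ℤ) ≤ |(((pt i).2:ℕ):ℤ) - (((pt j).2:ℕ):ℤ)| := Int.one_le_abs hne
      have h2 := congrArg abs key
      rw [abs_mul] at h2
      have h3 : |(((pt i).1:ℕ):ℤ) - (((pt j).1:ℕ):ℤ)| < r := by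
        rw [abs_lt]; omega
      have h4 : |(r:ℤ)| = r := abs_of_nonneg (by positivity)
      rw [h4] at h2
      nlinarith
    rw [this, mul_zero] at key
    apply Prod.ext
    · apply Fin.ext; omega
    · apply Fin.ext; omega
  let Λ : ℝ := r * c + g
  let f : Fin (K * L) → ℂ → ℂ := fun j z => z ^ ((ep j).1:ℕ) * Complex.exp ((((ep j).2:ℕ):ℂ) * c * z)
  let z : Fin (K * L) → ℂ := fun i => ((zr (ep i) : ℝ) : ℂ)
  let e : Fin (K * L) → Fin (K * L) → ℂ := fun i j => f j (z i) *
    (((Real.exp (((ep j).2:ℕ) * ((pt (ep i)).2:ℕ) * Λ) - 1 : ℝ)) : ℂ)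
  let B : Fin (K * L) → ℝ := fun j => (ρ * (r * T)) ^ ((ep j).1:ℕ) *
    Real.exp (((ep j).2:ℕ) * (ρ * |c| * (r * T)))
  have hrT : (0:ℝ) < r * T := by rw [hZ]; exact Real.exp_pos _
  have hfB : ∀ j (w : ℂ), ‖w‖ ≤ ρ * (r * T) → ‖f j w‖ ≤ B j := by
    intro j w hw
    simp only [f, B]
    rw [norm_mul, norm_pow]
    apply mul_le_mul (pow_le_pow_left₀ (norm_nonneg _) hw _) _ (norm_nonneg _) (by positivity)
    rw [Complex.norm_exp]
    apply Real.exp_le_exp.2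
    calc ((((ep j).2:ℕ):ℂ) * c * w).re ≤ ‖(((ep j).2:ℕ):ℂ) * c * w‖ := Complex.re_le_norm _
      _ = ((ep j).2:ℕ) * (|c| * ‖w‖) := by
          rw [norm_mul, norm_mul, Complex.norm_natCast, Complex.norm_real, Real.norm_eq_abs]; ring
      _ ≤ ((ep j).2:ℕ) * (|c| * (ρ * (r * T))) := by gcongr
      _ = _ := by ring
  have hzn : ∀ i, ‖z i‖ ≤ r * T := by
    intro i
    simp only [z]
    rw [Complex.norm_real]; exact hzr _
  have hM : ∀ i j x, ‖x‖ = ρ → ‖f j (z i * x)‖ + ρ ^ (K * L) * ‖e i j‖ ≤ 2 * B j := by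
    intro i j x hx
    have h1 : ‖f j (z i * x)‖ ≤ B j := by
      apply hfB
      rw [norm_mul, hx, mul_comm]
      exact mul_le_mul_of_nonneg_left (hzn i) (by linarith)
    have h2 : ‖f j (z i)‖ ≤ B j := by
      apply hfB
      have := hzn i
      nlinarith
    have hB0 : 0 ≤ B j := (norm_nonneg _).trans h2
    have h3 : ‖e i j‖ ≤ B j * (2 * (L * T * |Λ|)) := by
      simp only [e]
      rw [norm_mul, Complex.norm_real]
      apply mul_le_mul h2 _ (norm_nonneg _) hB0
      have h4 : |(((ep j).2:ℕ):ℝ) * ((pt (ep i)).2:ℕ) * Λ| ≤ L * T * |Λ| := by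
        rw [abs_mul, abs_mul, Nat.abs_cast, Nat.abs_cast]
        have h5 : (((ep j).2:ℕ):ℝ) ≤ L := by exact_mod_cast (ep j).2.2.le
        have h6 : (((pt (ep i)).2:ℕ):ℝ) ≤ T := by exact_mod_cast (pt (ep i)).2.2.le
        gcongr
      have h7 : (L * T * |Λ| : ℝ) ≤ 1 := by
        have h8 : (1:ℝ) ≤ Real.exp (2 * (K * L)) := Real.one_le_exp (by positivity)
        have h9 : (0:ℝ) ≤ L * T * |Λ| := by positivity
        have : 2 * (L * T * |Λ|) * Real.exp (2 * (K * L)) ≤ 1 := hΛ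
        nlinarith
      rw [Real.norm_eq_abs]
      exact (Real.abs_exp_sub_one_le (h4.trans h7)).trans (by linarith)
    have h4 : ρ ^ (K * L) = Real.exp (2 * (K * L)) := by
      rw [hρ, ← Real.exp_nat_mul]; congr 1; push_cast; ring
    have h5 : ρ ^ (K * L) * ‖e i j‖ ≤ B j := by
      rw [h4]
      calc Real.exp (2 * (K * L)) * ‖e i j‖ ≤ Real.exp (2 * (K * L)) * (B j * (2 * (L * T * |Λ|))) := by gcongr
        _ = B j * (2 * (L * T * |Λ|) * Real.exp (2 * (K * L))) := by ring
        _ ≤ B j * 1 := mul_le_mul_of_nonneg_left hΛ hB0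
        _ = B j := mul_one _
    linarith
  have hzinjC : Function.Injective z := by
    intro i j hij
    simp only [z] at hij
    have := hzinj (Complex.ofReal_injective hij)
    exact ep.injective this
  have hfd : ∀ j, Differentiable ℂ (f j) := by
    intro j
    simp only [f]
    fun_prop
  have main := det_upper (K * L) f hfd z hzinjC e ρ hρ1 (fun j => 2 * B j) hM
  set A : Matrix (Fin K × Fin L) (Fin K × Fin L) ℝ := (Matrix.of fun i j : Fin K × Fin L => (((pt i).1:ℕ) - (r:ℝ) * ((pt i).2:ℕ))^(j.1:ℕ) *
      (Real.exp c ^((pt i).1:ℕ) * Real.exp g ^((pt i).2:ℕ))^(j.2:ℕ)) with hA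
  have hdet : (Matrix.of fun i j => f j (z i) + e i j) = (A.submatrix ep ep).map (Complex.ofRealHom) := by
    ext i j
    simp only [Matrix.of_apply, Matrix.map_apply, Matrix.submatrix_apply, hA, f, e, z, Complex.ofRealHom_eq_coe]
    rw [← Complex.ofReal_natCast, ← Complex.ofReal_mul, ← Complex.ofReal_mul, ← Complex.ofReal_exp,
      ← Complex.ofReal_pow, ← Complex.ofReal_mul, ← Complex.ofReal_mul, ← Complex.ofReal_add]
    congr 1
    have hh : ∀ a b : ℝ, a + a * (b - 1) = a * b := by intro a b; ring
    rw [hh, mul_assoc, ← Real.exp_add]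
    congr 1
    rw [← Real.exp_nat_mul, ← Real.exp_nat_mul, ← Real.exp_add, ← Real.exp_nat_mul]
    congr 1
    simp only [zr, Λ]
    ring
  rw [hdet] at main
  have hdet2 : ((A.submatrix ep ep).map (Complex.ofRealHom)).det = ((A.det : ℝ) : ℂ) := by
    have := RingHom.map_det Complex.ofRealHom (A.submatrix ep ep)
    rw [Matrix.det_submatrix_equiv_self] at this
    exact this.symm
  rw [hdet2, Complex.norm_real, Real.norm_eq_abs] at main
  have hsum : ρ ^ (∑ i : Fin (K * L), (i:ℕ)) = Real.exp ((K * L) * (K * L - 1)) := by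
    rw [hρ, ← Real.exp_nat_mul]
    congr 1
    push_cast
    rw [sum_fin_cast]
    push_cast
    ring
  rw [hsum] at main
  refine main.trans (le_of_eq ?_)
  congr 1
  rw [← sumKL, Real.exp_sum, ← Equiv.prod_comp ep]
  apply Finset.prod_congr rfl
  intro j _
  simp only [B]
  rw [hZ, hρ, ← Real.exp_add, ← Real.exp_nat_mul, ← Real.exp_add]
  nth_rewrite 1 [← Real.exp_log (show (0:ℝ) < 2 by norm_num)]
  rw [← Real.exp_add]
  congr 1
  ring

end T12


open Finset Matrix

namespace T12

/-- lower bound of the interpolation determinant -/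
lemma delta_lower (α : Fin 3 → ℝ) (hα : Function.Injective α)
    (f : Polynomial ℤ) (hmon : f.Monic) (hroot : ∀ i, Polynomial.aeval (α i) f = 0)
    (hall : ∀ x : ℂ, Polynomial.aeval x f = 0 → ∃ i, x = (α i : ℂ))
    (PE PP PR : MvPolynomial (Fin 3) ℤ) (K L S T r : ℕ) (a1 a2 Zl : ℝ) (ha1 : 0 ≤ a1) (ha2 : 0 ≤ a2)
    (hZl : 0 ≤ Zl)
    (pt : Fin K × Fin L → Fin S × Fin T) (hSr : S ≤ r) (hT : 1 ≤ T) (hK : 0 < K) (hL : 0 < L)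
    (hZ : ((r:ℝ) * T) = Real.exp Zl)
    (hE : ∀ σ : Equiv.Perm (Fin 3), |MvPolynomial.aeval (fun i => α (σ i)) PE| ≤ Real.exp a1)
    (hP : ∀ σ : Equiv.Perm (Fin 3), |MvPolynomial.aeval (fun i => α (σ i)) PP| ≤ Real.exp a2)
    (hR : ∀ σ : Equiv.Perm (Fin 3), |MvPolynomial.aeval (fun i => α (σ i)) PR| ≤ Real.exp a2)
    (hR0 : MvPolynomial.aeval α PR ≠ 0) (Δ : ℝ)
    (hΔ : Δ = (Matrix.of fun i j : Fin K × Fin L => (((pt i).1:ℕ) - (r:ℝ) * ((pt i).2:ℕ))^(j.1:ℕ) *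
      (MvPolynomial.aeval α PE ^((pt i).1:ℕ) * (MvPolynomial.aeval α PP / MvPolynomial.aeval α PR)
        ^((pt i).2:ℕ))^(j.2:ℕ)).det) (hΔ0 : Δ ≠ 0) :
    1 ≤ |Δ| * Real.exp ((K * L) * (L * T * a2)) * ((K * L).factorial * Real.exp ((K * L : ℝ) *
      (((K:ℝ) - 1) / 2 * Zl + ((L:ℝ) - 1) / 2 * (S * a1) + L * T * a2))) ^ 5 := by
  classical
  let ι := Fin K × Fin L
  let W : Matrix ι ι (MvPolynomial (Fin 3) ℤ) := Matrix.of fun i j =>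
    (MvPolynomial.C ((((pt i).1:ℕ):ℤ) - (r:ℤ) * (((pt i).2:ℕ):ℤ))) ^ (j.1:ℕ) *
      (PE ^ ((j.2:ℕ) * ((pt i).1:ℕ)) * PP ^ ((j.2:ℕ) * ((pt i).2:ℕ)) *
        PR ^ ((L - 1 - (j.2:ℕ)) * ((pt i).2:ℕ)))
  have hev : ∀ (x : Fin 3 → ℝ), MvPolynomial.aeval x W.det = (Matrix.of fun i j : ι =>
      ((((pt i).1:ℕ):ℝ) - (r:ℝ) * (((pt i).2:ℕ):ℝ)) ^ (j.1:ℕ) *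
      ((MvPolynomial.aeval x PE) ^ ((j.2:ℕ) * ((pt i).1:ℕ)) * (MvPolynomial.aeval x PP) ^ ((j.2:ℕ) * ((pt i).2:ℕ)) *
        (MvPolynomial.aeval x PR) ^ ((L - 1 - (j.2:ℕ)) * ((pt i).2:ℕ)))).det := by
    intro x
    rw [AlgHom.map_det]
    congr 1
    ext i j
    simp [W]
  have hrow : MvPolynomial.aeval α W.det = (∏ i, (MvPolynomial.aeval α PR) ^ ((L - 1) * ((pt i).2:ℕ))) * Δ := by
    rw [hev, hΔ, ← Matrix.det_mul_column]
    congr 1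
    ext i j
    simp only [Matrix.of_apply]
    set R := MvPolynomial.aeval α PR
    set P := MvPolynomial.aeval α PP
    set E := MvPolynomial.aeval α PE
    have h1 : (L - 1) * ((pt i).2:ℕ) = (j.2:ℕ) * ((pt i).2:ℕ) + (L - 1 - (j.2:ℕ)) * ((pt i).2:ℕ) := by
      rw [← add_mul]
      congr 1
      have := j.2.2
      omega
    rw [h1, pow_add, mul_pow, ← pow_mul, ← pow_mul, div_pow, mul_comm ((pt i).1:ℕ), mul_comm ((pt i).2:ℕ) (j.2:ℕ)]
    have : R ^ ((j.2:ℕ) * ((pt i).2:ℕ)) ≠ 0 := pow_ne_zero _ hR0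
    field_simp
  have hne : MvPolynomial.aeval α W.det ≠ 0 := by
    rw [hrow]
    exact mul_ne_zero (Finset.prod_ne_zero_iff.2 fun i _ => pow_ne_zero _ hR0) hΔ0
  set M : ℝ := ((K * L).factorial * Real.exp ((K * L : ℝ) *
      (((K:ℝ) - 1) / 2 * Zl + ((L:ℝ) - 1) / 2 * (S * a1) + L * T * a2))) with hMdef
  have hK1 : (1:ℝ) ≤ K := by exact_mod_cast hK
  have hL1 : (1:ℝ) ≤ L := by exact_mod_cast hL
  have hM1 : 1 ≤ M := by
    have h1 : (1:ℝ) ≤ (K * L).factorial := by exact_mod_cast Nat.succ_le_of_lt (Nat.factorial_pos _)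
    have h2 : 1 ≤ Real.exp ((K * L : ℝ) *
      (((K:ℝ) - 1) / 2 * Zl + ((L:ℝ) - 1) / 2 * (S * a1) + L * T * a2)) := by
      apply Real.one_le_exp
      have : 0 ≤ ((K:ℝ) - 1) / 2 * Zl := mul_nonneg (by linarith) hZl
      have : 0 ≤ ((L:ℝ) - 1) / 2 * (S * a1) := mul_nonneg (by linarith) (by positivity)
      positivity
    rw [hMdef]; nlinarith
  have hzr : ∀ i, |((((pt i).1:ℕ):ℝ) - (r:ℝ) * (((pt i).2:ℕ):ℝ))| ≤ r * T := by
    intro i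
    have h1 : (((pt i).1:ℕ):ℝ) ≤ r := by
      have := (pt i).1.2
      exact_mod_cast (by omega : ((pt i).1:ℕ) ≤ r)
    have h2 : (((pt i).2:ℕ):ℝ) ≤ T := by
      have := (pt i).2.2
      exact_mod_cast (by omega : ((pt i).2:ℕ) ≤ T)
    have h3 : (0:ℝ) ≤ (((pt i).1:ℕ):ℝ) := by positivity
    have h4 : (0:ℝ) ≤ (((pt i).2:ℕ):ℝ) := by positivity
    have h5 : (0:ℝ) ≤ r := by positivity
    have h6 : (1:ℝ) ≤ T := by exact_mod_cast hT
    rw [abs_le]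
    constructor <;> nlinarith
  have hpw : ∀ (x b : ℝ) (m : ℕ), |x| ≤ Real.exp b → |x ^ m| ≤ Real.exp (m * b) := by
    intro x b m h
    rw [abs_pow, Real.exp_nat_mul]
    exact pow_le_pow_left₀ (abs_nonneg _) h _
  have hMb : ∀ σ : Equiv.Perm (Fin 3), |MvPolynomial.aeval (fun i => α (σ i)) W.det| ≤ M := by
    intro σ
    rw [hev]
    have := det_abs_le (ι := ι) (Matrix.of fun i j : ι =>
      ((((pt i).1:ℕ):ℝ) - (r:ℝ) * (((pt i).2:ℕ):ℝ)) ^ (j.1:ℕ) *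
      ((MvPolynomial.aeval (fun i => α (σ i)) PE) ^ ((j.2:ℕ) * ((pt i).1:ℕ)) * (MvPolynomial.aeval (fun i => α (σ i)) PP) ^ ((j.2:ℕ) * ((pt i).2:ℕ)) *
        (MvPolynomial.aeval (fun i => α (σ i)) PR) ^ ((L - 1 - (j.2:ℕ)) * ((pt i).2:ℕ))))
      (fun j => ((j.1:ℕ):ℝ) * Zl + ((j.2:ℕ):ℝ) * (S * a1) + L * T * a2) ?_
    · rw [sumKL] at this
      simpa [ι] using this
    · intro i j
      simp only [Matrix.of_apply]
      rw [abs_mul, abs_mul, abs_mul]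
      have e1 := hpw _ _ (j.1:ℕ) ((hzr i).trans hZ.le)
      have e2 := hpw _ _ ((j.2:ℕ) * ((pt i).1:ℕ)) (hE σ)
      have e3 := hpw _ _ ((j.2:ℕ) * ((pt i).2:ℕ)) (hP σ)
      have e4 := hpw _ _ ((L - 1 - (j.2:ℕ)) * ((pt i).2:ℕ)) (hR σ)
      have hb1 : (((pt i).1:ℕ):ℝ) ≤ S := by exact_mod_cast (pt i).1.2.le
      have hb2 : (((pt i).2:ℕ):ℝ) ≤ T := by exact_mod_cast (pt i).2.2.le
      have hb3 : (((j.2:ℕ):ℝ)) + ((L - 1 - (j.2:ℕ) : ℕ):ℝ) ≤ L := by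
        have := j.2.2
        exact_mod_cast (by omega : (j.2:ℕ) + (L - 1 - (j.2:ℕ)) ≤ L)
      calc _ ≤ Real.exp ((j.1:ℕ) * Zl) * (Real.exp (((j.2:ℕ) * ((pt i).1:ℕ) : ℕ) * a1) *
            Real.exp (((j.2:ℕ) * ((pt i).2:ℕ) : ℕ) * a2) * Real.exp (((L - 1 - (j.2:ℕ)) * ((pt i).2:ℕ) : ℕ) * a2)) := by
            gcongr
        _ = Real.exp ((j.1:ℕ) * Zl + (((j.2:ℕ) * ((pt i).1:ℕ) : ℕ) * a1 +
            ((j.2:ℕ) * ((pt i).2:ℕ) : ℕ) * a2 + ((L - 1 - (j.2:ℕ)) * ((pt i).2:ℕ) : ℕ) * a2)) := by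
            rw [← Real.exp_add, ← Real.exp_add, ← Real.exp_add]
        _ ≤ _ := by
            apply Real.exp_le_exp.2
            push_cast
            have q1 : ((j.2:ℕ):ℝ) * ((pt i).1:ℕ) * a1 ≤ (j.2:ℕ) * (S * a1) := by
              rw [mul_assoc]; gcongr
            have q2 : ((((j.2:ℕ):ℝ)) + ((L - 1 - (j.2:ℕ) : ℕ):ℝ)) * (((pt i).2:ℕ):ℝ) * a2 ≤ L * T * a2 := by
              gcongr
            linarith
  have hl := liouville α hα f hmon hroot hall W.det hne M hM1 hMb
  refine hl.trans ?_
  apply mul_le_mul_of_nonneg_right _ (by positivity)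
  rw [hrow, abs_mul, mul_comm]
  apply mul_le_mul_of_nonneg_left _ (abs_nonneg _)
  rw [Finset.abs_prod]
  calc ∏ i : ι, |(MvPolynomial.aeval α PR) ^ ((L - 1) * ((pt i).2:ℕ))| ≤ ∏ i : ι, Real.exp (L * T * a2) := by
        apply Finset.prod_le_prod (fun _ _ => abs_nonneg _)
        intro i _
        refine (hpw _ a2 _ (hR 1)).trans ?_
        apply Real.exp_le_exp.2
        push_cast
        have hb2 : (((pt i).2:ℕ):ℝ) ≤ T := by exact_mod_cast (pt i).2.2.le
        have hb3 : ((L - 1 : ℕ) : ℝ) ≤ L := by exact_mod_cast Nat.sub_le _ _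
        gcongr
    _ = _ := by
        rw [Finset.prod_const, ← Real.exp_nat_mul]
        congr 1
        simp [ι]

end T12


open Finset Matrix

namespace T12

lemma exp2_lt : Real.exp 2 < 7.4 := by
  have h := Real.exp_one_lt_d9
  have : Real.exp 2 = Real.exp 1 * Real.exp 1 := by rw [← Real.exp_add]; norm_num
  rw [this]
  have := Real.exp_pos 1
  nlinarith

lemma log_fact_le (N : ℕ) (hN : 1 ≤ N) : ((N.factorial : ℕ) : ℝ) ≤ Real.exp (N * Real.log N) := by
  rw [Real.exp_nat_mul, Real.exp_log (by exact_mod_cast hN)]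
  exact_mod_cast Nat.factorial_le_pow N

set_option maxHeartbeats 1000000 in
theorem baker (α : Fin 3 → ℝ) (hα : Function.Injective α)
    (f : Polynomial ℤ) (hmon : f.Monic) (hroot : ∀ i, Polynomial.aeval (α i) f = 0)
    (hall : ∀ x : ℂ, Polynomial.aeval x f = 0 → ∃ i, x = (α i : ℂ))
    (PE PP PR : MvPolynomial (Fin 3) ℤ) (L r A1 A2 : ℕ)
    (hE : ∀ σ : Equiv.Perm (Fin 3), |MvPolynomial.aeval (fun i => α (σ i)) PE| ≤ Real.exp A1)
    (hP : ∀ σ : Equiv.Perm (Fin 3), |MvPolynomial.aeval (fun i => α (σ i)) PP| ≤ Real.exp A2)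
    (hR : ∀ σ : Equiv.Perm (Fin 3), |MvPolynomial.aeval (fun i => α (σ i)) PR| ≤ Real.exp A2)
    (E G : ℝ) (hEdef : E = MvPolynomial.aeval α PE)
    (hGdef : G = MvPolynomial.aeval α PP / MvPolynomial.aeval α PR)
    (hR0 : MvPolynomial.aeval α PR ≠ 0)
    (hE0 : 0 < E) (hE1 : E ≠ 1) (hG0 : 0 < G) (hlogG : |Real.log G| ≤ A2)
    (hA1 : 1 ≤ A1) (hA2 : 10 ≤ A2) (hr : 61 * L * A2 ≤ r)
    (hL : 6 * Real.log (r * (24 * L * A1)) + 4 ≤ L)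
    (hΛ : 2 * (L * (24 * L * A1) * |r * Real.log E + Real.log G|) * Real.exp (2600 * L * L * A1 * A2) ≤ 1) :
    False := by
  have hL0 : 0 < L := by
    rcases Nat.eq_zero_or_pos L with h | h
    · subst h; norm_num at hL
    · exact h
  obtain ⟨K, hKdef⟩ : ∃ K, K = 1300 * L * A1 * A2 := ⟨_, rfl⟩
  obtain ⟨T, hTdef⟩ : ∃ T, T = 24 * L * A1 := ⟨_, rfl⟩
  have hK : 0 < K := by rw [hKdef]; positivity
  have hT : 1 ≤ T := Nat.succ_le_of_lt (by rw [hTdef]; positivity)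
  have hSL : 60 * L * A2 + L ≤ r := by
    have : L ≤ L * A2 := Nat.le_mul_of_pos_right _ (by omega)
    linarith
  have hze := zero_estimate K L (60 * L * A2) T r E G hE0 hE1 hG0 hSL hK hL0 (by
    rw [hKdef, hTdef]
    have : 0 ≤ L * L * A1 * A2 := Nat.zero_le _
    linarith)
  obtain ⟨S, hS⟩ : ∃ S, S = 60 * L * A2 + L := ⟨_, rfl⟩
  rw [← hS] at hSL
  rw [← hS] at hze
  obtain ⟨pt, hpt⟩ := hze
  have hr0 : (0:ℝ) < r := by
    have : 0 < 61 * L * A2 := by positivity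
    exact_mod_cast (by omega : 0 < r)
  have hT1 : (1:ℝ) ≤ T := by exact_mod_cast hT
  have hr1 : (1:ℝ) ≤ r := by exact_mod_cast (by exact_mod_cast hr0 : 0 < r)
  set Zl := Real.log (r * T) with hZl
  have hZl0 : 0 ≤ Zl := Real.log_nonneg (one_le_mul_of_one_le_of_one_le hr1 hT1)
  have hZ : ((r:ℝ) * T) = Real.exp Zl := by rw [hZl, Real.exp_log (by positivity)]
  have hTc : (T:ℝ) = 24 * L * A1 := by rw [hTdef]; push_cast; ring
  have hKc : (K:ℝ) = 1300 * L * A1 * A2 := by rw [hKdef]; push_cast; ring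
  have hL6 : 6 * Zl + 4 ≤ L := by rw [hZl, hTc]; exact hL
  have hptinj : Function.Injective pt := by
    intro i j hij
    by_contra hne
    apply hpt
    apply Matrix.det_zero_of_row_eq hne
    funext k
    simp only [Matrix.of_apply, hij]
  set Δ := (Matrix.of fun i j : Fin K × Fin L => (((pt i).1:ℕ) - (r:ℝ) * ((pt i).2:ℕ))^(j.1:ℕ) *
      (E^((pt i).1:ℕ) * G^((pt i).2:ℕ))^(j.2:ℕ)).det with hΔ
  have hlow := delta_lower α hα f hmon hroot hall PE PP PR K L S T r A1 A2 Zl (by positivity) (by positivity)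
    hZl0 pt hSL hT hK hL0 hZ hE hP hR hR0 Δ (by rw [hΔ, hEdef, hGdef]) hpt
  have hup := delta_upper K L S T r (Real.log E) (Real.log G) Zl pt hSL hT hK hL0 hZ (by
    rw [hTc, hKc]
    convert hΛ using 3
    ring) hptinj
  rw [Real.exp_log hE0, Real.exp_log hG0, ← hΔ] at hup
  have hLam : |(r:ℝ) * Real.log E + Real.log G| ≤ 1 := by
    have h1 : (1:ℝ) ≤ Real.exp (2600 * L * L * A1 * A2) := Real.one_le_exp (by positivity)
    have h2 : (1:ℝ) ≤ L * (24 * L * A1) := by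
      have : 1 ≤ L * (24 * L * A1) := Nat.succ_le_of_lt (by positivity)
      exact_mod_cast this
    have h3 := abs_nonneg ((r:ℝ) * Real.log E + Real.log G)
    by_contra hcon
    push Not at hcon
    have h4 : 1 < L * (24 * L * A1) * |(r:ℝ) * Real.log E + Real.log G| :=
      lt_of_lt_of_le hcon (le_mul_of_one_le_left h3 h2)
    have h5 := le_mul_of_one_le_right (show 0 ≤ 2 * (L * (24 * L * A1) * |(r:ℝ) * Real.log E + Real.log G|) by positivity) h1
    linarith
  have hc : |Real.log E| * (r * T) ≤ (A2 + 1) * T := by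
    have : |(r:ℝ) * Real.log E| ≤ A2 + 1 := by
      have : (r:ℝ) * Real.log E = ((r:ℝ) * Real.log E + Real.log G) - Real.log G := by ring
      rw [this]
      exact (abs_sub _ _).trans (by linarith)
    rw [abs_mul, abs_of_pos hr0] at this
    have h2 := mul_le_mul_of_nonneg_right this (show (0:ℝ) ≤ T by positivity)
    linarith
  -- combine
  set N := K * L with hNdef
  have hN1 : 1 ≤ N := Nat.succ_le_of_lt (by positivity)
  have hNc : (N:ℝ) = K * L := by rw [hNdef]; push_cast; ring
  have hfac := log_fact_le N hN1
  set lN := Real.log N with hlN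
  rw [← hNc] at hlow hup
  set X := ((K:ℝ) - 1) / 2 * (2 + Zl) + ((L:ℝ) - 1) / 2 * (Real.exp 2 * |Real.log E| * (r * T)) + Real.log 2 with hX
  set Y := ((K:ℝ) - 1) / 2 * Zl + ((L:ℝ) - 1) / 2 * (S * A1) + L * T * A2 with hY
  have hup2 : |Δ| * Real.exp (N * (N - 1)) ≤ Real.exp (N * lN + N * X) := by
    refine hup.trans ?_
    rw [Real.exp_add]
    gcongr
  have hlow2 : 1 ≤ |Δ| * Real.exp (N * (L * T * A2) + 5 * (N * lN + N * Y)) := by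
    refine hlow.trans ?_
    rw [Real.exp_add, mul_assoc]
    have : Real.exp (5 * (N * lN + N * Y)) = (Real.exp (N * lN) * Real.exp (N * Y)) ^ 5 := by
      rw [← Real.exp_add, ← Real.exp_nat_mul]; norm_num
    rw [this]
    gcongr
  have hfin : (1:ℝ) ≤ Real.exp (N * lN + N * X + (N * (L * T * A2) + 5 * (N * lN + N * Y)) - N * (N - 1)) := by
    rw [Real.exp_sub, Real.exp_add, le_div_iff₀ (Real.exp_pos _), one_mul]
    set W := Real.exp (N * (L * T * A2) + 5 * (N * lN + N * Y))
    calc Real.exp (N * (N - 1)) ≤ (|Δ| * W) * Real.exp (N * (N - 1)) :=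
          le_mul_of_one_le_left (Real.exp_pos _).le hlow2
      _ = (|Δ| * Real.exp (N * (N - 1))) * W := by ring
      _ ≤ _ := by gcongr
  have hexp0 : 0 ≤ N * lN + N * X + (N * (L * T * A2) + 5 * (N * lN + N * Y)) - N * ((N:ℝ) - 1) := by
    by_contra hneg
    push Not at hneg
    have := Real.exp_lt_exp.2 hneg
    rw [Real.exp_zero] at this
    linarith
  have hNpos : (0:ℝ) < N := by exact_mod_cast hN1
  have hdiv : (N:ℝ) - 1 ≤ 6 * lN + X + L * T * A2 + 5 * Y := by
    have : 0 ≤ (N:ℝ) * (6 * lN + X + L * T * A2 + 5 * Y - (N - 1)) := by linarith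
    have := nonneg_of_mul_nonneg_right this hNpos
    linarith
  clear hup2 hlow2 hfin hexp0 hup hlow hfac hΛ hptinj hpt
  clear_value Δ
  have hLr : (1:ℝ) ≤ L := by exact_mod_cast hL0
  have hA1r : (1:ℝ) ≤ A1 := by exact_mod_cast hA1
  have hA2r : (10:ℝ) ≤ A2 := by exact_mod_cast hA2
  have hKpos : (0:ℝ) < K := by exact_mod_cast hK
  set U : ℝ := L * L * A1 * A2 with hU
  have hNU : (N:ℝ) = 1300 * U := by rw [hNc, hKc, hU]; ring
  have hLTA : (L:ℝ) * T * A2 = 24 * U := by rw [hTc, hU]; ring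
  have hU10 : 10 ≤ U := by
    have h1 : (1:ℝ) ≤ L * L := one_le_mul_of_one_le_of_one_le hLr hLr
    have h2 : (1:ℝ) ≤ L * L * A1 := one_le_mul_of_one_le_of_one_le h1 hA1r
    have h3 := mul_le_mul h2 hA2r (by norm_num) (by positivity)
    rw [hU]; linarith
  have hlNle : lN ≤ U + 7 := by
    have h1 : Real.log ((N:ℝ) / 1300) ≤ (N:ℝ) / 1300 - 1 := Real.log_le_sub_one_of_pos (by positivity)
    rw [Real.log_div (by positivity) (by norm_num)] at h1
    have h2 : Real.log 1300 ≤ 7.7 := by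
      have : (1300:ℝ) ≤ 2 ^ 11 := by norm_num
      have h3 := Real.log_le_log (by norm_num) this
      rw [Real.log_pow] at h3
      have := Real.log_two_lt_d9
      push_cast at h3
      linarith
    have h3 : (N:ℝ) / 1300 = U := by rw [hNU]; ring
    rw [h3] at h1
    linarith
  have hXle : X ≤ K / 2 * (2 + Zl) + 97.7 * U + 1 := by
    have h1 : ((L:ℝ) - 1) / 2 * (Real.exp 2 * |Real.log E| * (r * T)) ≤ L / 2 * (7.4 * ((A2 + 1) * T)) := by
      have h2 : Real.exp 2 * |Real.log E| * (r * T) ≤ 7.4 * ((A2 + 1) * T) := by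
        rw [mul_assoc]
        exact mul_le_mul exp2_lt.le hc (by positivity) (by norm_num)
      have h3 : 0 ≤ Real.exp 2 * |Real.log E| * (r * T) := by positivity
      exact mul_le_mul (by linarith) h2 h3 (by linarith)
    have h4 : (L:ℝ) / 2 * (7.4 * ((A2 + 1) * T)) ≤ 97.7 * U := by
      have h5 : ((A2:ℝ) + 1) ≤ 1.1 * A2 := by linarith
      have h6 : (L:ℝ) / 2 * (7.4 * ((A2 + 1) * T)) ≤ L / 2 * (7.4 * ((1.1 * A2) * T)) := by gcongr
      have h7 : (L:ℝ) / 2 * (7.4 * ((1.1 * A2) * T)) = 4.07 * (L * T * A2) := by ring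
      rw [h7, hLTA] at h6
      linarith
    have h8 : ((K:ℝ) - 1) / 2 * (2 + Zl) ≤ K / 2 * (2 + Zl) := by
      apply mul_le_mul_of_nonneg_right _ (by linarith)
      linarith
    have h9 : Real.log 2 ≤ 1 := by have := Real.log_two_lt_d9; linarith
    rw [hX]; linarith
  have hYle : Y ≤ K / 2 * Zl + 30.5 * U + 24 * U := by
    have h1 : ((L:ℝ) - 1) / 2 * (S * A1) ≤ 30.5 * U := by
      have h2 : (S:ℝ) ≤ 61 * L * A2 := by
        rw [hS]; push_cast
        have := le_mul_of_one_le_right (show (0:ℝ) ≤ L by positivity) (show (1:ℝ) ≤ A2 by linarith)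
        linarith
      calc ((L:ℝ) - 1) / 2 * (S * A1) ≤ L / 2 * ((61 * L * A2) * A1) := by
            apply mul_le_mul (by linarith) _ (by positivity) (by positivity)
            gcongr
        _ = 30.5 * U := by rw [hU]; ring
    have h8 : ((K:ℝ) - 1) / 2 * Zl ≤ K / 2 * Zl := by
      apply mul_le_mul_of_nonneg_right _ (by linarith)
      linarith
    rw [hY, hLTA]; linarith
  have hKL : (K:ℝ) * (3 * Zl + 2) ≤ 650 * U := by
    have : (K:ℝ) * (3 * Zl + 2) ≤ K * (L / 2) := by
      apply mul_le_mul_of_nonneg_left _ hKpos.le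
      linarith
    have h2 : (K:ℝ) * (L / 2) = 650 * U := by rw [hKc, hU]; ring
    linarith
  rw [hNU, hLTA] at hdiv
  linarith

end T12


open Finset Matrix

namespace T12

structure Gen (a b : ℤ) (al : Fin 3 → ℝ) (l1 l2 e : ℝ) : Prop where
  s1 : al 0 + al 1 + al 2 = a + b
  s2 : al 0 * al 1 + al 0 * al 2 + al 1 * al 2 = a * b
  s3 : al 0 * al 1 * al 2 = 1
  p0 : |Real.log |al 0| + (l1 + l2)| ≤ 2 * e
  q0 : |Real.log |al 0 - a| - l1| ≤ e
  p1 : |Real.log |al 1| - l1| ≤ e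
  q1 : |Real.log |al 1 - a| + (l1 + l2)| ≤ 2 * e
  p2 : |Real.log |al 2| - l2| ≤ e
  q2 : |Real.log |al 2 - a| - l2| ≤ e
  d01 : |Real.log |al 0 - al 1| - l1| ≤ e
  d02 : |Real.log |al 0 - al 2| - l2| ≤ e
  d12 : |Real.log |al 1 - al 2| - l2| ≤ e
  h0 : |al 0| < 1
  hl2 : 693 ≤ l2
  hl1 : 0.69 * l2 ≤ l1
  hl1' : l1 ≤ 0.7 * l2
  he0 : 0 ≤ e
  he : e ≤ 1e-9

lemma ne_of_log {x : ℝ} (h : Real.log |x| ≠ 0) : x ≠ 0 := by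
  rintro rfl; simp at h

namespace Gen

variable {a b : ℤ} {al : Fin 3 → ℝ} {l1 l2 e : ℝ}

lemma root (G : Gen a b al l1 l2 e) (i : Fin 3) : al i * (al i - a) * (al i - b) = 1 := by
  have h : ∀ X : ℝ, (X - al 0) * (X - al 1) * (X - al 2) = X * (X - a) * (X - b) - 1 := by
    intro X
    linear_combination (-X^2) * G.s1 + X * G.s2 - G.s3
  fin_cases i
  · have := h (al 0); simp at this ⊢; linarith
  · have := h (al 1); simp at this ⊢; linarith
  · have := h (al 2); simp at this ⊢; linarith

lemma ne (G : Gen a b al l1 l2 e) (i : Fin 3) : al i ≠ 0 := by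
  have := G.root i
  intro h; rw [h] at this; simp at this

lemma ne' (G : Gen a b al l1 l2 e) (i : Fin 3) : al i - a ≠ 0 := by
  have := G.root i
  intro h; rw [h] at this; simp at this

lemma n01 (G : Gen a b al l1 l2 e) : al 0 - al 1 ≠ 0 := by
  apply ne_of_log
  have := abs_le.1 G.d01; have := G.hl2; have := G.hl1; have := G.he
  intro h; linarith

lemma n02 (G : Gen a b al l1 l2 e) : al 0 - al 2 ≠ 0 := by
  apply ne_of_log
  have := abs_le.1 G.d02; have := G.hl2; have := G.hl1; have := G.he
  intro h; linarith

lemma n12 (G : Gen a b al l1 l2 e) : al 1 - al 2 ≠ 0 := by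
  apply ne_of_log
  have := abs_le.1 G.d12; have := G.hl2; have := G.hl1; have := G.he
  intro h; linarith

lemma inj (G : Gen a b al l1 l2 e) : Function.Injective al := by
  have h1 := G.n01; have h2 := G.n02; have h3 := G.n12
  intro i j hij
  fin_cases i <;> fin_cases j <;> simp at hij ⊢ <;>
    first
    | exact h1 (by linarith)
    | exact h2 (by linarith)
    | exact h3 (by linarith)

end Gen

/-- membership in the order -/
def InR (al : Fin 3 → ℝ) (g : Fin 3 → ℝ) : Prop :=
  ∃ X Y Z : ℤ, ∀ i, g i = X + Y * al i + Z * (al i) ^ 2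

lemma InR.mul {a b : ℤ} {al : Fin 3 → ℝ} {l1 l2 e : ℝ} (G : Gen a b al l1 l2 e) {g h : Fin 3 → ℝ}
    (hg : InR al g) (hh : InR al h) : InR al (fun i => g i * h i) := by
  obtain ⟨X, Y, Z, hg⟩ := hg
  obtain ⟨X', Y', Z', hh⟩ := hh
  -- x^3 = s x^2 - t x + 1
  refine ⟨X * X' + (Y * Z' + Z * Y') + Z * Z' * (a + b),
    X * Y' + Y * X' - (Y * Z' + Z * Y') * (a * b) + Z * Z' * (1 - (a + b) * (a * b)),
    X * Z' + Z * X' + Y * Y' + (Y * Z' + Z * Y') * (a + b) + Z * Z' * ((a + b) ^ 2 - a * b), ?_⟩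
  intro i
  have hr := G.root i
  show g i * h i = _
  rw [hg, hh]
  push_cast
  linear_combination ((Y * Z' + Z * Y') + Z * Z' * al i + Z * Z' * (a + b)) * hr

lemma InR.pow {a b : ℤ} {al : Fin 3 → ℝ} {l1 l2 e : ℝ} (G : Gen a b al l1 l2 e) {g : Fin 3 → ℝ}
    (hg : InR al g) (k : ℕ) : InR al (fun i => g i ^ k) := by
  induction k with
  | zero => exact ⟨1, 0, 0, by intro i; simp⟩
  | succ k ih =>
    have := ih.mul G hg
    simpa only [pow_succ] using this

lemma InR.zpow {a b : ℤ} {al : Fin 3 → ℝ} {l1 l2 e : ℝ} (G : Gen a b al l1 l2 e) {g : Fin 3 → ℝ}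
    (hg : InR al g) (hg' : InR al (fun i => (g i)⁻¹)) (k : ℤ) : InR al (fun i => g i ^ k) := by
  obtain ⟨m, rfl | rfl⟩ := k.eq_nat_or_neg
  · simpa using hg.pow G m
  · simpa using hg'.pow G m

lemma InR.unit1 {a b : ℤ} {al : Fin 3 → ℝ} {l1 l2 e : ℝ} (G : Gen a b al l1 l2 e) (k : ℤ) :
    InR al (fun i => al i ^ k) := by
  apply InR.zpow G
  · exact ⟨0, 1, 0, by intro i; simp⟩
  · refine ⟨a * b, -(a + b), 1, ?_⟩
    intro i
    have := G.root i
    have h := G.ne i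
    apply inv_eq_of_mul_eq_one_left
    push_cast
    linarith

lemma InR.unit2 {a b : ℤ} {al : Fin 3 → ℝ} {l1 l2 e : ℝ} (G : Gen a b al l1 l2 e) (k : ℤ) :
    InR al (fun i => (al i - a) ^ k) := by
  apply InR.zpow G
  · exact ⟨-a, 1, 0, by intro i; push_cast; ring⟩
  · refine ⟨0, -b, 1, ?_⟩
    intro i
    have := G.root i
    have h := G.ne' i
    apply inv_eq_of_mul_eq_one_left
    push_cast
    linarith

set_option maxHeartbeats 1000000 in
theorem units {a b : ℤ} {al : Fin 3 → ℝ} {l1 l2 e : ℝ} (G : Gen a b al l1 l2 e) (x y : ℤ)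
    (hN : |(x - al 0 * y) * (x - al 1 * y) * (x - al 2 * y)| = 1) :
    ∃ b1 b2 : ℤ, ∃ s : ℝ, (s = 1 ∨ s = -1) ∧
      ∀ i, (x:ℝ) - al i * y = s * (al i ^ b1 * (al i - a) ^ b2) := by
  have hβ : ∀ i, (x:ℝ) - al i * y ≠ 0 := by
    intro i h
    have h2 : (x - al 0 * y) * (x - al 1 * y) * (x - al 2 * y) = (0:ℝ) := by
      fin_cases i <;> simp at h <;> rw [h] <;> ring
    rw [h2] at hN; simp at hN
  obtain ⟨B, hB⟩ : ∃ B : Fin 3 → ℝ, ∀ i, B i = Real.log |(x:ℝ) - al i * y| := ⟨_, fun i => rfl⟩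
  obtain ⟨P, hP⟩ : ∃ P : Fin 3 → ℝ, ∀ i, P i = Real.log |al i| := ⟨_, fun i => rfl⟩
  obtain ⟨Q, hQ⟩ : ∃ Q : Fin 3 → ℝ, ∀ i, Q i = Real.log |al i - a| := ⟨_, fun i => rfl⟩
  have sB : B 0 + B 1 + B 2 = 0 := by
    rw [hB, hB, hB, ← Real.log_mul, ← Real.log_mul, ← abs_mul, ← abs_mul, hN, Real.log_one]
    · exact mul_ne_zero (abs_ne_zero.2 (hβ 0)) (abs_ne_zero.2 (hβ 1))
    · exact abs_ne_zero.2 (hβ 2)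
    · exact abs_ne_zero.2 (hβ 0)
    · exact abs_ne_zero.2 (hβ 1)
  have sP : P 0 + P 1 + P 2 = 0 := by
    rw [hP, hP, hP, ← Real.log_mul, ← Real.log_mul, ← abs_mul, ← abs_mul, G.s3, abs_one, Real.log_one]
    · exact mul_ne_zero (abs_ne_zero.2 (G.ne 0)) (abs_ne_zero.2 (G.ne 1))
    · exact abs_ne_zero.2 (G.ne 2)
    · exact abs_ne_zero.2 (G.ne 0)
    · exact abs_ne_zero.2 (G.ne 1)
  have sQ : Q 0 + Q 1 + Q 2 = 0 := by
    have h1 : (al 0 - a) * (al 1 - a) * (al 2 - a) = 1 := by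
      linear_combination G.s3 - a * G.s2 + a ^ 2 * G.s1
    rw [hQ, hQ, hQ, ← Real.log_mul, ← Real.log_mul, ← abs_mul, ← abs_mul, h1, abs_one, Real.log_one]
    · exact mul_ne_zero (abs_ne_zero.2 (G.ne' 0)) (abs_ne_zero.2 (G.ne' 1))
    · exact abs_ne_zero.2 (G.ne' 2)
    · exact abs_ne_zero.2 (G.ne' 0)
    · exact abs_ne_zero.2 (G.ne' 1)
  have hP0 := abs_le.1 G.p0
  have hP1 := abs_le.1 G.p1
  have hP2 := abs_le.1 G.p2
  have hQ0 := abs_le.1 G.q0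
  have hQ1 := abs_le.1 G.q1
  have hQ2 := abs_le.1 G.q2
  rw [← hP] at hP0 hP1 hP2
  rw [← hQ] at hQ0 hQ1 hQ2
  have hl2 := G.hl2
  have hl1 := G.hl1
  have hl1' := G.hl1'
  have he0 := G.he0
  have he := G.he
  have hdet : 0 < P 0 * Q 1 - Q 0 * P 1 := by
    have h1 : (l1 + l2 - 2 * e) * (l1 + l2 - 2 * e) ≤ (- P 0) * (- Q 1) :=
      mul_le_mul (by linarith) (by linarith) (by linarith) (by linarith)
    have h2 : Q 0 * P 1 ≤ (l1 + e) * (l1 + e) :=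
      mul_le_mul (by linarith) (by linarith) (by linarith) (by linarith)
    have h3 : (l1 + e) * (l1 + e) < (l1 + l2 - 2 * e) * (l1 + l2 - 2 * e) :=
      mul_lt_mul'' (by linarith) (by linarith) (by linarith) (by linarith)
    linarith
  obtain ⟨c1, hc1⟩ : ∃ c, c = (B 0 * Q 1 - Q 0 * B 1) / (P 0 * Q 1 - Q 0 * P 1) := ⟨_, rfl⟩
  obtain ⟨c2, hc2⟩ : ∃ c, c = (P 0 * B 1 - P 1 * B 0) / (P 0 * Q 1 - Q 0 * P 1) := ⟨_, rfl⟩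
  have e0 : B 0 = c1 * P 0 + c2 * Q 0 := by
    rw [hc1, hc2, div_mul_eq_mul_div, div_mul_eq_mul_div, ← add_div, eq_div_iff hdet.ne']; ring
  have e1 : B 1 = c1 * P 1 + c2 * Q 1 := by
    rw [hc1, hc2, div_mul_eq_mul_div, div_mul_eq_mul_div, ← add_div, eq_div_iff hdet.ne']; ring
  have e2 : B 2 = c1 * P 2 + c2 * Q 2 := by
    linear_combination sB - e0 - e1 - c1 * sP - c2 * sQ
  have eall : ∀ i, B i = c1 * P i + c2 * Q i := by
    intro i; fin_cases i
    · exact e0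
    · exact e1
    · exact e2
  obtain ⟨t1, ht1⟩ : ∃ t, t = c1 - round c1 := ⟨_, rfl⟩
  obtain ⟨t2, ht2⟩ : ∃ t, t = c2 - round c2 := ⟨_, rfl⟩
  have hb1 := abs_le.1 (abs_sub_round c1)
  have hb2 := abs_le.1 (abs_sub_round c2)
  rw [← ht1] at hb1
  rw [← ht2] at hb2
  obtain ⟨ε, hε⟩ : ∃ ε : Fin 3 → ℝ, ∀ i, ε i = ((x:ℝ) - al i * y) * al i ^ (-round c1) * (al i - a) ^ (-round c2) :=
    ⟨_, fun i => rfl⟩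
  have hε0 : ∀ i, ε i ≠ 0 := by
    intro i; rw [hε]
    exact mul_ne_zero (mul_ne_zero (hβ i) (zpow_ne_zero _ (G.ne i))) (zpow_ne_zero _ (G.ne' i))
  have hlogε : ∀ i, Real.log |ε i| = t1 * P i + t2 * Q i := by
    intro i
    rw [hε, abs_mul, abs_mul, abs_zpow, abs_zpow, Real.log_mul, Real.log_mul, Real.log_zpow, Real.log_zpow,
      ← hB, ← hP, ← hQ, eall, ht1, ht2]
    · push_cast; ring
    · exact abs_ne_zero.2 (hβ i)
    · exact zpow_ne_zero _ (abs_ne_zero.2 (G.ne i))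
    · exact mul_ne_zero (abs_ne_zero.2 (hβ i)) (zpow_ne_zero _ (abs_ne_zero.2 (G.ne i)))
    · exact zpow_ne_zero _ (abs_ne_zero.2 (G.ne' i))
  have hexp : ∀ i, |ε i| = Real.exp (t1 * P i + t2 * Q i) := by
    intro i; rw [← hlogε, Real.exp_log (abs_pos.2 (hε0 i))]
  have hmem : InR al ε := by
    have h1 : InR al (fun i => (x:ℝ) - al i * y) := ⟨x, -y, 0, by intro i; push_cast; ring⟩
    have h2 := (h1.mul G (InR.unit1 G (-round c1))).mul G (InR.unit2 G (-round c2))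
    have h3 : ε = fun i => ((x:ℝ) - al i * y) * al i ^ (-round c1) * (al i - a) ^ (-round c2) := funext hε
    rw [h3]; exact h2
  obtain ⟨X, Y, Z, hXYZ⟩ := hmem
  obtain ⟨E, hE⟩ : ∃ E : Fin 3 → ℝ, ∀ i, E i = t1 * P i + t2 * Q i := ⟨_, fun i => rfl⟩
  have hexpE : ∀ i, |ε i| = Real.exp (E i) := by intro i; rw [hexp, hE]
  -- bounds for E
  have tb : ∀ (t w d : ℝ), |t| ≤ 1 / 2 → |w| ≤ d → |t * w| ≤ d / 2 := by
    intro t w d h1 h2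
    rw [abs_mul]
    calc |t| * |w| ≤ 1 / 2 * d := mul_le_mul h1 h2 (abs_nonneg _) (by norm_num)
      _ = d / 2 := by ring
  have ht1' : |t1| ≤ 1 / 2 := abs_le.2 hb1
  have ht2' : |t2| ≤ 1 / 2 := abs_le.2 hb2
  have E0 : |E 0 - (-(t1 * (l1 + l2)) + t2 * l1)| ≤ 2 * e := by
    have h1 := abs_le.1 (tb t1 _ _ ht1' (G.p0))
    have h2 := abs_le.1 (tb t2 _ _ ht2' (G.q0))
    rw [← hP] at h1
    rw [← hQ] at h2
    rw [hE, abs_le]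
    constructor <;> linarith
  have E1 : |E 1 - (t1 * l1 - t2 * (l1 + l2))| ≤ 2 * e := by
    have h1 := abs_le.1 (tb t1 _ _ ht1' (G.p1))
    have h2 := abs_le.1 (tb t2 _ _ ht2' (G.q1))
    rw [← hP] at h1
    rw [← hQ] at h2
    rw [hE, abs_le]
    constructor <;> linarith
  have E2 : |E 2 - (t1 + t2) * l2| ≤ e := by
    have h1 := abs_le.1 (tb t1 _ _ ht1' (G.p2))
    have h2 := abs_le.1 (tb t2 _ _ ht2' (G.q2))
    rw [← hP] at h1
    rw [← hQ] at h2
    rw [hE, abs_le]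
    constructor <;> linarith
  have E0' := abs_le.1 E0
  have E1' := abs_le.1 E1
  have E2' := abs_le.1 E2
  have sE : E 0 + E 1 + E 2 = 0 := by
    rw [hE, hE, hE]; linear_combination t1 * sP + t2 * sQ
  have m1 := abs_le.1 (tb t1 (l1 + l2) (l1 + l2) ht1' (abs_of_nonneg (by linarith)).le)
  have m2 := abs_le.1 (tb t2 (l1 + l2) (l1 + l2) ht2' (abs_of_nonneg (by linarith)).le)
  have m3 := abs_le.1 (tb t1 l1 l1 ht1' (abs_of_nonneg (by linarith)).le)
  have m4 := abs_le.1 (tb t2 l1 l1 ht2' (abs_of_nonneg (by linarith)).le)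
  have m5 := abs_le.1 (tb t1 l2 l2 ht1' (abs_of_nonneg (by linarith)).le)
  have m6 := abs_le.1 (tb t2 l2 l2 ht2' (abs_of_nonneg (by linarith)).le)
  have d01 := abs_le.1 G.d01
  have d02 := abs_le.1 G.d02
  have d12 := abs_le.1 G.d12
  have x01 : |al 0 - al 1| = Real.exp (Real.log |al 0 - al 1|) := (Real.exp_log (abs_pos.2 G.n01)).symm
  have x02 : |al 0 - al 2| = Real.exp (Real.log |al 0 - al 2|) := (Real.exp_log (abs_pos.2 G.n02)).symm
  have x12 : |al 1 - al 2| = Real.exp (Real.log |al 1 - al 2|) := (Real.exp_log (abs_pos.2 G.n12)).symm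
  have hexp2 : (3:ℝ) ≤ Real.exp 2 := by have := Real.add_one_le_exp (2:ℝ); linarith
  have hexp1 : (2:ℝ) ≤ Real.exp 1 := by have := Real.add_one_le_exp (1:ℝ); linarith
  have hZ : Z = 0 := by
    by_contra hne
    have hZ1 : (1:ℝ) ≤ |(Z:ℝ)| := by exact_mod_cast Int.one_le_abs hne
    have hid : (Z:ℝ) * ((al 0 - al 1) * (al 0 - al 2) * (al 1 - al 2)) =
        ε 0 * (al 1 - al 2) - ε 1 * (al 0 - al 2) + ε 2 * (al 0 - al 1) := by
      rw [hXYZ, hXYZ, hXYZ]; ring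
    have hL : Real.exp (l1 + 2 * l2 - 1) ≤ |(Z:ℝ) * ((al 0 - al 1) * (al 0 - al 2) * (al 1 - al 2))| := by
      rw [abs_mul, abs_mul, abs_mul, x01, x02, x12, ← Real.exp_add, ← Real.exp_add]
      refine le_trans ?_ (le_mul_of_one_le_left (Real.exp_pos _).le hZ1)
      apply Real.exp_le_exp.2; linarith
    have hR : |ε 0 * (al 1 - al 2) - ε 1 * (al 0 - al 2) + ε 2 * (al 0 - al 1)| ≤ 3 * Real.exp (l1 + 1.5 * l2 + 1) := by
      have k0 : |ε 0 * (al 1 - al 2)| ≤ Real.exp (l1 + 1.5 * l2 + 1) := by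
        rw [abs_mul, hexpE, x12, ← Real.exp_add]
        apply Real.exp_le_exp.2; linarith
      have k1 : |ε 1 * (al 0 - al 2)| ≤ Real.exp (l1 + 1.5 * l2 + 1) := by
        rw [abs_mul, hexpE, x02, ← Real.exp_add]
        apply Real.exp_le_exp.2; linarith
      have k2 : |ε 2 * (al 0 - al 1)| ≤ Real.exp (l1 + 1.5 * l2 + 1) := by
        rw [abs_mul, hexpE, x01, ← Real.exp_add]
        apply Real.exp_le_exp.2; linarith
      rw [abs_le] at k0 k1 k2 ⊢
      constructor <;> linarith
    rw [hid] at hL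
    have h3 : 3 * Real.exp (l1 + 1.5 * l2 + 1) ≤ Real.exp (l1 + 1.5 * l2 + 3) := by
      have : Real.exp (l1 + 1.5 * l2 + 3) = Real.exp 2 * Real.exp (l1 + 1.5 * l2 + 1) := by
        rw [← Real.exp_add]; congr 1; ring
      rw [this]; gcongr
    have h4 := Real.exp_le_exp.1 (hL.trans (hR.trans h3))
    linarith
  have hY : Y = 0 := by
    by_contra hne
    have hY1 : (1:ℝ) ≤ |(Y:ℝ)| := by exact_mod_cast Int.one_le_abs hne
    have hdiff : ∀ i j, |al i - al j| ≤ |ε i| + |ε j| := by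
      intro i j
      have h1 : ε i - ε j = Y * (al i - al j) := by
        rw [hXYZ, hXYZ, hZ]; push_cast; ring
      calc |al i - al j| ≤ |(Y:ℝ)| * |al i - al j| := le_mul_of_one_le_left (abs_nonneg _) hY1
        _ = |ε i - ε j| := by rw [h1, abs_mul]
        _ ≤ _ := abs_sub _ _
    by_cases hcase : E 2 < l2 - 5
    · have hbig : ∀ w : ℝ, Real.exp (l2 - 1) ≤ Real.exp w + Real.exp (E 2) → l2 - 2 < w := by
        intro w hw
        by_contra hcon
        push Not at hcon
        have h1 : Real.exp w ≤ Real.exp (l2 - 2) := Real.exp_le_exp.2 hcon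
        have h2 : Real.exp (E 2) < Real.exp (l2 - 2) := Real.exp_lt_exp.2 (by linarith)
        have h3 : Real.exp (l2 - 1) = Real.exp 1 * Real.exp (l2 - 2) := by
          rw [← Real.exp_add]; congr 1; ring
        have h4 := mul_le_mul_of_nonneg_right hexp1 (Real.exp_pos (l2 - 2)).le
        linarith
      have h0 := hdiff 0 2
      have h1 := hdiff 1 2
      rw [x02, hexpE, hexpE] at h0
      rw [x12, hexpE, hexpE] at h1
      have h0' := hbig (E 0) (le_trans (Real.exp_le_exp.2 (by linarith)) h0)
      have h1' := hbig (E 1) (le_trans (Real.exp_le_exp.2 (by linarith)) h1)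
      linarith
    · push Not at hcase
      have ht1p : 0 ≤ t1 := by
        by_contra hneg
        push Not at hneg
        have := mul_neg_of_neg_of_pos hneg (show 0 < l2 by linarith)
        linarith
      have ht2p : 0 ≤ t2 := by
        by_contra hneg
        push Not at hneg
        have := mul_neg_of_neg_of_pos hneg (show 0 < l2 by linarith)
        linarith
      have w1 : 0 ≤ t1 * l1 := mul_nonneg ht1p (by linarith)
      have w2 : 0 ≤ t2 * l1 := mul_nonneg ht2p (by linarith)
      have z0 : E 0 ≤ 0 := by linarith
      have z1 : E 1 ≤ 0 := by linarith
      have h0 := hdiff 0 1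
      rw [x01, hexpE, hexpE] at h0
      have h1 := Real.exp_le_one_iff.2 z0
      have h2 := Real.exp_le_one_iff.2 z1
      have h3 := Real.add_one_le_exp (Real.log |al 0 - al 1|)
      linarith
  have hεX : ∀ i, ε i = X := by
    intro i; rw [hXYZ, hY, hZ]; push_cast; ring
  have hX1 : |(X:ℝ)| = 1 := by
    have h0 := hexpE 0
    have h1 := hexpE 1
    have h2 := hexpE 2
    rw [hεX] at h0 h1 h2
    have : |(X:ℝ)| ^ 3 = 1 := by
      calc |(X:ℝ)| ^ 3 = |(X:ℝ)| * |(X:ℝ)| * |(X:ℝ)| := by ring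
        _ = Real.exp (E 0) * Real.exp (E 1) * Real.exp (E 2) := by rw [← h0, ← h1, ← h2]
        _ = 1 := by rw [← Real.exp_add, ← Real.exp_add, sE, Real.exp_zero]
    exact (pow_eq_one_iff_of_nonneg (abs_nonneg _) (by norm_num)).1 this
  refine ⟨round c1, round c2, X, ?_, ?_⟩
  · exact (abs_eq (by norm_num)).1 hX1
  · intro i
    rw [← hεX i, hε, _root_.zpow_neg, _root_.zpow_neg]
    have h1 := zpow_ne_zero (round c1) (G.ne i)
    have h2 := zpow_ne_zero (round c2) (G.ne' i)
    field_simp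

end T12


open Finset Matrix

namespace T12

lemma abs_log_one_add_le (t : ℝ) (ht : |t| ≤ 1 / 2) : |Real.log (|1 + t|)| ≤ 2 * |t| := by
  have h := abs_le.1 ht
  have hpos : 0 < 1 + t := by linarith
  rw [abs_of_pos hpos]
  have h1 : Real.log (1 + t) ≤ t := by
    have := Real.log_le_sub_one_of_pos hpos; linarith
  have h2 : 1 - (1 + t)⁻¹ ≤ Real.log (1 + t) := Real.one_sub_inv_le_log_of_pos hpos
  have h3 : 1 - (1 + t)⁻¹ = t / (1 + t) := by field_simp; ring
  have h4 : -(2 * |t|) ≤ t / (1 + t) := by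
    rw [le_div_iff₀ hpos]
    rcases abs_cases t with ⟨h5, h6⟩ | ⟨h5, h6⟩ <;> rw [h5] <;> nlinarith
  rw [abs_le]
  constructor
  · linarith
  · have := le_abs_self t
    have := abs_nonneg t
    linarith

/-- the linear form in logarithms -/
noncomputable def Lam (a : ℤ) (al : Fin 3 → ℝ) (u v : ℤ) : ℝ :=
  Real.log |al 0 - al 2| - Real.log |al 0 - al 1| + (1 + u) * (Real.log |al 1| - Real.log |al 2|)
    + v * (Real.log |al 1 - a| - Real.log |al 2 - a|)

lemma Lam_approx {a b : ℤ} {al : Fin 3 → ℝ} {l1 l2 e : ℝ} (G : Gen a b al l1 l2 e) (u v : ℤ) :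
    |Lam a al u v + (u * (l2 - l1) + v * (l1 + 2 * l2))| ≤ e * (4 + 2 * |(u:ℝ)| + 3 * |(v:ℝ)|) := by
  have k1 : |(1 + (u:ℝ)) * ((Real.log |al 1| - l1) - (Real.log |al 2| - l2))| ≤ (1 + |(u:ℝ)|) * (2 * e) := by
    rw [abs_mul]
    apply mul_le_mul _ _ (abs_nonneg _) (by positivity)
    · exact (abs_add_le _ _).trans (by simp)
    · exact (abs_sub _ _).trans (by have := G.p1; have := G.p2; linarith)
  have k2 : |(v:ℝ) * ((Real.log |al 1 - a| + (l1 + l2)) - (Real.log |al 2 - a| - l2))| ≤ |(v:ℝ)| * (3 * e) := by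
    rw [abs_mul]
    apply mul_le_mul_of_nonneg_left _ (abs_nonneg _)
    exact (abs_sub _ _).trans (by have := G.q1; have := G.q2; linarith)
  have k3 := abs_le.1 G.d01
  have k4 := abs_le.1 G.d02
  rw [abs_le] at k1 k2 ⊢
  unfold Lam
  constructor <;> linarith

set_option maxHeartbeats 1000000 in
theorem stepI {a b : ℤ} {al : Fin 3 → ℝ} {l1 l2 e : ℝ} (G : Gen a b al l1 l2 e) (x y : ℤ)
    (hN : |(x - al 0 * y) * (x - al 1 * y) * (x - al 2 * y)| = 1) (hy : 2 ≤ |y|)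
    (htype : ∀ i, |(x:ℝ) - al 0 * y| ≤ |(x:ℝ) - al i * y|) :
    ∃ u v : ℤ, 1 ≤ u ∧ v < 0 ∧ |v| * 8 ≤ u ∧ |Lam a al u v| ≤ Real.exp (-(2.4 * u * l2)) := by
  obtain ⟨b1, v, s, hs, hβ⟩ := units G x y hN
  obtain ⟨u, rfl⟩ : ∃ u, b1 = 1 + u := ⟨b1 - 1, by ring⟩
  obtain ⟨β, hβdef⟩ : ∃ β : Fin 3 → ℝ, ∀ i, β i = (x:ℝ) - al i * y := ⟨_, fun i => rfl⟩
  have hs1 : |s| = 1 := by rcases hs with h | h <;> rw [h] <;> simp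
  have hβ0 : ∀ i, β i ≠ 0 := by
    intro i
    rw [hβdef, hβ]
    have : s ≠ 0 := by intro h; rw [h] at hs1; simp at hs1
    exact mul_ne_zero this (mul_ne_zero (zpow_ne_zero _ (G.ne i)) (zpow_ne_zero _ (G.ne' i)))
  have hlog : ∀ i, Real.log |β i| = (1 + u) * Real.log |al i| + v * Real.log |al i - a| := by
    intro i
    rw [hβdef, hβ, abs_mul, hs1, one_mul, abs_mul, abs_zpow, abs_zpow, Real.log_mul, Real.log_zpow, Real.log_zpow]
    · push_cast; ring
    · exact zpow_ne_zero _ (abs_ne_zero.2 (G.ne i))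
    · exact zpow_ne_zero _ (abs_ne_zero.2 (G.ne' i))
  simp only [← hβdef] at hN htype
  have hyR : (2:ℝ) ≤ |(y:ℝ)| := by exact_mod_cast hy
  have hy0 : (y:ℝ) ≠ 0 := by intro h; rw [h] at hyR; norm_num at hyR
  obtain ⟨ly, hly⟩ : ∃ ly, ly = Real.log |(y:ℝ)| := ⟨_, rfl⟩
  have hl2 := G.hl2
  have hl1 := G.hl1
  have hl1' := G.hl1'
  have he0 := G.he0
  have he := G.he
  have d01 := abs_le.1 G.d01
  have d02 := abs_le.1 G.d02
  have d12 := abs_le.1 G.d12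
  have hly2 : Real.log 2 ≤ ly := by rw [hly]; exact Real.log_le_log (by norm_num) hyR
  have hlog2 := Real.log_two_gt_d9
  have hlog2' := Real.log_two_lt_d9
  -- product
  have hsum : Real.log |β 0| + Real.log |β 1| + Real.log |β 2| = 0 := by
    rw [← Real.log_mul, ← Real.log_mul, ← abs_mul, ← abs_mul, hN, Real.log_one]
    · exact mul_ne_zero (abs_ne_zero.2 (hβ0 0)) (abs_ne_zero.2 (hβ0 1))
    · exact abs_ne_zero.2 (hβ0 2)
    · exact abs_ne_zero.2 (hβ0 0)
    · exact abs_ne_zero.2 (hβ0 1)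
  have hle : ∀ i, Real.log |β 0| ≤ Real.log |β i| := fun i =>
    Real.log_le_log (abs_pos.2 (hβ0 0)) (htype i)
  have hB0 : Real.log |β 0| ≤ 0 := by have := hle 1; have := hle 2; linarith
  have hb0 : |β 0| ≤ 1 := by
    have := Real.exp_le_one_iff.2 hB0
    rwa [Real.exp_log (abs_pos.2 (hβ0 0))] at this
  have hdf : ∀ i, |al 0 - al i| * |(y:ℝ)| ≤ |β 0| + |β i| := by
    intro i
    have : (al 0 - al i) * y = β i - β 0 := by rw [hβdef, hβdef]; ring
    rw [← abs_mul, this, add_comm]; exact abs_sub _ _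
  have hlo : ∀ i, al 0 - al i ≠ 0 → Real.log |al 0 - al i| + ly ≤ Real.log 2 + Real.log |β i| := by
    intro i hi
    rw [hly, ← Real.log_mul (abs_ne_zero.2 hi) (abs_ne_zero.2 hy0), ← Real.log_mul (by norm_num) (abs_ne_zero.2 (hβ0 i))]
    apply Real.log_le_log (mul_pos (abs_pos.2 hi) (abs_pos.2 hy0))
    have := hdf i; have := htype i; linarith
  have hB1 := hlo 1 G.n01
  have hB2 := hlo 2 G.n02
  have hB2' : Real.log |β 2| ≤ Real.log 2 + (Real.log |al 0 - al 2| + ly) := by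
    rw [hly, ← Real.log_mul (abs_ne_zero.2 G.n02) (abs_ne_zero.2 hy0), ← Real.log_mul (by norm_num)
      (mul_ne_zero (abs_ne_zero.2 G.n02) (abs_ne_zero.2 hy0))]
    apply Real.log_le_log (abs_pos.2 (hβ0 2))
    have h1 : β 2 = (al 0 - al 2) * y + β 0 := by rw [hβdef, hβdef]; ring
    have h2 : |β 2| ≤ |al 0 - al 2| * |(y:ℝ)| + |β 0| := by
      rw [← abs_mul]; nth_rewrite 1 [h1]; exact abs_add_le _ _
    have h3 : 1 ≤ |al 0 - al 2| := by
      rw [← Real.exp_log (abs_pos.2 G.n02)]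
      exact Real.one_le_exp (by linarith)
    have h4 : 1 ≤ |al 0 - al 2| * |(y:ℝ)| := one_le_mul_of_one_le_of_one_le h3 (by linarith)
    linarith
  -- the ratio
  obtain ⟨t, ht⟩ : ∃ t, t = (al 1 - al 2) * β 0 / ((al 0 - al 1) * β 2) := ⟨_, rfl⟩
  have hden : (al 0 - al 1) * β 2 ≠ 0 := mul_ne_zero G.n01 (hβ0 2)
  have ht1 : 1 + t = (al 0 - al 2) * β 1 / ((al 0 - al 1) * β 2) := by
    rw [ht, eq_div_iff hden, add_mul, div_mul_cancel₀ _ hden, hβdef, hβdef, hβdef]; ring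
  have hLam : Real.log |1 + t| = Lam a al u v := by
    rw [ht1, abs_div, abs_mul, abs_mul, Real.log_div, Real.log_mul, Real.log_mul, hlog, hlog]
    · unfold Lam; ring
    · exact abs_ne_zero.2 G.n01
    · exact abs_ne_zero.2 (hβ0 2)
    · exact abs_ne_zero.2 G.n02
    · exact abs_ne_zero.2 (hβ0 1)
    · rw [← abs_mul]; exact abs_ne_zero.2 (mul_ne_zero G.n02 (hβ0 1))
    · rw [← abs_mul]; exact abs_ne_zero.2 hden
  have htne : t ≠ 0 := by rw [ht]; exact div_ne_zero (mul_ne_zero G.n12 (hβ0 0)) hden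
  have htlog : Real.log |t| ≤ -3 * ly - Real.log 2 := by
    rw [ht, abs_div, abs_mul, abs_mul, Real.log_div, Real.log_mul, Real.log_mul]
    · linarith
    · exact abs_ne_zero.2 G.n01
    · exact abs_ne_zero.2 (hβ0 2)
    · exact abs_ne_zero.2 G.n12
    · exact abs_ne_zero.2 (hβ0 0)
    · rw [← abs_mul]; exact abs_ne_zero.2 (mul_ne_zero G.n12 (hβ0 0))
    · rw [← abs_mul]; exact abs_ne_zero.2 hden
  have htle : |t| ≤ Real.exp (-3 * ly) / 2 := by
    rw [← Real.exp_log (abs_pos.2 htne)]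
    refine (Real.exp_le_exp.2 htlog).trans ?_
    rw [Real.exp_sub, Real.exp_log (by norm_num)]
  have hexp1 : Real.exp (-3 * ly) ≤ 1 := Real.exp_le_one_iff.2 (by linarith)
  have hLamle : |Lam a al u v| ≤ Real.exp (-3 * ly) := by
    rw [← hLam]
    refine (abs_log_one_add_le t (by linarith)).trans (by linarith)
  -- integers
  have happ := abs_le.1 (Lam_approx G u v)
  have hLam1 := abs_le.1 (hLamle.trans hexp1)
  obtain ⟨U, hU⟩ : ∃ U, U = |(u:ℝ)| := ⟨_, rfl⟩
  obtain ⟨V, hV⟩ : ∃ V, V = |(v:ℝ)| := ⟨_, rfl⟩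
  rw [← hU, ← hV] at happ
  have hU0 : 0 ≤ U := by rw [hU]; exact abs_nonneg _
  have hV0 : 0 ≤ V := by rw [hV]; exact abs_nonneg _
  have hB2app : |Real.log |β 2| - (1 + u + v) * l2| ≤ e * (1 + U + V) := by
    rw [hlog]
    have k1 : |(1 + (u:ℝ)) * (Real.log |al 2| - l2)| ≤ (1 + U) * e := by
      rw [abs_mul, hU]
      apply mul_le_mul ((abs_add_le _ _).trans (by simp)) G.p2 (abs_nonneg _) (by positivity)
    have k2 : |(v:ℝ) * (Real.log |al 2 - a| - l2)| ≤ V * e := by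
      rw [abs_mul, hV]
      exact mul_le_mul_of_nonneg_left G.q2 (abs_nonneg _)
    rw [abs_le] at k1 k2 ⊢
    constructor <;> linarith
  have hB2app' := abs_le.1 hB2app
  have hUl : 0 ≤ U * l2 := by positivity
  have hVl : 0 ≤ V * l2 := by positivity
  have eU : e * U ≤ 1e-9 * U := mul_le_mul_of_nonneg_right he hU0
  have eV : e * V ≤ 1e-9 * V := mul_le_mul_of_nonneg_right he hV0
  have f1 : 693 * U ≤ U * l2 := by rw [mul_comm]; exact mul_le_mul_of_nonneg_left hl2 hU0
  have f2 : 693 * V ≤ V * l2 := by rw [mul_comm]; exact mul_le_mul_of_nonneg_left hl2 hV0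
  have f3 : V * (0.69 * l2) ≤ V * l1 := mul_le_mul_of_nonneg_left hl1 hV0
  have f4 : U * (0.69 * l2) ≤ U * l1 := mul_le_mul_of_nonneg_left hl1 hU0
  have f5 : U * l1 ≤ U * (0.7 * l2) := mul_le_mul_of_nonneg_left hl1' hU0
  have hVU : V * (l1 + 2 * l2) ≤ 1 + e * (4 + 2 * U + 3 * V) + U * (l2 - l1) := by
    have h1 : |(v:ℝ) * (l1 + 2 * l2)| = V * (l1 + 2 * l2) := by
      rw [abs_mul, hV, abs_of_nonneg (show 0 ≤ l1 + 2 * l2 by linarith)]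
    have h2 : |(u:ℝ) * (l2 - l1)| = U * (l2 - l1) := by
      rw [abs_mul, hU, abs_of_nonneg (show 0 ≤ l2 - l1 by linarith)]
    rw [← h1, ← h2]
    have h3 := le_abs_self ((u:ℝ) * (l2 - l1))
    have h4 := neg_abs_le ((u:ℝ) * (l2 - l1))
    rw [abs_le]
    constructor <;> linarith
  have hu0 : u ≠ 0 := by
    intro h0
    have hU00 : U = 0 := by rw [hU, h0]; simp
    rw [hU00] at hVU
    have hV1 : V < 1 := by nlinarith
    have hv0 : v = 0 := by
      rw [hV] at hV1
      have : |v| < 1 := by exact_mod_cast hV1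
      exact Int.abs_lt_one_iff.1 this
    have k0 := hβ 0
    have k1 := hβ 1
    rw [h0, hv0] at k0 k1
    simp at k0 k1
    have k2 : (al 0 - al 1) * (y + s) = 0 := by linarith
    rcases mul_eq_zero.1 k2 with k3 | k3
    · exact G.n01 k3
    · have : (y:ℝ) = -s := by linarith
      rw [this, abs_neg, hs1] at hyR
      norm_num at hyR
  have hU1 : 1 ≤ U := by rw [hU]; exact_mod_cast Int.one_le_abs hu0
  have hV8 : V * 8 ≤ U := by
    have h1 : (V * 8) * l2 ≤ U * l2 := by linarith
    exact le_of_mul_le_mul_right h1 (by linarith)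
  have hV8l : V * 8 * l2 ≤ U * l2 := mul_le_mul_of_nonneg_right hV8 (by linarith)
  have hvl : |(v:ℝ) * l2| ≤ V * l2 := by rw [abs_mul, ← hV, abs_of_nonneg (show 0 ≤ l2 by linarith)]
  have hvl' := abs_le.1 hvl
  have hupos : 1 ≤ u := by
    by_contra hneg
    have : u ≤ -1 := by omega
    have hur : (u:ℝ) ≤ -1 := by exact_mod_cast this
    have hUu : U = -u := by rw [hU, abs_of_nonpos (by linarith)]
    have h1 : (u:ℝ) * l2 = - (U * l2) := by rw [hUu]; ring
    linarith
  have hur : (1:ℝ) ≤ u := by exact_mod_cast hupos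
  have hUu : U = u := by rw [hU, abs_of_nonneg (by linarith)]
  have hvneg : v < 0 := by
    by_contra hneg
    have : 0 ≤ v := by omega
    have hvr : (0:ℝ) ≤ v := by exact_mod_cast this
    have hVv : V = v := by rw [hV, abs_of_nonneg hvr]
    rw [← hUu, ← hVv] at happ
    linarith
  refine ⟨u, v, hupos, hvneg, ?_, ?_⟩
  · rw [hV, hUu] at hV8; exact_mod_cast hV8
  · refine hLamle.trans (Real.exp_le_exp.2 ?_)
    have hul : (u:ℝ) * l2 = U * l2 := by rw [hUu]
    have hg : -(2.4 * (u:ℝ) * l2) = -(2.4 * (U * l2)) := by rw [← hul]; ring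
    rw [hg]
    linarith

end T12


open Finset Matrix

namespace T12

/-- the monomial `X_i^k` as polynomial also for negative `k` -/
noncomputable def Hz (a b : ℤ) (i : Fin 3) (k : ℤ) : MvPolynomial (Fin 3) ℤ :=
  if 0 ≤ k then MvPolynomial.X i ^ k.toNat
  else ((MvPolynomial.X i - MvPolynomial.C a) * (MvPolynomial.X i - MvPolynomial.C b)) ^ (-k).toNat

/-- the monomial `(X_i - a)^k` as polynomial also for negative `k` -/
noncomputable def Tz (a b : ℤ) (i : Fin 3) (k : ℤ) : MvPolynomial (Fin 3) ℤ :=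
  if 0 ≤ k then (MvPolynomial.X i - MvPolynomial.C a) ^ k.toNat
  else (MvPolynomial.X i * (MvPolynomial.X i - MvPolynomial.C b)) ^ (-k).toNat

lemma toNat_zpow (x : ℝ) (k : ℤ) (hk : 0 ≤ k) : x ^ k.toNat = x ^ k := by
  rw [← zpow_natCast, Int.toNat_of_nonneg hk]

lemma aeval_Hz (a b : ℤ) (β : Fin 3 → ℝ) (i : Fin 3) (h : β i * (β i - a) * (β i - b) = 1) (k : ℤ) :
    MvPolynomial.aeval β (Hz a b i k) = β i ^ k := by
  unfold Hz
  split_ifs with hk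
  · simp [toNat_zpow _ _ hk]
  · have h1 : (β i - a) * (β i - b) = (β i)⁻¹ := by
      symm; apply inv_eq_of_mul_eq_one_right; linarith
    simp only [map_pow, map_mul, map_sub, MvPolynomial.aeval_X, MvPolynomial.aeval_C, algebraMap_int_eq, eq_intCast, map_intCast]
    rw [h1, toNat_zpow _ _ (by omega), _root_.inv_zpow, _root_.zpow_neg, inv_inv]

lemma aeval_Tz (a b : ℤ) (β : Fin 3 → ℝ) (i : Fin 3) (h : β i * (β i - a) * (β i - b) = 1) (k : ℤ) :
    MvPolynomial.aeval β (Tz a b i k) = (β i - a) ^ k := by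
  unfold Tz
  split_ifs with hk
  · simp [toNat_zpow _ _ hk]
  · have h1 : β i * (β i - b) = (β i - a)⁻¹ := by
      symm; apply inv_eq_of_mul_eq_one_right; linarith
    simp only [map_pow, map_mul, map_sub, MvPolynomial.aeval_X, MvPolynomial.aeval_C, algebraMap_int_eq, eq_intCast, map_intCast]
    rw [h1, toNat_zpow _ _ (by omega), _root_.inv_zpow, _root_.zpow_neg, inv_inv]

/-- quotient monomial -/
noncomputable def Mo (a b : ℤ) (k m : ℤ) : MvPolynomial (Fin 3) ℤ :=
  Hz a b 1 k * Hz a b 2 (-k) * Tz a b 1 m * Tz a b 2 (-m)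

variable {a b : ℤ} {al : Fin 3 → ℝ} {l1 l2 e : ℝ}

lemma aeval_Mo (G : Gen a b al l1 l2 e) (σ : Fin 3 → Fin 3) (k m : ℤ) :
    MvPolynomial.aeval (fun i => al (σ i)) (Mo a b k m) =
      al (σ 1) ^ k * al (σ 2) ^ (-k) * (al (σ 1) - a) ^ m * (al (σ 2) - a) ^ (-m) := by
  unfold Mo
  rw [map_mul, map_mul, map_mul, aeval_Hz, aeval_Hz, aeval_Tz, aeval_Tz]
  all_goals exact G.root _

lemma aeval_Mo_ne (G : Gen a b al l1 l2 e) (σ : Fin 3 → Fin 3) (k m : ℤ) :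
    MvPolynomial.aeval (fun i => al (σ i)) (Mo a b k m) ≠ 0 := by
  rw [aeval_Mo G]
  have h1 := G.ne (σ 1); have h2 := G.ne (σ 2); have h3 := G.ne' (σ 1); have h4 := G.ne' (σ 2)
  positivity

lemma log_Mo (G : Gen a b al l1 l2 e) (σ : Fin 3 → Fin 3) (k m : ℤ) :
    Real.log |MvPolynomial.aeval (fun i => al (σ i)) (Mo a b k m)| =
      k * (Real.log |al (σ 1)| - Real.log |al (σ 2)|)
        + m * (Real.log |al (σ 1) - a| - Real.log |al (σ 2) - a|) := by
  rw [aeval_Mo G]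
  have h1 := G.ne (σ 1); have h2 := G.ne (σ 2); have h3 := G.ne' (σ 1); have h4 := G.ne' (σ 2)
  rw [Real.log_abs, Real.log_mul, Real.log_mul, Real.log_mul, Real.log_zpow, Real.log_zpow, Real.log_zpow,
    Real.log_zpow, Real.log_abs, Real.log_abs, Real.log_abs, Real.log_abs]
  · push_cast; ring
  all_goals positivity

lemma Gen.logp (G : Gen a b al l1 l2 e) (i : Fin 3) : |Real.log (|al i|)| ≤ 2 * l2 := by
  have h0 := abs_le.1 G.p0; have h1 := abs_le.1 G.p1; have h2 := abs_le.1 G.p2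
  have := G.he; have := G.he0; have := G.hl1; have := G.hl1'; have := G.hl2
  rw [abs_le]
  fin_cases i <;> simp only [Fin.zero_eta, Fin.mk_one, Fin.reduceFinMk] <;> constructor <;> linarith

lemma Gen.logq (G : Gen a b al l1 l2 e) (i : Fin 3) : |Real.log (|al i - a|)| ≤ 2 * l2 := by
  have h0 := abs_le.1 G.q0; have h1 := abs_le.1 G.q1; have h2 := abs_le.1 G.q2
  have := G.he; have := G.he0; have := G.hl1; have := G.hl1'; have := G.hl2
  rw [abs_le]
  fin_cases i <;> simp only [Fin.zero_eta, Fin.mk_one, Fin.reduceFinMk] <;> constructor <;> linarith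

lemma Gen.logd (G : Gen a b al l1 l2 e) (i j : Fin 3) : Real.log |al i - al j| ≤ 2 * l2 := by
  have h0 := abs_le.1 G.d01; have h1 := abs_le.1 G.d02; have h2 := abs_le.1 G.d12
  have := G.he; have := G.he0; have := G.hl1; have := G.hl1'; have := G.hl2
  have c0 := abs_sub_comm (al 1) (al 0)
  have c1 := abs_sub_comm (al 2) (al 0)
  have c2 := abs_sub_comm (al 2) (al 1)
  fin_cases i <;> fin_cases j <;> simp only [Fin.zero_eta, Fin.mk_one, Fin.reduceFinMk, sub_self, abs_zero, Real.log_zero, c0, c1, c2] <;> linarith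

lemma log_Mo_le (G : Gen a b al l1 l2 e) (σ : Fin 3 → Fin 3) (k m : ℤ) :
    |Real.log (|MvPolynomial.aeval (fun i => al (σ i)) (Mo a b k m)|)| ≤ 4 * l2 * (|(k:ℝ)| + |(m:ℝ)|) := by
  rw [log_Mo G]
  refine (abs_add_le _ _).trans ?_
  rw [abs_mul, abs_mul]
  have h1 : |Real.log (|al (σ 1)|) - Real.log (|al (σ 2)|)| ≤ 4 * l2 := by
    refine (abs_sub _ _).trans ?_
    have := G.logp (σ 1); have := G.logp (σ 2); linarith
  have h2 : |Real.log |al (σ 1) - a| - Real.log (|al (σ 2) - a|)| ≤ 4 * l2 := by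
    refine (abs_sub _ _).trans ?_
    have := G.logq (σ 1); have := G.logq (σ 2); linarith
  have h3 := mul_le_mul_of_nonneg_left h1 (abs_nonneg (k:ℝ))
  have h4 := mul_le_mul_of_nonneg_left h2 (abs_nonneg (m:ℝ))
  linarith

lemma abs_le_exp_of_log {x A : ℝ} (h : Real.log |x| ≤ A) : |x| ≤ Real.exp A := by
  rcases eq_or_ne x 0 with rfl | hx
  · simp [Real.exp_nonneg]
  · rw [← Real.log_le_iff_le_exp (abs_pos.2 hx)]; exact h

lemma Mo_ne_one (G : Gen a b al l1 l2 e) (q q2 : ℤ) (hq : 1 ≤ q) (hq2 : |q2| * 4 ≤ q)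
    (h : |MvPolynomial.aeval al (Mo a b q q2)| = 1) : False := by
  have hl : Real.log |MvPolynomial.aeval (fun i => al (id i)) (Mo a b q q2)| = 0 := by
    have : (fun i => al (id i)) = al := rfl
    rw [this, h, Real.log_one]
  rw [log_Mo G] at hl
  simp only [id] at hl
  -- the unit
  obtain ⟨ε, hε⟩ : ∃ ε : Fin 3 → ℝ, ε = fun i => al i ^ q * (al i - a) ^ q2 := ⟨_, rfl⟩
  have hεi : ∀ i, ε i = al i ^ q * (al i - a) ^ q2 := fun i => by rw [hε]
  have hεl : ∀ i, Real.log |ε i| = q * Real.log |al i| + q2 * Real.log |al i - a| := by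
    intro i
    have h1 := G.ne i; have h3 := G.ne' i
    rw [hεi, Real.log_abs, Real.log_mul (by positivity) (by positivity), Real.log_zpow, Real.log_zpow,
      Real.log_abs, Real.log_abs]
  have hε0 : ∀ i, ε i ≠ 0 := by
    intro i
    have h1 := G.ne i; have h3 := G.ne' i
    rw [hεi]; positivity
  have heq : |ε 1| = |ε 2| := by
    apply Real.log_injOn_pos (Set.mem_Ioi.2 (abs_pos.2 (hε0 1))) (Set.mem_Ioi.2 (abs_pos.2 (hε0 2)))
    rw [hεl, hεl]; linarith
  have hsq : ε 1 ^ 2 = ε 2 ^ 2 := by rw [← sq_abs, heq, sq_abs]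
  have hin : InR al (fun i => ε i ^ 2) := by
    apply InR.pow G
    rw [hε]; exact (InR.unit1 G q).mul G (InR.unit2 G q2)
  obtain ⟨X, Y, Z, hXYZ⟩ := hin
  have e1 := hXYZ 1; have e2 := hXYZ 2; have e0 := hXYZ 0
  simp only at e0 e1 e2
  have hYZ : (Y:ℝ) + Z * (al 1 + al 2) = 0 := by
    have h1 : (al 1 - al 2) * (Y + Z * (al 1 + al 2)) = 0 := by
      rw [e1, e2] at hsq; linarith
    exact (mul_eq_zero.1 h1).resolve_left G.n12
  have hqR : (1:ℝ) ≤ q := by exact_mod_cast hq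
  have hq2R : |(q2:ℝ)| * 4 ≤ q := by exact_mod_cast hq2
  have hq2' := abs_le.1 (show |(q2:ℝ)| ≤ q / 4 by linarith)
  by_cases hZ : Z = 0
  · have hY : Y = 0 := by
      rw [hZ] at hYZ; simp at hYZ; exact hYZ
    rw [hZ, hY] at e0 e1 e2
    simp at e0 e1 e2
    -- all ε_i^2 equal X
    have e02 : |ε 0| = |ε 2| := by
      rw [← Real.sqrt_sq_eq_abs, ← Real.sqrt_sq_eq_abs, e0, e2]
    have k : Real.log |ε 0| = Real.log |ε 2| := by rw [e02]
    rw [hεl, hεl] at k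
    have h0 := abs_le.1 G.p0; have h1 := abs_le.1 G.p2; have h2 := abs_le.1 G.q0; have h3 := abs_le.1 G.q2
    have := G.he; have := G.he0; have := G.hl1; have := G.hl1'; have := G.hl2
    have k1 : (q:ℝ) * (Real.log |al 2| - Real.log |al 0|) = q2 * (Real.log |al 0 - a| - Real.log |al 2 - a|) := by
      linarith
    have k2 : |(q2:ℝ) * (Real.log |al 0 - a| - Real.log |al 2 - a|)| ≤ (q / 4) * l2 := by
      rw [abs_mul]
      apply mul_le_mul (by linarith) _ (abs_nonneg _) (by linarith)
      rw [abs_le]; constructor <;> linarith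
    have k3 := (abs_le.1 k2).2
    have k4 : (q:ℝ) * (2 * l2) ≤ q * (Real.log |al 2| - Real.log |al 0|) * 2 := by
      rw [mul_assoc]
      apply mul_le_mul_of_nonneg_left _ (by linarith)
      linarith
    have k5 : 0 < (q:ℝ) * l2 := by apply mul_pos <;> linarith
    linarith
  · -- al 0 rational
    have hZR : (Z:ℝ) ≠ 0 := by exact_mod_cast hZ
    have hr := G.root 0
    have h1 : (Z:ℝ) * al 0 = Z * (a + b) + Y := by
      have := G.s1
      have : al 0 = a + b - (al 1 + al 2) := by linarith
      rw [this]; linarith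
    -- integrality
    obtain ⟨w, hw⟩ : ∃ w : ℤ, al 0 = w := by
      have hInteg : IsIntegral ℤ ((Rat.cast (((Z * (a + b) + Y : ℤ) : ℚ) / (Z : ℚ)) : ℝ)) := by
        have : ((Rat.cast (((Z * (a + b) + Y : ℤ) : ℚ) / (Z : ℚ)) : ℝ)) = al 0 := by
          push_cast
          rw [div_eq_iff hZR]; linarith
        rw [this]
        refine ⟨Polynomial.X * (Polynomial.X - Polynomial.C a) * (Polynomial.X - Polynomial.C b) - 1, ?_, ?_⟩
        · have hm : (Polynomial.X * (Polynomial.X - Polynomial.C a) * (Polynomial.X - Polynomial.C b)).Monic :=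
            (Polynomial.monic_X.mul (Polynomial.monic_X_sub_C a)).mul (Polynomial.monic_X_sub_C b)
          apply hm.sub_of_left
          rw [Polynomial.degree_mul, Polynomial.degree_mul, Polynomial.degree_X, Polynomial.degree_X_sub_C,
            Polynomial.degree_X_sub_C, Polynomial.degree_one]
          norm_num
        · rw [← Polynomial.aeval_def]; simp; linarith
      have h2 : IsIntegral ℤ (((Z * (a + b) + Y : ℤ) : ℚ) / (Z : ℚ)) := by
        rw [show ((Rat.cast (((Z * (a + b) + Y : ℤ) : ℚ) / (Z : ℚ)) : ℝ)) = algebraMap ℚ ℝ (((Z * (a + b) + Y : ℤ) : ℚ) / (Z : ℚ)) from rfl] at hInteg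
        exact (isIntegral_algebraMap_iff (algebraMap ℚ ℝ).injective).1 hInteg
      obtain ⟨w, hw⟩ := IsIntegrallyClosed.isIntegral_iff.1 h2
      refine ⟨w, ?_⟩
      have h3 : ((w:ℚ):ℝ) = ((((Z * (a + b) + Y : ℤ) : ℚ) / (Z : ℚ) : ℚ) : ℝ) := by
        rw [← hw]; simp
      push_cast at h3
      rw [h3, eq_div_iff hZR]; linarith
    have h5 := G.h0
    rw [hw] at h5
    have h6 : |w| < 1 := by exact_mod_cast h5
    have h7 := Int.abs_lt_one_iff.1 h6
    exact G.ne 0 (by rw [hw, h7]; simp)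

lemma Gen.poly (G : Gen a b al l1 l2 e) : ∃ f : Polynomial ℤ, f.Monic ∧ (∀ i, Polynomial.aeval (al i) f = 0) ∧
    (∀ x : ℂ, Polynomial.aeval x f = 0 → ∃ i, x = (al i : ℂ)) := by
  refine ⟨Polynomial.X * (Polynomial.X - Polynomial.C a) * (Polynomial.X - Polynomial.C b) - 1, ?_, ?_, ?_⟩
  · have hm : (Polynomial.X * (Polynomial.X - Polynomial.C a) * (Polynomial.X - Polynomial.C b)).Monic :=
      (Polynomial.monic_X.mul (Polynomial.monic_X_sub_C a)).mul (Polynomial.monic_X_sub_C b)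
    apply hm.sub_of_left
    rw [Polynomial.degree_mul, Polynomial.degree_mul, Polynomial.degree_X, Polynomial.degree_X_sub_C,
      Polynomial.degree_X_sub_C, Polynomial.degree_one]
    norm_num
  · intro i
    have := G.root i
    simp; linarith
  · intro x hx
    simp at hx
    have h1 : ((al 0 : ℂ) + al 1 + al 2) = a + b := by exact_mod_cast congrArg (fun t : ℝ => (t:ℂ)) G.s1
    have h2 : ((al 0 : ℂ) * al 1 + al 0 * al 2 + al 1 * al 2) = a * b := by
      exact_mod_cast congrArg (fun t : ℝ => (t:ℂ)) G.s2
    have h3 : ((al 0 : ℂ) * al 1 * al 2) = 1 := by exact_mod_cast congrArg (fun t : ℝ => (t:ℂ)) G.s3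
    have h4 : (x - al 0) * (x - al 1) * (x - al 2) = 0 := by
      linear_combination hx + (-x^2) * h1 + x * h2 - h3
    rcases mul_eq_zero.1 h4 with h | h
    · rcases mul_eq_zero.1 h with h | h
      · exact ⟨0, sub_eq_zero.1 h⟩
      · exact ⟨1, sub_eq_zero.1 h⟩
    · exact ⟨2, sub_eq_zero.1 h⟩

end T12


open Finset Matrix

namespace T12

lemma numII (L Q q r u l2 A1 A2 t : ℝ) (hl2 : 693 ≤ l2) (hL : 4 ≤ L) (hQ : 1e5 * L ^ 2 * l2 ≤ Q)
    (hq : 1 ≤ q) (hqQ : q ≤ Q) (hrq : r * q ≤ u) (hu : 2 * Q ^ 3 ≤ u) (hr : 2 * Q ^ 2 ≤ r)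
    (ht : t * Q = r) (hA1 : A1 ≤ 5 * q * l2 + 1) (hA2 : A2 ≤ 4 * l2 * (9 * q / 8 + t + 1) + 1)
    (hA10 : 0 ≤ A1) (hA20 : 0 ≤ A2) :
    61 * L * A2 ≤ r ∧ 2605 * L * L * A1 * A2 ≤ 2.4 * u * l2 := by
  have hQ0 : 0 < Q := by linarith
  have hr0 : 0 < r := by nlinarith
  have ht0 : 0 < t := by
    by_contra h
    nlinarith
  obtain ⟨Y, hY⟩ : ∃ Y, Y = 17 / 8 * q + t := ⟨_, rfl⟩
  have hY1 : 1 ≤ Y := by linarith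
  have hA2' : A2 ≤ 4.01 * (l2 * Y) := by
    have h1 : l2 * (9 * q / 8 + t + 1) ≤ l2 * Y := mul_le_mul_of_nonneg_left (by linarith) (by linarith)
    have h2 : l2 * 1 ≤ l2 * Y := mul_le_mul_of_nonneg_left (by linarith) (by linarith)
    linarith
  have hA1' : A1 ≤ 5.01 * (q * l2) := by
    have : 1 * 693 ≤ q * l2 := mul_le_mul hq hl2 (by norm_num) (by linarith)
    linarith
  have hqq : Q * q ≤ r / 2 := by
    have : Q * q ≤ Q * Q := mul_le_mul_of_nonneg_left hqQ hQ0.le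
    nlinarith
  have hQY : Q * Y ≤ 17 / 16 * r + r := by rw [hY]; linarith
  constructor
  · have c1 : 4e5 * (L * l2) ≤ Q := by
      have : 4 * L * l2 ≤ L ^ 2 * l2 := mul_le_mul_of_nonneg_right (by nlinarith) (by linarith)
      linarith
    have c2 : 4e5 * (L * l2) * Y ≤ Q * Y := mul_le_mul_of_nonneg_right c1 (by linarith)
    have c3 : L * A2 ≤ L * (4.01 * (l2 * Y)) := mul_le_mul_of_nonneg_left hA2' (by linarith)
    linarith
  · have c1 : A1 * A2 ≤ (5.01 * (q * l2)) * (4.01 * (l2 * Y)) :=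
      mul_le_mul hA1' hA2' hA20 (by positivity)
    have c2 : q * Q * Y ≤ 33 / 16 * u := by
      have h1 : q * q * Q ≤ Q ^ 3 := by
        have : q * q ≤ Q * Q := mul_le_mul hqQ hqQ (by linarith) hQ0.le
        calc q * q * Q ≤ Q * Q * Q := mul_le_mul_of_nonneg_right this hQ0.le
          _ = Q ^ 3 := by ring
      have h2 : q * (t * Q) ≤ u := by rw [ht]; linarith
      rw [hY]
      linarith
    have c3 : 1e5 * (L ^ 2 * l2) * (q * Y) ≤ Q * (q * Y) :=
      mul_le_mul_of_nonneg_right (by linarith) (by positivity)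
    have c4 : 1e5 * (L ^ 2 * l2) * (q * Y) * l2 ≤ 33 / 16 * u * l2 :=
      mul_le_mul_of_nonneg_right (by linarith) (by linarith)
    have c5 : (L * L) * (A1 * A2) ≤ (L * L) * ((5.01 * (q * l2)) * (4.01 * (l2 * Y))) :=
      mul_le_mul_of_nonneg_left c1 (by positivity)
    have c6 : 0 ≤ u * l2 := by
      have : 0 ≤ u := by nlinarith [pow_pos hQ0 3]
      positivity
    linarith

variable {a b : ℤ} {al : Fin 3 → ℝ} {l1 l2 e : ℝ}

lemma sgn_exists (x : ℝ) : ∃ s : ℤ, (s = 1 ∨ s = -1) ∧ (s:ℝ) * x = |x| := by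
  rcases le_total 0 x with h | h
  · exact ⟨1, Or.inl rfl, by rw [abs_of_nonneg h]; simp⟩
  · exact ⟨-1, Or.inr rfl, by rw [abs_of_nonpos h]; simp⟩

lemma sgn_abs {s : ℤ} (h : s = 1 ∨ s = -1) : |(s:ℝ)| = 1 := by
  rcases h with rfl | rfl <;> simp

set_option maxHeartbeats 1000000 in
/-- application of the two-logarithm bound -/
lemma stepII_core (G : Gen a b al l1 l2 e) (q q2 s1 s2 : ℤ) (r L A1 A2 : ℕ)
    (hq : 1 ≤ q) (hq2 : |q2| * 4 ≤ q)
    (hA1 : 4 * l2 * (|(q:ℝ)| + |(q2:ℝ)|) ≤ A1)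
    (hA2 : 2 * l2 + 4 * l2 * (|((1 + s1 : ℤ):ℝ)| + |(s2:ℝ)|) ≤ A2) (hA1' : 1 ≤ A1) (hA2' : 10 ≤ A2)
    (hr : 61 * L * A2 ≤ r) (hL : 6 * Real.log (r * (24 * L * A1)) + 4 ≤ L)
    (hΛ : 2 * (L * (24 * L * A1) * |Lam a al (r * q + s1) (r * q2 + s2)|) *
      Real.exp (2600 * L * L * A1 * A2) ≤ 1) : False := by
  obtain ⟨f, hf1, hf2, hf3⟩ := G.poly
  obtain ⟨sE, hsE, hsE'⟩ := sgn_exists (MvPolynomial.aeval al (Mo a b q q2))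
  obtain ⟨sP, hsP, hsP'⟩ := sgn_exists ((al 0 - al 2) * MvPolynomial.aeval al (Mo a b (1 + s1) s2) / (al 0 - al 1))
  have hM0 := aeval_Mo_ne G id
  have hlM := log_Mo G id
  have hlMle := log_Mo_le G id
  have hid : (fun i => al (id i)) = al := rfl
  rw [hid] at hM0 hlM hlMle
  simp only [id] at hlM
  have hG0 : (al 0 - al 2) * MvPolynomial.aeval al (Mo a b (1 + s1) s2) / (al 0 - al 1) ≠ 0 :=
    div_ne_zero (mul_ne_zero G.n02 (hM0 _ _)) G.n01
  have hlogG : Real.log |(al 0 - al 2) * MvPolynomial.aeval al (Mo a b (1 + s1) s2) / (al 0 - al 1)|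
      = Real.log |al 0 - al 2| + Real.log |MvPolynomial.aeval al (Mo a b (1 + s1) s2)| - Real.log |al 0 - al 1| := by
    rw [Real.log_abs, Real.log_div (mul_ne_zero G.n02 (hM0 _ _)) G.n01, Real.log_mul G.n02 (hM0 _ _), Real.log_abs,
      Real.log_abs, Real.log_abs]
  have hl2 := G.hl2
  have hLE := hlMle q q2
  have hLP := hlMle (1 + s1) s2
  have hLam : (r:ℝ) * Real.log |MvPolynomial.aeval al (Mo a b q q2)| + Real.log |(al 0 - al 2) * MvPolynomial.aeval al (Mo a b (1 + s1) s2) / (al 0 - al 1)| = Lam a al (r * q + s1) (r * q2 + s2) := by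
    rw [hlogG, hlM, hlM]
    unfold Lam
    push_cast
    ring
  refine baker al G.inj f hf1 hf2 hf3 (MvPolynomial.C sE * Mo a b q q2)
    (MvPolynomial.C sP * ((MvPolynomial.X 0 - MvPolynomial.X 2) * Mo a b (1 + s1) s2))
    (MvPolynomial.X 0 - MvPolynomial.X 1) L r A1 A2 ?_ ?_ ?_
    |MvPolynomial.aeval al (Mo a b q q2)|
    |(al 0 - al 2) * MvPolynomial.aeval al (Mo a b (1 + s1) s2) / (al 0 - al 1)| ?_ ?_ ?_ ?_ ?_ ?_ ?_ hA1' hA2' hr hL ?_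
  · intro σ
    rw [map_mul, MvPolynomial.aeval_C, abs_mul]
    simp only [algebraMap_int_eq, eq_intCast]
    rw [sgn_abs hsE, one_mul]
    apply abs_le_exp_of_log
    exact (le_abs_self _).trans ((log_Mo_le G σ q q2).trans hA1)
  · intro σ
    rw [map_mul, MvPolynomial.aeval_C, abs_mul]
    simp only [algebraMap_int_eq, eq_intCast]
    rw [sgn_abs hsP, one_mul]
    apply abs_le_exp_of_log
    rw [map_mul, map_sub, MvPolynomial.aeval_X, MvPolynomial.aeval_X]
    have hne : al (σ 0) - al (σ 2) ≠ 0 := by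
      intro h
      have := σ.injective (G.inj (sub_eq_zero.1 h))
      simp at this
    rw [Real.log_abs, Real.log_mul hne (aeval_Mo_ne G σ _ _), ← Real.log_abs, ← Real.log_abs (MvPolynomial.aeval _ _)]
    have h1 := G.logd (σ 0) (σ 2)
    have h2 := (le_abs_self _).trans (log_Mo_le G σ (1 + s1) s2)
    linarith
  · intro σ
    apply abs_le_exp_of_log
    rw [map_sub, MvPolynomial.aeval_X, MvPolynomial.aeval_X]
    have h1 := G.logd (σ 0) (σ 1)
    have h2 : 0 ≤ 4 * l2 * (|((1 + s1 : ℤ):ℝ)| + |(s2:ℝ)|) := by positivity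
    linarith
  · rw [map_mul, MvPolynomial.aeval_C, ← hsE']; simp
  · rw [map_mul, MvPolynomial.aeval_C, ← hsP', map_mul, map_sub, map_sub, MvPolynomial.aeval_X, MvPolynomial.aeval_X, MvPolynomial.aeval_X]
    simp only [algebraMap_int_eq, eq_intCast]; ring
  · rw [map_sub, MvPolynomial.aeval_X, MvPolynomial.aeval_X]; exact G.n01
  · exact abs_pos.2 (hM0 _ _)
  · intro h; exact Mo_ne_one G q q2 hq hq2 h
  · exact abs_pos.2 hG0
  · rw [hlogG]
    have h1 := abs_le.1 G.d01
    have h2 := abs_le.1 G.d02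
    have := G.he; have := G.he0; have := G.hl1; have := G.hl1'
    have h3 := abs_le.1 hLP
    rw [abs_le]
    constructor <;> linarith
  · rw [hLam]; exact hΛ

set_option maxHeartbeats 1000000 in
theorem stepII (G : Gen a b al l1 l2 e) (u v : ℤ) (hu : 1 ≤ u) (hv : |v| * 8 ≤ u)
    (hLam : |Lam a al u v| ≤ Real.exp (-(2.4 * u * l2))) (L Q : ℕ)
    (hL : 8 * Real.log u + 4 ≤ L) (hQ : 1e5 * (L:ℝ) ^ 2 * l2 ≤ Q) : u < 2 * (Q:ℤ) ^ 3 := by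
  by_contra hcon
  push Not at hcon
  have hl2 := G.hl2
  have huR : (1:ℝ) ≤ u := by exact_mod_cast hu
  have hu0 : (0:ℝ) < u := by linarith
  have hlogu : 0 ≤ Real.log u := Real.log_nonneg huR
  have hL4 : (4:ℝ) ≤ L := by linarith
  have hLL : (16:ℝ) ≤ (L:ℝ) ^ 2 := by nlinarith
  have hQbig : (1e5:ℝ) * 16 * 693 ≤ Q := by
    refine le_trans ?_ hQ
    apply mul_le_mul _ hl2 (by norm_num) (by positivity)
    linarith
  have hQ0 : 0 < Q := by
    have : (0:ℝ) < Q := by linarith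
    exact_mod_cast this
  have huQ : 2 * (Q:ℝ) ^ 3 ≤ u := by exact_mod_cast hcon
  obtain ⟨q2, q, hq0, hqQ, happ⟩ := Real.exists_int_int_abs_mul_sub_le ((v:ℝ) / u) hQ0
  have hqR : (1:ℝ) ≤ q := by exact_mod_cast hq0
  have hqQR : (q:ℝ) ≤ Q := by exact_mod_cast hqQ
  have hvR : |(v:ℝ)| * 8 ≤ u := by exact_mod_cast hv
  have hvu : |(v:ℝ) / u| ≤ 1 / 8 := by
    rw [abs_div, abs_of_pos hu0, div_le_iff₀ hu0]; linarith
  have happ' : |(q:ℝ) * (v / u) - q2| ≤ 1 / Q := happ.trans (by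
    apply one_div_le_one_div_of_le <;> linarith)
  -- q2 small
  have h1Q : 1 / (Q:ℝ) ≤ 1 / 8 := one_div_le_one_div_of_le (by norm_num) (by linarith)
  have hqv : |(q:ℝ) * (v / u)| ≤ q * (1 / 8) := by
    rw [abs_mul, abs_of_nonneg (show (0:ℝ) ≤ q by linarith)]
    exact mul_le_mul_of_nonneg_left hvu (by linarith)
  have hq2R : |(q2:ℝ)| ≤ q / 4 := by
    have h1 := abs_le.1 hqv
    have h2 := abs_le.1 happ'
    rw [abs_le]; constructor <;> linarith
  have hq2 : |q2| * 4 ≤ q := by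
    have : |(q2:ℝ)| * 4 ≤ q := by linarith
    exact_mod_cast this
  obtain ⟨r, hrdef⟩ : ∃ r : ℕ, (r:ℤ) = u / q := ⟨(u / q).toNat, by
    rw [Int.toNat_of_nonneg]; positivity⟩
  obtain ⟨s1, hs1⟩ : ∃ s1 : ℤ, s1 = u % q := ⟨_, rfl⟩
  have hs10 : 0 ≤ s1 := by rw [hs1]; exact Int.emod_nonneg _ hq0.ne'
  have hs1q : s1 < q := by rw [hs1]; exact Int.emod_lt_of_pos _ hq0
  have hue : u = r * q + s1 := by rw [hrdef, hs1, mul_comm]; exact (Int.mul_ediv_add_emod u q).symm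
  have hueR : (u:ℝ) = r * q + s1 := by exact_mod_cast hue
  have hs10R : (0:ℝ) ≤ s1 := by exact_mod_cast hs10
  have hs1qR : (1:ℝ) + s1 ≤ q := by exact_mod_cast (show 1 + s1 ≤ q by omega)
  obtain ⟨s2, hs2⟩ : ∃ s2 : ℤ, s2 = v - r * q2 := ⟨_, rfl⟩
  have hs2R : (s2:ℝ) = v - r * q2 := by exact_mod_cast hs2
  have hve : v = r * q2 + s2 := by rw [hs2]; ring
  obtain ⟨t, ht⟩ : ∃ t : ℝ, t = r / Q := ⟨_, rfl⟩
  have hQR0 : (0:ℝ) < Q := by exact_mod_cast hQ0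
  have htQ : t * Q = r := by rw [ht]; field_simp
  have hs2le : |(s2:ℝ)| ≤ s1 / 8 + t := by
    have h1 : (s2:ℝ) = (v / u) * s1 + r * (q * (v / u) - q2) := by
      have : (v:ℝ) = (v / u) * u := by field_simp
      rw [hs2R]; nth_rewrite 1 [this]; rw [hueR]; ring
    rw [h1]
    refine (abs_add_le _ _).trans ?_
    rw [abs_mul, abs_mul, abs_of_nonneg hs10R, abs_of_nonneg (show (0:ℝ) ≤ r by positivity)]
    have h2 := mul_le_mul_of_nonneg_right hvu hs10R
    have h3 := mul_le_mul_of_nonneg_left happ' (show (0:ℝ) ≤ r by positivity)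
    have h4 : (r:ℝ) * (1 / Q) = t := by rw [ht]; ring
    linarith
  have hr2 : 2 * (Q:ℝ) ^ 2 ≤ r := by
    have h1 : 2 * (Q:ℤ) ^ 2 ≤ r := by
      rw [hrdef, Int.le_ediv_iff_mul_le hq0]
      refine le_trans ?_ hcon
      calc 2 * (Q:ℤ) ^ 2 * q ≤ 2 * (Q:ℤ) ^ 2 * Q := mul_le_mul_of_nonneg_left hqQ (by positivity)
        _ = 2 * (Q:ℤ) ^ 3 := by ring
    exact_mod_cast h1
  have hrq : (r:ℝ) * q ≤ u := by linarith
  obtain ⟨A1, hA1⟩ : ∃ A1 : ℕ, A1 = ⌈5 * (q:ℝ) * l2⌉₊ := ⟨_, rfl⟩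
  obtain ⟨A2, hA2⟩ : ∃ A2 : ℕ, A2 = ⌈4 * l2 * (9 * q / 8 + t + 1)⌉₊ := ⟨_, rfl⟩
  have ht0 : 0 ≤ t := by rw [ht]; positivity
  have hql : 693 ≤ (q:ℝ) * l2 := by
    have : 1 * 693 ≤ (q:ℝ) * l2 := mul_le_mul hqR hl2 (by norm_num) (by linarith)
    linarith
  have hA1lo : 5 * (q:ℝ) * l2 ≤ A1 := by rw [hA1]; exact Nat.le_ceil _
  have hA1hi : (A1:ℝ) ≤ 5 * (q:ℝ) * l2 + 1 := by rw [hA1]; exact (Nat.ceil_lt_add_one (by linarith)).le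
  have hA2lo : 4 * l2 * (9 * q / 8 + t + 1) ≤ A2 := by rw [hA2]; exact Nat.le_ceil _
  have hpos2 : 0 ≤ 4 * l2 * (9 * (q:ℝ) / 8 + t + 1) := by
    have : 0 ≤ 9 * (q:ℝ) / 8 + t + 1 := by linarith
    have : 0 ≤ l2 := by linarith
    positivity
  have hA2hi : (A2:ℝ) ≤ 4 * l2 * (9 * q / 8 + t + 1) + 1 := by
    rw [hA2]; exact (Nat.ceil_lt_add_one hpos2).le
  obtain ⟨n1, n2⟩ := numII L Q q r u l2 A1 A2 t hl2 hL4 hQ hqR hqQR hrq huQ hr2 htQ hA1hi hA2hi (by positivity) (by positivity)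
  have hA2ge : (10:ℝ) ≤ A2 := by
    refine le_trans ?_ hA2lo
    have h1 : l2 * 1 ≤ l2 * (9 * q / 8 + t + 1) := mul_le_mul_of_nonneg_left (by linarith) (by linarith)
    linarith
  have hA1ge : (1:ℝ) ≤ A1 := by linarith
  refine stepII_core G q q2 s1 s2 r L A1 A2 hq0 hq2 ?_ ?_ (by exact_mod_cast hA1ge) (by exact_mod_cast hA2ge)
    (by exact_mod_cast n1) ?_ ?_
  · refine le_trans ?_ hA1lo
    rw [abs_of_nonneg (show (0:ℝ) ≤ q by linarith)]
    have h1 : l2 * (q + |(q2:ℝ)|) ≤ l2 * (5 / 4 * q) := mul_le_mul_of_nonneg_left (by linarith) (by linarith)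
    linarith
  · refine le_trans ?_ hA2lo
    push_cast
    rw [abs_of_nonneg (show (0:ℝ) ≤ 1 + s1 by linarith)]
    have h1 : l2 * ((1 + s1) + |(s2:ℝ)|) ≤ l2 * (9 * q / 8 + t) := mul_le_mul_of_nonneg_left (by linarith) (by linarith)
    linarith
  · have hX : (r:ℝ) * (24 * L * A1) ≤ u * Q := by
      have h1 : (A1:ℝ) ≤ 6 * (q * l2) := by linarith
      have h2 : (r:ℝ) * (24 * L * A1) ≤ r * (24 * L * (6 * (q * l2))) := by gcongr
      have h3 : (r:ℝ) * (24 * L * (6 * (q * l2))) = (r * q) * (144 * (L * l2)) := by ring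
      have h4 : 144 * ((L:ℝ) * l2) ≤ Q := by
        refine le_trans ?_ hQ
        have : 4 * (L:ℝ) * l2 ≤ (L:ℝ) ^ 2 * l2 := mul_le_mul_of_nonneg_right (by nlinarith) (by linarith)
        have : 0 ≤ (L:ℝ) * l2 := by positivity
        linarith
      have h5 : ((r:ℝ) * q) * (144 * (L * l2)) ≤ u * Q := mul_le_mul hrq h4 (by positivity) hu0.le
      linarith
    have hr1 : (1:ℝ) ≤ r := by nlinarith
    have hXpos : (0:ℝ) < (r:ℝ) * (24 * L * A1) := by positivity
    have h1 : Real.log (r * (24 * L * A1)) ≤ Real.log u + Real.log Q := by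
      rw [← Real.log_mul hu0.ne' hQR0.ne']
      exact Real.log_le_log hXpos hX
    have h2 : 3 * Real.log Q ≤ Real.log u := by
      have : Real.log ((Q:ℝ) ^ 3) ≤ Real.log u := Real.log_le_log (by positivity) (by
        have : 0 ≤ (Q:ℝ) ^ 3 := by positivity
        linarith)
      rw [Real.log_pow] at this
      exact_mod_cast this
    linarith
  · rw [← hue, ← hve]
    obtain ⟨w, hw⟩ : ∃ w : ℝ, w = L * L * A1 * A2 := ⟨_, rfl⟩
    have h1 : 48 * ((L:ℝ) * L * A1) ≤ 5 * w := by
      rw [hw]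
      have : (L:ℝ) * L * A1 * 10 ≤ L * L * A1 * A2 := mul_le_mul_of_nonneg_left hA2ge (by positivity)
      linarith [show (0:ℝ) ≤ (L:ℝ) * L * A1 by positivity]
    have h2 : 5 * w ≤ Real.exp (5 * w) := by
      have := Real.add_one_le_exp (5 * w); linarith
    have h3 : 2 * (L * (24 * L * A1) * |Lam a al u v|) * Real.exp (2600 * L * L * A1 * A2)
        ≤ Real.exp (5 * w) * Real.exp (-(2.4 * u * l2)) * Real.exp (2600 * w) := by
      have k1 : 2600 * (L:ℝ) * L * A1 * A2 = 2600 * w := by rw [hw]; ring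
      have k2 : 2 * (L * (24 * L * A1) * |Lam a al u v|) = (48 * ((L:ℝ) * L * A1)) * |Lam a al u v| := by ring
      rw [k1, k2]
      apply mul_le_mul_of_nonneg_right _ (Real.exp_nonneg _)
      exact mul_le_mul (h1.trans h2) hLam (abs_nonneg _) (Real.exp_nonneg _)
    refine h3.trans ?_
    rw [← Real.exp_add, ← Real.exp_add]
    apply Real.exp_le_one_iff.2
    have k : 2605 * w ≤ 2.4 * u * l2 := by rw [hw]; linarith
    linarith

end T12


open Finset Matrix

namespace T12

lemma log_ten_le : Real.log 10 ≤ 2.3105 := by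
  have h1 : Real.log ((10:ℝ) ^ 3) ≤ Real.log ((2:ℝ) ^ 10) := Real.log_le_log (by norm_num) (by norm_num)
  rw [Real.log_pow, Real.log_pow] at h1
  push_cast at h1
  have := Real.log_two_lt_d9
  linarith

variable {a b : ℤ} {al : Fin 3 → ℝ} {l1 l2 e : ℝ}

theorem stepIIb (G : Gen a b al l1 l2 e) (u v : ℤ) (hu : 1 ≤ u) (hv : |v| * 8 ≤ u)
    (hLam : |Lam a al u v| ≤ Real.exp (-(2.4 * u * l2))) (B c : ℝ) (N : ℕ) (hB : l2 ≤ B) (hc48 : 48 ≤ c)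
    (hc : 8 * (N * 2.3105) + 5 ≤ c) (hnum : 2 * (100001 * B) ^ 3 * c ^ 6 ≤ 10 ^ N) : (u:ℝ) < 10 ^ N := by
  by_contra hcon
  push Not at hcon
  have hl2 := G.hl2
  have huR : (1:ℝ) ≤ u := by exact_mod_cast hu
  have hu0 : (0:ℝ) < u := by linarith
  obtain ⟨x, hx⟩ : ∃ x, x = Real.log u := ⟨_, rfl⟩
  have hx0 : 0 ≤ x := by rw [hx]; exact Real.log_nonneg huR
  obtain ⟨L, hL⟩ : ∃ L : ℕ, L = ⌈8 * x + 4⌉₊ := ⟨_, rfl⟩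
  have hLlo : 8 * x + 4 ≤ L := by rw [hL]; exact Nat.le_ceil _
  have hLhi : (L:ℝ) ≤ 8 * x + 5 := by rw [hL]; exact (Nat.ceil_lt_add_one (by linarith)).le.trans (by linarith)
  obtain ⟨Q, hQ⟩ : ∃ Q : ℕ, Q = ⌈1e5 * (L:ℝ) ^ 2 * l2⌉₊ := ⟨_, rfl⟩
  have hQlo : 1e5 * (L:ℝ) ^ 2 * l2 ≤ Q := by rw [hQ]; exact Nat.le_ceil _
  have hpos : 0 ≤ 1e5 * (L:ℝ) ^ 2 * l2 := by
    have : 0 ≤ l2 := by linarith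
    positivity
  have hQhi : (Q:ℝ) ≤ 1e5 * (L:ℝ) ^ 2 * l2 + 1 := by rw [hQ]; exact (Nat.ceil_lt_add_one hpos).le
  have hlt := stepII G u v hu hv hLam L Q (by rw [← hx]; exact hLlo) hQlo
  have hltR : (u:ℝ) < 2 * (Q:ℝ) ^ 3 := by exact_mod_cast hlt
  -- bounds
  have hLL : (16:ℝ) ≤ (L:ℝ) ^ 2 := by nlinarith
  have hQ2 : (Q:ℝ) ≤ 100001 * B * (8 * x + 5) ^ 2 := by
    have h1 : (16:ℝ) * 693 ≤ (L:ℝ) ^ 2 * l2 := mul_le_mul hLL hl2 (by norm_num) (by positivity)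
    have h2 : (L:ℝ) ^ 2 * l2 ≤ (8 * x + 5) ^ 2 * B := by
      apply mul_le_mul _ hB (by linarith) (by positivity)
      gcongr
    linarith
  have hQ3 : (u:ℝ) < 2 * (100001 * B) ^ 3 * (8 * x + 5) ^ 6 := by
    refine hltR.trans_le ?_
    have : (Q:ℝ) ^ 3 ≤ (100001 * B * (8 * x + 5) ^ 2) ^ 3 := by gcongr
    calc 2 * (Q:ℝ) ^ 3 ≤ 2 * (100001 * B * (8 * x + 5) ^ 2) ^ 3 := by linarith
      _ = _ := by ring
  obtain ⟨d, hd⟩ : ∃ d, d = x - N * Real.log 10 := ⟨_, rfl⟩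
  have hd0 : 0 ≤ d := by
    have : Real.log (10 ^ N) ≤ Real.log u := Real.log_le_log (by positivity) hcon
    rw [Real.log_pow] at this
    linarith
  have hle : 8 * x + 5 ≤ c * Real.exp (d / 6) := by
    have h1 : (N:ℝ) * Real.log 10 ≤ N * 2.3105 := mul_le_mul_of_nonneg_left log_ten_le (by positivity)
    have h2 : d / 6 + 1 ≤ Real.exp (d / 6) := Real.add_one_le_exp _
    have h3 : c * (d / 6 + 1) ≤ c * Real.exp (d / 6) := mul_le_mul_of_nonneg_left h2 (by linarith)
    have h4 : 48 * (d / 6) ≤ c * (d / 6) := mul_le_mul_of_nonneg_right hc48 (by linarith)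
    linarith
  have h6 : (8 * x + 5) ^ 6 ≤ c ^ 6 * Real.exp d := by
    have : (8 * x + 5) ^ 6 ≤ (c * Real.exp (d / 6)) ^ 6 := by gcongr
    rw [mul_pow, ← Real.exp_nat_mul] at this
    have e1 : ((6:ℕ):ℝ) * (d / 6) = d := by push_cast; ring
    rwa [e1] at this
  have hexp : Real.exp d * 10 ^ N = u := by
    rw [hd, Real.exp_sub, hx, Real.exp_log hu0, ← Real.log_pow, Real.exp_log (by positivity)]
    field_simp
  have hB0 : 0 ≤ B := by linarith
  have h7 : 2 * (100001 * B) ^ 3 * (8 * x + 5) ^ 6 ≤ 2 * (100001 * B) ^ 3 * (c ^ 6 * Real.exp d) :=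
    mul_le_mul_of_nonneg_left h6 (by positivity)
  have h8 : 2 * (100001 * B) ^ 3 * c ^ 6 * Real.exp d ≤ 10 ^ N * Real.exp d :=
    mul_le_mul_of_nonneg_right hnum (Real.exp_nonneg _)
  linarith

theorem uA (G : Gen a b al l1 l2 e) (u v : ℤ) (hu : 1 ≤ u) (hv : |v| * 8 ≤ u)
    (hLam : |Lam a al u v| ≤ Real.exp (-(2.4 * u * l2))) (hB : l2 ≤ 2011) : (u:ℝ) < 10 ^ 43 :=
  stepIIb G u v hu hv hLam 2011 800 43 hB (by norm_num) (by norm_num) (by norm_num)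

theorem uC (G : Gen a b al l1 l2 e) (u v : ℤ) (hu : 1 ≤ u) (hv : |v| * 8 ≤ u)
    (hLam : |Lam a al u v| ≤ Real.exp (-(2.4 * u * l2))) (hB : l2 ≤ 7.15e14) : (u:ℝ) < 10 ^ 80 :=
  stepIIb G u v hu hv hLam 7.15e14 1484 80 hB (by norm_num) (by norm_num) (by norm_num)

/-- the linear relation fed to the reduction step -/
theorem relation (G : Gen a b al l1 l2 e) (u v : ℤ) (hu : 1 ≤ u) (hv0 : v < 0) (hv : |v| * 8 ≤ u)
    (hLam : |Lam a al u v| ≤ Real.exp (-(2.4 * u * l2))) (hel : Real.exp (-l2) ≤ e) :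
    ∃ p q : ℤ, 1 ≤ q ∧ |p| ≤ q ∧ (q:ℝ) ≤ 1.125 * u ∧ |(p:ℝ) * l2 - q * l1| ≤ 7.5 * e * q := by
  have huR : (1:ℝ) ≤ u := by exact_mod_cast hu
  have hvR : |(v:ℝ)| * 8 ≤ u := by exact_mod_cast hv
  have hv0R : (v:ℝ) < 0 := by exact_mod_cast hv0
  rw [abs_of_neg hv0] at hv
  refine ⟨u + 2 * v, u - v, by omega, by rw [abs_le]; constructor <;> omega, ?_, ?_⟩
  · rw [abs_of_neg hv0R] at hvR
    push_cast; linarith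
  · have happ := abs_le.1 (Lam_approx G u v)
    have hl2 := G.hl2
    have h1 : |Lam a al u v| ≤ e := by
      refine hLam.trans (le_trans (Real.exp_le_exp.2 ?_) hel)
      nlinarith
    have h1' := abs_le.1 h1
    have he0 := G.he0
    rw [abs_of_neg hv0R] at hvR happ
    rw [abs_of_pos (show (0:ℝ) < u by linarith)] at happ
    have h2 : e * 1 ≤ e * u := mul_le_mul_of_nonneg_left huR he0
    have h3 : e * (-v * 8) ≤ e * u := mul_le_mul_of_nonneg_left hvR he0
    have h4 : 0 ≤ e * (-v) := mul_nonneg he0 (by linarith)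
    push_cast
    rw [abs_le]
    constructor <;> linarith

end T12


open Finset Matrix

namespace T12

/-- truncated fixed-point sum of the series `∑ 1 / ((2 k + 1) b ^ k)` -/
def atS (M b : ℕ) : ℕ → ℕ
  | 0 => 0
  | k + 1 => atS M b k + M / ((2 * k + 1) * b ^ k)

lemma atS_bound (M b : ℕ) (hb : 0 < b) (T : ℕ) :
    (atS M b T : ℝ) ≤ M * ∑ k ∈ range T, 1 / ((2 * (k:ℝ) + 1) * (b:ℝ) ^ k) ∧
    M * ∑ k ∈ range T, 1 / ((2 * (k:ℝ) + 1) * (b:ℝ) ^ k) ≤ atS M b T + T := by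
  induction T with
  | zero => simp [atS]
  | succ k ih =>
    rw [Finset.sum_range_succ, mul_add]
    have hd : 0 < (2 * k + 1) * b ^ k := by positivity
    have h1 : ((M / ((2 * k + 1) * b ^ k) : ℕ) : ℝ) ≤ M * (1 / ((2 * (k:ℝ) + 1) * (b:ℝ) ^ k)) := by
      refine Nat.cast_div_le.trans (le_of_eq ?_)
      push_cast; ring
    have h2 : M * (1 / ((2 * (k:ℝ) + 1) * (b:ℝ) ^ k)) ≤ ((M / ((2 * k + 1) * b ^ k) : ℕ) : ℝ) + 1 := by
      have h3 := Nat.lt_div_mul_add hd (a := M)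
      have h4 : (M:ℝ) ≤ ((M / ((2 * k + 1) * b ^ k) : ℕ) : ℝ) * ((2 * k + 1) * (b:ℝ) ^ k) + (2 * k + 1) * (b:ℝ) ^ k := by
        exact_mod_cast h3.le
      have hdR : 0 < (2 * (k:ℝ) + 1) * (b:ℝ) ^ k := by positivity
      rw [mul_one_div, div_le_iff₀ hdR]
      linarith
    simp only [atS]
    push_cast at h1 h2 ih ⊢
    constructor <;> linarith [ih.1, ih.2]

lemma At_bound (M b T : ℕ) (x : ℝ) (hb : 2 ≤ b) (hx0 : 0 < x) (hx1 : x < 1) (hxb : x ^ 2 * b = 1)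
    (hT : 2 * M ≤ b ^ T) :
    (atS M b T : ℝ) ≤ M * ((Real.log (1 + x) - Real.log (1 - x)) / (2 * x)) ∧
    M * ((Real.log (1 + x) - Real.log (1 - x)) / (2 * x)) ≤ atS M b T + T + 1 := by
  have hb0 : 0 < b := by omega
  have hbR : (2:ℝ) ≤ b := by exact_mod_cast hb
  obtain ⟨f, hf⟩ : ∃ f : ℕ → ℝ, f = fun k : ℕ => 1 / ((2 * (k:ℝ) + 1) * (b:ℝ) ^ k) := ⟨_, rfl⟩
  have hs : HasSum f ((Real.log (1 + x) - Real.log (1 - x)) / (2 * x)) := by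
    have h := (Real.hasSum_log_sub_log_of_abs_lt_one (show |x| < 1 by rw [abs_of_pos hx0]; exact hx1)).div_const (2 * x)
    have hfe : f = fun k : ℕ => 2 * (1 / (2 * (k:ℝ) + 1)) * x ^ (2 * k + 1) / (2 * x) := by
     rw [hf]
     funext k
     have h1 : (b:ℝ) = (x ^ 2)⁻¹ := by
       exact eq_inv_of_mul_eq_one_left (by linarith)
     rw [h1, inv_pow, ← pow_mul, pow_succ]
     field_simp
    rw [hfe]; exact h
  obtain ⟨B1, B2⟩ := atS_bound M b hb0 T
  have hfk : ∀ k : ℕ, 1 / ((2 * (k:ℝ) + 1) * (b:ℝ) ^ k) = f k := fun k => by rw [hf]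
  simp only [hfk] at B1 B2
  have hf0 : ∀ k, 0 ≤ f k := fun k => by rw [← hfk]; positivity
  have hM0 : (0:ℝ) ≤ M := by positivity
  constructor
  · refine B1.trans (mul_le_mul_of_nonneg_left ?_ hM0)
    exact sum_le_hasSum _ (fun k _ => hf0 k) hs
  · have ht := (hasSum_nat_add_iff' T).2 hs
    have hg : HasSum (fun k : ℕ => ((b:ℝ) ^ T)⁻¹ * (1 / 2 : ℝ) ^ k) (((b:ℝ) ^ T)⁻¹ * 2) := by
      have := hasSum_geometric_two
      exact this.mul_left _
    have hle : ∀ k, f (k + T) ≤ ((b:ℝ) ^ T)⁻¹ * (1 / 2 : ℝ) ^ k := by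
      intro k
      rw [← hfk, pow_add, one_div, mul_inv, mul_inv]
      have h1 : (2 * ((k + T : ℕ):ℝ) + 1)⁻¹ ≤ 1 := inv_le_one_of_one_le₀ (by
        have : (0:ℝ) ≤ ((k + T : ℕ):ℝ) := by positivity
        linarith)
      have h2 : ((b:ℝ) ^ k)⁻¹ ≤ (1 / 2 : ℝ) ^ k := by
        rw [← inv_pow]
        apply pow_le_pow_left₀ (by positivity)
        rw [one_div]; exact inv_anti₀ (by norm_num) hbR
      calc (2 * ((k + T : ℕ):ℝ) + 1)⁻¹ * (((b:ℝ) ^ k)⁻¹ * ((b:ℝ) ^ T)⁻¹)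
          ≤ 1 * ((1 / 2 : ℝ) ^ k * ((b:ℝ) ^ T)⁻¹) := by gcongr
        _ = _ := by ring
    have h3 := hasSum_le hle ht hg
    have h4 : (M:ℝ) * (((b:ℝ) ^ T)⁻¹ * 2) ≤ 1 := by
      have : (2:ℝ) * M ≤ (b:ℝ) ^ T := by exact_mod_cast hT
      have hp : 0 < (b:ℝ) ^ T := by positivity
      rw [← mul_assoc, mul_comm, ← mul_assoc, ← div_eq_mul_inv, div_le_one hp]; exact this
    have h5 := mul_le_mul_of_nonneg_left h3 hM0
    rw [mul_sub] at h5
    linarith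

/-- scaling factor `10 ^ 330` -/
def Mc : ℕ := 10 ^ 330
/-- scaled `log 2` -/
def Dc : ℕ := 693147180559945309417232121458176568075500134360255254120680009493393621969694715605863326996418687542001481020570685733685520235758130557032670751635075961930727570828371435190307038623891673471123350115364497955239120475172681574932065155524734139525882950453007095326366642654104239157814952043740430385500801944170641671518533
/-- scaled `log φ` -/
def Ac : ℕ := 481211825059603447497758913424368423135184334385660519661018168840163867608221774412009429122723474997231839958293656411272568323726737622753059241864409754182417007211837150223823937469187275243279193018797079003561726796944545752305345434188765285532564902073996934966187556301021239963679308206359977988509980156825797852649228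
/-- scaled `log √5` -/
def Cc : ℕ := 804718956217050187300379666613093819762800677134258860956323945737089493853828882315066939046589805399983151510857781449862002614662338099816808308731852863776089818748591622826746428101170762528635077596800439888694862844096770356383077365610904763974260646410679029861283836142643620230794724089182335664336999212318879796594590

/-- scaled `√5` -/
def Sc : ℕ := 2236067977499789696409173668731276235440618359611525724270897245410520925637804899414414408378782274969508176150773783504253267724447073863586360121533452708866778173191879165811276645322639856580535761350417533785003423392414064442086432539097252592627228876299517402440681611775908909498492371390729728898482088641542689894099131

set_option exponentiation.threshold 1000 in
lemma logchk : (3 * Dc ≤ 2 * atS Mc 9 480 ∧ 2 * (atS Mc 9 480 + (480 + 1)) ≤ 3 * (Dc + 400)) ∧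
    (9 * Cc ≤ 9 * Dc + atS Mc 81 480 ∧ 9 * (Dc + 400) + (atS Mc 81 480 + (480 + 1)) ≤ 9 * (Cc + 1000)) ∧
    (5 * Mc * Ac ≤ Sc * atS Mc 5 480 ∧
      (Sc + 1) * (atS Mc 5 480 + (480 + 1)) ≤ 5 * Mc * (Ac + 1000)) ∧
    (2 * Mc ≤ 9 ^ 480 ∧ 2 * Mc ≤ 81 ^ 480 ∧ 2 * Mc ≤ 5 ^ 480 ∧ 0 < Mc ∧ Sc * Sc ≤ 5 * Mc * Mc ∧ 5 * Mc * Mc < (Sc + 1) * (Sc + 1)) := by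
  decide +kernel

lemma logs_gen (M D A C S T : ℕ) (h : (3 * D ≤ 2 * atS M 9 T ∧ 2 * (atS M 9 T + (T + 1)) ≤ 3 * (D + 400)) ∧
    (9 * C ≤ 9 * D + atS M 81 T ∧ 9 * (D + 400) + (atS M 81 T + (T + 1)) ≤ 9 * (C + 1000)) ∧
    (5 * M * A ≤ S * atS M 5 T ∧
      (S + 1) * (atS M 5 T + (T + 1)) ≤ 5 * M * (A + 1000)) ∧
    (2 * M ≤ 9 ^ T ∧ 2 * M ≤ 81 ^ T ∧ 2 * M ≤ 5 ^ T ∧ 0 < M ∧ S * S ≤ 5 * M * M ∧ 5 * M * M < (S + 1) * (S + 1))) :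
    |M * Real.log 2 - D| ≤ 1000 ∧ |M * Real.log Real.goldenRatio - A| ≤ 1000 ∧
      |M * (Real.log 5 / 2) - C| ≤ 1000 := by
  obtain ⟨⟨a1, a2⟩, ⟨b1, b2⟩, ⟨c1, c2⟩, t1, t2, t3, hM, hS1, hS2⟩ := h
  obtain ⟨i1, i2⟩ := At_bound M 9 T (1 / 3) (by norm_num) (by norm_num) (by norm_num) (by norm_num) t1
  obtain ⟨j1, j2⟩ := At_bound M 81 T (1 / 9) (by norm_num) (by norm_num) (by norm_num) (by norm_num) t2
  have h5 : Real.sqrt 5 ^ 2 = 5 := Real.sq_sqrt (by norm_num)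
  have h50 : 0 < Real.sqrt 5 := by positivity
  have h51 : 1 < Real.sqrt 5 := by rw [Real.lt_sqrt] <;> norm_num
  obtain ⟨k1, k2⟩ := At_bound M 5 T (1 / Real.sqrt 5) (by norm_num) (by positivity)
    (by rw [div_lt_one h50]; exact h51) (by rw [div_pow, h5]; norm_num) t3
  have e1 : (Real.log (1 + 1 / 3) - Real.log (1 - 1 / 3)) / (2 * (1 / 3)) = 3 / 2 * Real.log 2 := by
    rw [← Real.log_div (by norm_num) (by norm_num)]; norm_num; ring
  have e2 : (Real.log (1 + 1 / 9) - Real.log (1 - 1 / 9)) / (2 * (1 / 9)) = 9 / 2 * (Real.log 5 - 2 * Real.log 2) := by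
    rw [← Real.log_div (by norm_num) (by norm_num), show ((1:ℝ) + 1 / 9) / (1 - 1 / 9) = 5 / 2 ^ 2 by norm_num,
      Real.log_div (by norm_num) (by norm_num), Real.log_pow]; push_cast; ring
  have e3 : (Real.log (1 + 1 / Real.sqrt 5) - Real.log (1 - 1 / Real.sqrt 5)) / (2 * (1 / Real.sqrt 5))
      = Real.sqrt 5 * Real.log Real.goldenRatio := by
    have hlt : 1 / Real.sqrt 5 < 1 := by rw [div_lt_one h50]; exact h51
    have hp : 0 < 1 / Real.sqrt 5 := by positivity
    rw [← Real.log_div (by linarith) (by linarith)]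
    have : (1 + 1 / Real.sqrt 5) / (1 - 1 / Real.sqrt 5) = Real.goldenRatio ^ 2 := by
      rw [div_eq_iff (by linarith), Real.goldenRatio]
      field_simp
      ring_nf
      rw [show Real.sqrt 5 ^ 3 = Real.sqrt 5 ^ 2 * Real.sqrt 5 by ring, h5]; ring
    rw [this, Real.log_pow]; field_simp; push_cast; ring
  rw [e1] at i1 i2
  rw [e2] at j1 j2
  rw [e3] at k1 k2
  have hMR : (0:ℝ) < M := by exact_mod_cast hM
  have a1' : 3 * (D:ℝ) ≤ 2 * atS M 9 T := by exact_mod_cast a1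
  have a2' : 2 * ((atS M 9 T:ℝ) + (T + 1)) ≤ 3 * (D + 400) := by exact_mod_cast a2
  have b1' : 9 * (C:ℝ) ≤ 9 * D + atS M 81 T := by exact_mod_cast b1
  have b2' : 9 * ((D:ℝ) + 400) + (atS M 81 T + (T + 1)) ≤ 9 * (C + 1000) := by exact_mod_cast b2
  refine ⟨?_, ?_, ?_⟩
  · rw [abs_le]; constructor <;> linarith
  · obtain ⟨s, hs⟩ : ∃ s, s = S := ⟨_, rfl⟩
    have s1 : (s:ℝ) ≤ Real.sqrt 5 * M := by
      have h1 : s * s ≤ 5 * M * M := by rw [hs]; exact hS1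
      have h2 : (s:ℝ) ^ 2 ≤ (Real.sqrt 5 * M) ^ 2 := by
        rw [mul_pow, h5]
        have : (s:ℝ) * s ≤ 5 * M * M := by exact_mod_cast h1
        linarith
      exact le_of_sq_le_sq h2 (by positivity)
    have s2 : Real.sqrt 5 * M ≤ s + 1 := by
      have h1 : 5 * M * M < (s + 1) * (s + 1) := by rw [hs]; exact hS2
      have h2 : (Real.sqrt 5 * M) ^ 2 ≤ ((s:ℝ) + 1) ^ 2 := by
        rw [mul_pow, h5]
        have : (5:ℝ) * M * M < (s + 1) * (s + 1) := by exact_mod_cast h1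
        linarith
      exact le_of_sq_le_sq h2 (by positivity)
    rw [← hs] at c1 c2
    have c1' : 5 * (M:ℝ) * A ≤ s * atS M 5 T := by exact_mod_cast c1
    have c2' : ((s:ℝ) + 1) * (atS M 5 T + (T + 1)) ≤ 5 * M * (A + 1000) := by exact_mod_cast c2
    have hP : (Real.sqrt 5 * M) * (M * (Real.sqrt 5 * Real.log Real.goldenRatio)) = 5 * M * (M * Real.log Real.goldenRatio) := by
      linear_combination (M * M * Real.log Real.goldenRatio) * h5
    have lo : 5 * (M:ℝ) * A ≤ 5 * M * (M * Real.log Real.goldenRatio) := by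
      rw [← hP]
      exact c1'.trans (mul_le_mul s1 k1 (by positivity) (by positivity))
    have hi : 5 * M * (M * Real.log Real.goldenRatio) ≤ 5 * (M:ℝ) * (A + 1000) := by
      rw [← hP]
      refine le_trans (mul_le_mul s2 (k2.trans (by linarith)) ?_ (by positivity)) c2'
      exact le_trans (by positivity) k1
    have lo' := le_of_mul_le_mul_left lo (by positivity)
    have hi' := le_of_mul_le_mul_left hi (by positivity)
    rw [abs_le]; constructor <;> linarith
  · rw [abs_le]; constructor <;> linarith

lemma logs : |Mc * Real.log 2 - Dc| ≤ 1000 ∧ |Mc * Real.log Real.goldenRatio - Ac| ≤ 1000 ∧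
      |Mc * (Real.log 5 / 2) - Cc| ≤ 1000 := logs_gen Mc Dc Ac Cc Sc 480 logchk

end T12


open Finset Matrix

namespace T12

/-- Euclidean algorithm with fuel, returning two consecutive convergent denominators -/
def euc (den Q2 : ℕ) : ℕ → ℕ → ℕ → ℕ → ℕ → ℕ × ℕ
  | 0, _, _, m0, m1 => (m0, m1)
  | k + 1, r0, r1, m0, m1 =>
    match Nat.ble den (r0 * Q2) with
    | false => (m0, m1)
    | true =>
      match r0 % r1, m0 + (r0 / r1) * m1 with
      | s + 1, t + 1 => euc den Q2 k r1 (s + 1) m1 (t + 1)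
      | _, _ => (m0, m1)

/-- one convergent is good -/
def goodPair (num den Q2 kap m h : ℕ) : Bool :=
  Nat.blt (Q2 * (m * num)) (den + Q2 * (h * den)) && Nat.blt (Q2 * (h * den)) (den + Q2 * (m * num)) &&
    Nat.blt (2 * (m * kap)) den

/-- the final test on two pairs -/
def goodTwo (num den Q2 kap m0 m1 h0 h1 : ℕ) : Bool :=
  goodPair num den Q2 kap m0 h0 && goodPair num den Q2 kap m1 h1 && !(Nat.beq (m0 * h1) (m1 * h0))

/-- nearest integer multiplier -/
def rnd (num den m : ℕ) : ℕ := (m * num + den / 2) / den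

/-- full test -/
def goodN (num den Q2 kap : ℕ) : Bool :=
  match euc den Q2 120 den num 0 1 with
  | (m0, m1) => goodTwo num den Q2 kap m0 m1 (rnd num den m0) (rnd num den m1)

/-- test for a range of `n` -/
def goodRange (A D C Q2 kap : ℕ) (n0 : ℕ) : ℕ → Bool
  | 0 => true
  | k + 1 => goodRange A D C Q2 kap n0 k && goodN ((n0 + k) * A - C) ((n0 + k) * D) Q2 kap

set_option exponentiation.threshold 1000 in
lemma goodA : goodRange Ac Dc Cc (2 * (12 * 10 ^ 42)) (144 * 10 ^ 280) 1001 500 = true := by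
  decide +kernel

lemma goodRange_spec (A D C Q2 kap n0 : ℕ) : ∀ k, goodRange A D C Q2 kap n0 k = true →
    ∀ n, n0 ≤ n → n < n0 + k → goodN (n * A - C) (n * D) Q2 kap = true := by
  intro k
  induction k with
  | zero => intro _ n h1 h2; omega
  | succ k ih =>
    intro h n h1 h2
    simp only [goodRange, Bool.and_eq_true] at h
    rcases Nat.lt_or_ge n (n0 + k) with h3 | h3
    · exact ih h.1 n h1 h3
    · have : n = n0 + k := by omega
      rw [this]; exact h.2

lemma goodPair_sound (num den Q kap m h : ℕ) (hg : goodPair num den (2 * Q) kap m h = true) (p q : ℤ)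
    (hq0 : 0 ≤ q) (hq : q ≤ Q) (hp : |p * den - q * num| ≤ kap) : (m:ℤ) * p = h * q := by
  unfold goodPair at hg
  simp only [Bool.and_eq_true, Nat.blt_eq] at hg
  obtain ⟨⟨g1, g2⟩, g3⟩ := hg
  have g1' : 2 * (Q:ℤ) * (m * num) < den + 2 * Q * (h * den) := by exact_mod_cast g1
  have g2' : 2 * (Q:ℤ) * (h * den) < den + 2 * Q * (m * num) := by exact_mod_cast g2
  have g3' : 2 * ((m:ℤ) * kap) < den := by exact_mod_cast g3
  have hmk : 0 ≤ (m:ℤ) * kap := by positivity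
  have hden : (0:ℤ) < den := by linarith
  by_contra hne
  have h1 : 1 ≤ |(m:ℤ) * p - h * q| := Int.one_le_abs (sub_ne_zero.2 hne)
  have h2 : ((m:ℤ) * p - h * q) * den = m * (p * den - q * num) + q * (m * num - h * den) := by ring
  have h3 : (den:ℤ) ≤ |(m:ℤ) * p - h * q| * den := by nlinarith
  have h4 : |(m:ℤ) * p - h * q| * den = |(m * (p * den - q * num) + q * (m * num - h * den) : ℤ)| := by
    rw [← h2, abs_mul, abs_of_pos hden]
  have h5 : |(m * (p * den - q * num) + q * (m * num - h * den) : ℤ)| ≤ m * kap + Q * |(m * num - h * den : ℤ)| := by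
    refine (abs_add_le _ _).trans ?_
    rw [abs_mul, abs_mul, abs_of_nonneg hq0, abs_of_nonneg (show (0:ℤ) ≤ m by positivity)]
    exact add_le_add (mul_le_mul_of_nonneg_left hp (by positivity)) (mul_le_mul_of_nonneg_right hq (abs_nonneg _))
  have h6 : 2 * ((Q:ℤ) * |(m * num - h * den : ℤ)|) < den := by
    rcases abs_cases ((m:ℤ) * num - h * den) with ⟨k1, _⟩ | ⟨k1, _⟩ <;> rw [k1] <;> linarith
  linarith

lemma goodN_sound (num den Q kap : ℕ) (hg : goodN num den (2 * Q) kap = true) (p q : ℤ)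
    (hq0 : 1 ≤ q) (hq : q ≤ Q) (hp : |p * den - q * num| ≤ kap) : False := by
  unfold goodN at hg
  generalize euc den (2 * Q) 120 den num 0 1 = pr at hg
  obtain ⟨m0, m1⟩ := pr
  simp only at hg
  generalize rnd num den m0 = h0 at hg
  generalize rnd num den m1 = h1 at hg
  unfold goodTwo at hg
  simp only [Bool.and_eq_true, Bool.not_eq_true'] at hg
  obtain ⟨⟨g0, g1⟩, g2⟩ := hg
  have e0 := goodPair_sound num den Q kap m0 h0 g0 p q (by omega) hq hp
  have e1 := goodPair_sound num den Q kap m1 h1 g1 p q (by omega) hq hp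
  have : q * ((m0:ℤ) * h1 - m1 * h0) = 0 := by linear_combination (m1:ℤ) * e0 - m0 * e1
  rcases mul_eq_zero.1 this with h | h
  · omega
  · have h3 : (m0:ℤ) * h1 = m1 * h0 := by linarith
    have h4 : m0 * h1 = m1 * h0 := by exact_mod_cast h3
    rw [h4] at g2
    simp at g2

/-- reduction vectors -/
def vecB : List (ℤ × ℤ × ℤ) :=
  [(-45523447915487296600948165387241629695079204017439728019964911146880533530488361811598491360, 31604285595911637009751607270182579118038094202546421390587962251962316663445622162112704539, -52851086345555742651645629314547044017270311036925396670466117950635979081060657815188426632),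
    (146642493398298644673655962861845893087151907898590700179234723206383949493564422307360634465, -101805365236400015530629632493528340400899942227569196617282012280281893748136548168537847144, 170246662662922091054678672098691982885255856519641579174085125358759302396672765580624794715),
    (306875870602082612794847792161155663129833283304888574298454631691620375473971471256702467898, -213046091653851528378560896380353478440451755042238677539990092833122856356796926948555021819, 356271852796997203299746655038426569074658819011638850231698850598211514941947865696582866387)]

/-- reduction vectors -/
def vecC : List (ℤ × ℤ × ℤ) :=
  [(49041525318194239576902212678713682202682804204295872285807745054419853030200461113850436811054648871618179737508467975075040908595819455470554587454681981392623735229750589245197019, -34046682384267536958763121878679433711027224731392549863809099475491797186033116415863922968584719861755187717026779631882835737130112850442182505293170182380470951183462871782109392, 56935447726222548636035237839264411760241465403965779760027919550494930075830151663947816569648745455922797728799196573887404070903726828067257325121053141613857921809066260250810986),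
    (-24829393353528764674802686840949035439634618341097862163869526788073017581793177410677254091216613771044708277819618071969153255105438661916163036582082856345789150906919560449507515, 17237605556041139928775202757672320544032103574984545911085636920583742030986463308244583487816442117888891976029779846462613832492709718006692753365284952677734326399939722673945524, -28826033003283990758961060647269044876664988084483390382788389647857003980624128285817195367039544799888662404144522206748552907463567663361104013838446518173207770414169705128420831),
    (-66997970490305511385727153491694215012431527241841650018019187897034319728826208506971145563325779492975883399965935721778112015300557971592998248930440451375823616579365302533785535, 46512799242557325551442056691807464340877674011597415059247909673507974457862485873411314623724662976042159425873802425290384040291615073105017176431533794498357312470534252918619555, -77782234990937398963190311547679376992138399570037581398209060396841138451413935596889541350919934779157109906733810627379441636400914578923679342947812995019700743877995323084418689)]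

/-- test of a reduction vector -/
def goodVec (A D C kap Ym Wm : ℤ) (m : ℤ × ℤ × ℤ) : Bool :=
  decide (|m.1| * kap + Ym * (|m.1 * A + m.2.1 * D| + 1000 * (|m.1| + |m.2.1|))
    + Wm * (|m.2.2 * D - m.1 * C| + 1000 * (|m.1| + |m.2.2|)) < D - 1000)

/-- determinant test -/
def goodDet : List (ℤ × ℤ × ℤ) → Bool
  | [x, y, z] => decide (x.1 * (y.2.1 * z.2.2 - y.2.2 * z.2.1) - x.2.1 * (y.1 * z.2.2 - y.2.2 * z.1)
      + x.2.2 * (y.1 * z.2.1 - y.2.1 * z.1) ≠ 0)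
  | _ => false

set_option exponentiation.threshold 1000 in
lemma goodB : (vecB.all (goodVec Ac Dc Cc (137 * 10 ^ 234) (35 * 10 ^ 45) (12 * 10 ^ 42)) && goodDet vecB) = true := by
  decide +kernel

set_option exponentiation.threshold 1000 in
lemma goodC : (vecC.all (goodVec Ac Dc Cc (187 * 10 ^ 142) (13 * 10 ^ 94) (12 * 10 ^ 79)) && goodDet vecC) = true := by
  decide +kernel

lemma goodVec_sound (c2 cf c5 : ℝ) (M A D C : ℕ) (kap Ym Wm : ℤ) (m : ℤ × ℤ × ℤ)
    (hg : goodVec A D C kap Ym Wm m = true) (k2 : |M * c2 - D| ≤ 1000) (kf : |M * cf - A| ≤ 1000)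
    (k5 : |M * c5 - C| ≤ 1000) (X Y W : ℤ) (hY : |Y| ≤ Ym) (hW : |W| ≤ Wm)
    (hR : M * |X * c2 - Y * cf + W * c5| ≤ kap) : m.1 * X + m.2.1 * Y + m.2.2 * W = 0 := by
  obtain ⟨m1, m2, m3⟩ := m
  unfold goodVec at hg
  simp only [decide_eq_true_eq] at hg ⊢
  by_contra hne
  have h1 : 1 ≤ |m1 * X + m2 * Y + m3 * W| := Int.one_le_abs hne
  have h1R : (1:ℝ) ≤ |(m1:ℝ) * X + m2 * Y + m3 * W| := by exact_mod_cast h1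
  have hgR : |(m1:ℝ)| * kap + Ym * (|(m1:ℝ) * A + m2 * D| + 1000 * (|(m1:ℝ)| + |(m2:ℝ)|))
    + Wm * (|(m3:ℝ) * D - m1 * C| + 1000 * (|(m1:ℝ)| + |(m3:ℝ)|)) < D - 1000 := by exact_mod_cast hg
  have hYR : |(Y:ℝ)| ≤ Ym := by exact_mod_cast hY
  have hWR : |(W:ℝ)| ≤ Wm := by exact_mod_cast hW
  have hYm : (0:ℝ) ≤ Ym := (abs_nonneg _).trans hYR
  have hWm : (0:ℝ) ≤ Wm := (abs_nonneg _).trans hWR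
  have hkap : (0:ℝ) ≤ kap := le_trans (by positivity) hR
  have k2' := abs_le.1 k2
  have hpos : (0:ℝ) ≤ M * c2 := by
    have : (0:ℝ) ≤ D - 1000 := by
      refine le_trans ?_ hgR.le
      positivity
    linarith
  have b1 : |(m1:ℝ) * (M * cf) + m2 * (M * c2)| ≤ |(m1:ℝ) * A + m2 * D| + 1000 * (|(m1:ℝ)| + |(m2:ℝ)|) := by
    have : (m1:ℝ) * (M * cf) + m2 * (M * c2) = (m1 * A + m2 * D) + (m1 * (M * cf - A) + m2 * (M * c2 - D)) := by ring
    rw [this]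
    refine (abs_add_le _ _).trans (add_le_add le_rfl ((abs_add_le _ _).trans ?_))
    rw [abs_mul, abs_mul]
    have := mul_le_mul_of_nonneg_left kf (abs_nonneg (m1:ℝ))
    have := mul_le_mul_of_nonneg_left k2 (abs_nonneg (m2:ℝ))
    linarith
  have b2 : |(m3:ℝ) * (M * c2) - m1 * (M * c5)| ≤ |(m3:ℝ) * D - m1 * C| + 1000 * (|(m1:ℝ)| + |(m3:ℝ)|) := by
    have : (m3:ℝ) * (M * c2) - m1 * (M * c5) = (m3 * D - m1 * C) + (m3 * (M * c2 - D) - m1 * (M * c5 - C)) := by ring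
    rw [this]
    refine (abs_add_le _ _).trans (add_le_add le_rfl ((abs_sub _ _).trans ?_))
    rw [abs_mul, abs_mul]
    have := mul_le_mul_of_nonneg_left k5 (abs_nonneg (m1:ℝ))
    have := mul_le_mul_of_nonneg_left k2 (abs_nonneg (m3:ℝ))
    linarith
  have e1 : M * c2 * ((m1:ℝ) * X + m2 * Y + m3 * W) = m1 * (M * (X * c2 - Y * cf + W * c5))
      + Y * ((m1:ℝ) * (M * cf) + m2 * (M * c2)) + W * ((m3:ℝ) * (M * c2) - m1 * (M * c5)) := by ring
  have e2 : M * c2 ≤ |M * c2 * ((m1:ℝ) * X + m2 * Y + m3 * W)| := by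
    rw [abs_mul, abs_of_nonneg hpos]
    nlinarith
  rw [e1] at e2
  have e3 : |m1 * (M * (X * c2 - Y * cf + W * c5))
      + Y * ((m1:ℝ) * (M * cf) + m2 * (M * c2)) + W * ((m3:ℝ) * (M * c2) - m1 * (M * c5))| ≤
      |(m1:ℝ)| * kap + Ym * (|(m1:ℝ) * A + m2 * D| + 1000 * (|(m1:ℝ)| + |(m2:ℝ)|))
    + Wm * (|(m3:ℝ) * D - m1 * C| + 1000 * (|(m1:ℝ)| + |(m3:ℝ)|)) := by
    refine (abs_add_le _ _).trans (add_le_add ((abs_add_le _ _).trans (add_le_add ?_ ?_)) ?_)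
    · rw [abs_mul, abs_mul, abs_of_nonneg (show (0:ℝ) ≤ M by positivity)]
      exact mul_le_mul_of_nonneg_left hR (abs_nonneg _)
    · rw [abs_mul]; exact mul_le_mul hYR b1 (abs_nonneg _) hYm
    · rw [abs_mul]; exact mul_le_mul hWR b2 (abs_nonneg _) hWm
  linarith

lemma good_sound (c2 cf c5 : ℝ) (M A D C : ℕ) (kap Ym Wm : ℤ) (vs : List (ℤ × ℤ × ℤ))
    (hg : (vs.all (goodVec A D C kap Ym Wm) && goodDet vs) = true) (k2 : |M * c2 - D| ≤ 1000) (kf : |M * cf - A| ≤ 1000)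
    (k5 : |M * c5 - C| ≤ 1000) (X Y W : ℤ) (hY : |Y| ≤ Ym) (hW : |W| ≤ Wm)
    (hR : M * |X * c2 - Y * cf + W * c5| ≤ kap) : W = 0 := by
  rw [Bool.and_eq_true, List.all_eq_true] at hg
  obtain ⟨h1, h2⟩ := hg
  have h3 := fun m hm => goodVec_sound c2 cf c5 M A D C kap Ym Wm m (h1 m hm) k2 kf k5 X Y W hY hW hR
  unfold goodDet at h2
  split at h2
  · rename_i x y z
    simp only [decide_eq_true_eq] at h2
    have ex := h3 x (by simp)
    have ey := h3 y (by simp)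
    have ez := h3 z (by simp)
    have : (x.1 * (y.2.1 * z.2.2 - y.2.2 * z.2.1) - x.2.1 * (y.1 * z.2.2 - y.2.2 * z.1)
      + x.2.2 * (y.1 * z.2.1 - y.2.1 * z.1)) * W = 0 := by
      linear_combination (y.1 * z.2.1 - y.2.1 * z.1) * ex - (x.1 * z.2.1 - x.2.1 * z.1) * ey
        + (x.1 * y.2.1 - x.2.1 * y.1) * ez
    exact (mul_eq_zero.1 this).resolve_left h2
  · simp at h2

end T12


open Finset Matrix

namespace T12

lemma fib_ratio (n0 n : ℕ) (h0 : 1 ≤ n0) (h : n0 ≤ n) : Nat.fib n * 2 ^ n0 ≤ Nat.fib n0 * 2 ^ n := by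
  induction n, h using Nat.le_induction with
  | base => exact le_refl _
  | succ k hk ih =>
    have h1 : Nat.fib (k + 1) ≤ 2 * Nat.fib k := by
      obtain ⟨m, rfl⟩ : ∃ m, k = m + 1 := ⟨k - 1, by omega⟩
      have : Nat.fib (m + 1 + 1) = _ := Nat.fib_add_two (n := m)
      have := Nat.fib_le_fib_succ (n := m)
      omega
    calc Nat.fib (k + 1) * 2 ^ n0 ≤ 2 * Nat.fib k * 2 ^ n0 := by gcongr
      _ = 2 * (Nat.fib k * 2 ^ n0) := by ring
      _ ≤ 2 * (Nat.fib n0 * 2 ^ k) := by gcongr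
      _ = _ := by ring

lemma e_bound (n0 n : ℕ) (h0 : 1 ≤ n0) (h : n0 ≤ n) (c : ℝ) (hc : 4 * (Nat.fib n0 : ℝ) ≤ c * 2 ^ n0) :
    4 * (Nat.fib n : ℝ) / 2 ^ n ≤ c := by
  have h1 : (Nat.fib n : ℝ) * 2 ^ n0 ≤ Nat.fib n0 * 2 ^ n := by exact_mod_cast fib_ratio n0 n h0 h
  rw [div_le_iff₀ (by positivity)]
  have h2 : (0:ℝ) < 2 ^ n0 := by positivity
  have h3 : (0:ℝ) < 2 ^ n := by positivity
  refine le_of_mul_le_mul_right ?_ h2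
  nlinarith

set_option exponentiation.threshold 4000 in
lemma e1001 (n : ℕ) (h : 1001 ≤ n) : 4 * (Nat.fib n : ℝ) / 2 ^ n ≤ 132 / 10 ^ 94 :=
  e_bound 1001 n (by norm_num) h _ (by
    have : 4 * Nat.fib 1001 * 10 ^ 94 ≤ 132 * 2 ^ 1001 := by norm_num
    have h2 : 4 * (Nat.fib 1001 : ℝ) * 10 ^ 94 ≤ 132 * 2 ^ 1001 := by exact_mod_cast this
    rw [div_mul_eq_mul_div, le_div_iff₀ (by positivity)]; exact h2)

set_option exponentiation.threshold 4000 in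
lemma e1501 (n : ℕ) (h : 1501 ≤ n) : 4 * (Nat.fib n : ℝ) / 2 ^ n ≤ 126 / 10 ^ 140 :=
  e_bound 1501 n (by norm_num) h _ (by
    have : 4 * Nat.fib 1501 * 10 ^ 140 ≤ 126 * 2 ^ 1501 := by norm_num
    have h2 : 4 * (Nat.fib 1501 : ℝ) * 10 ^ 140 ≤ 126 * 2 ^ 1501 := by exact_mod_cast this
    rw [div_mul_eq_mul_div, le_div_iff₀ (by positivity)]; exact h2)

set_option exponentiation.threshold 4000 in
lemma e2901 (n : ℕ) (h : 2901 ≤ n) : 4 * (Nat.fib n : ℝ) / 2 ^ n ≤ 173 / 10 ^ 269 :=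
  e_bound 2901 n (by norm_num) h _ (by
    have : 4 * Nat.fib 2901 * 10 ^ 269 ≤ 173 * 2 ^ 2901 := by norm_num
    have h2 : 4 * (Nat.fib 2901 : ℝ) * 10 ^ 269 ≤ 173 * 2 ^ 2901 := by exact_mod_cast this
    rw [div_mul_eq_mul_div, le_div_iff₀ (by positivity)]; exact h2)

set_option exponentiation.threshold 4000 in
lemma Mc_real : (Mc:ℝ) = 10 ^ 330 := by unfold Mc; norm_num

set_option exponentiation.threshold 4000 in
lemma Cc_le : Cc ≤ Ac * 1001 := by decide +kernel

/-- from the real relation to an integer inequality -/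
lemma int_rel (M A D C : ℕ) (c2 cf c5 : ℝ) (k2 : |M * c2 - D| ≤ 1000) (kf : |M * cf - A| ≤ 1000)
    (k5 : |M * c5 - C| ≤ 1000) (n : ℕ) (p q : ℤ) (hq : 1 ≤ q) (hp : |p| ≤ q) (K : ℝ)
    (hR : M * |p * (n * c2) - q * (n * cf) + q * c5| ≤ K) :
    |(p:ℝ) * (n * D) - q * (n * A - C)| ≤ K + 1000 * ((2 * n + 1) * q) := by
  have hqR : (1:ℝ) ≤ q := by exact_mod_cast hq
  have hpR : |(p:ℝ)| ≤ q := by exact_mod_cast hp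
  have hn : (0:ℝ) ≤ n := by positivity
  have hM : (0:ℝ) ≤ M := by positivity
  have e1 : (p:ℝ) * (n * D) - q * (n * A - C) = M * (p * (n * c2) - q * (n * cf) + q * c5)
     - ((p * n) * (M * c2 - D) - (q * n) * (M * cf - A) + q * (M * c5 - C)) := by ring
  rw [e1]
  have t0 : |M * (p * (n * c2) - q * (n * cf) + q * c5)| ≤ K := by
    rw [abs_mul, abs_of_nonneg hM]; exact hR
  have t1 : |(p * n) * (M * c2 - D)| ≤ (q * n) * 1000 := by
    rw [abs_mul, abs_mul, abs_of_nonneg hn]; gcongr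
  have t2 : |(q * n) * (M * cf - A)| ≤ (q * n) * 1000 := by
    rw [abs_mul, abs_of_nonneg (by positivity : (0:ℝ) ≤ q * n)]; gcongr
  have t3 : |q * (M * c5 - C)| ≤ q * 1000 := by
    rw [abs_mul, abs_of_nonneg (by positivity : (0:ℝ) ≤ q)]; gcongr
  rw [abs_le] at t0 t1 t2 t3 ⊢
  constructor <;> linarith

set_option exponentiation.threshold 4000 in
/-- the reduction step -/
theorem reduction (n : ℕ) (hn : 1001 ≤ n) (hn' : (n:ℝ) < 1.03e15) (u : ℝ) (p q : ℤ) (hq : 1 ≤ q) (hp : |p| ≤ q)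
    (hqu : (q:ℝ) ≤ 1.125 * u) (hu1 : n ≤ 2900 → u < 10 ^ 43) (hu2 : u < 10 ^ 80)
    (hR : |p * (n * Real.log 2) - q * (n * Real.log Real.goldenRatio) + q * (Real.log 5 / 2)|
      ≤ 9 * (4 * (Nat.fib n : ℝ) / 2 ^ n) * q) : False := by
  obtain ⟨k2, kf, k5⟩ := logs
  have hqR : (1:ℝ) ≤ q := by exact_mod_cast hq
  have hM0 : (0:ℝ) ≤ Mc := by positivity
  by_cases h1 : n ≤ 2900
  · have hu := hu1 h1
    have hq1 : (q:ℝ) ≤ 12 * 10 ^ 42 := by linarith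
    have hq2 : q ≤ 12 * 10 ^ 42 := by exact_mod_cast hq1
    by_cases h2 : n ≤ 1500
    · have he := e1001 n hn
      have hRM : Mc * |p * (n * Real.log 2) - q * (n * Real.log Real.goldenRatio) + q * (Real.log 5 / 2)| ≤
          143 * 10 ^ 280 := by
        calc Mc * _ ≤ (Mc:ℝ) * (9 * (132 / 10 ^ 94) * (12 * 10 ^ 42)) := by
              refine mul_le_mul_of_nonneg_left (hR.trans ?_) hM0
              gcongr
          _ ≤ _ := by rw [Mc_real]; norm_num
      have hi := int_rel Mc Ac Dc Cc _ _ _ k2 kf k5 n p q hq hp _ hRM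
      have hnR : (n:ℝ) ≤ 1500 := by exact_mod_cast h2
      have hb : (1000:ℝ) * ((2 * n + 1) * q) ≤ 1000 * ((2 * 1500 + 1) * (12 * 10 ^ 42)) := by gcongr
      have hb2 : (143:ℝ) * 10 ^ 280 + 1000 * ((2 * 1500 + 1) * (12 * 10 ^ 42)) ≤ 144 * 10 ^ 280 := by norm_num
      have hCA : Cc ≤ n * Ac := Cc_le.trans (by rw [mul_comm]; gcongr)
      refine goodN_sound (n * Ac - Cc) (n * Dc) (12 * 10 ^ 42) (144 * 10 ^ 280)
        (goodRange_spec Ac Dc Cc _ _ 1001 500 goodA n hn (by omega)) p q hq (by exact_mod_cast hq2) ?_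
      have hi2 := (hi.trans (add_le_add le_rfl hb)).trans hb2
      rw [Nat.cast_sub hCA]
      have : (|p * ((n * Dc : ℕ):ℤ) - q * (((n * Ac : ℕ):ℤ) - (Cc:ℤ))| : ℤ) ≤ 144 * 10 ^ 280 := by
        push_cast
        exact_mod_cast hi2
      exact_mod_cast this
    · have he := e1501 n (by omega)
      have hRM : Mc * |p * (n * Real.log 2) - q * (n * Real.log Real.goldenRatio) + q * (Real.log 5 / 2)| ≤
          137 * 10 ^ 234 := by
        calc Mc * _ ≤ (Mc:ℝ) * (9 * (126 / 10 ^ 140) * (12 * 10 ^ 42)) := by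
              refine mul_le_mul_of_nonneg_left (hR.trans ?_) hM0
              gcongr
          _ ≤ _ := by rw [Mc_real]; norm_num
      have := good_sound _ _ _ Mc Ac Dc Cc (137 * 10 ^ 234) (35 * 10 ^ 45) (12 * 10 ^ 42) vecB goodB k2 kf k5
        (n * p) (n * q) q (by
          rw [abs_of_nonneg (by positivity)]
          calc (n:ℤ) * q ≤ 2900 * (12 * 10 ^ 42) := by
                have : (n:ℤ) ≤ 2900 := by exact_mod_cast h1
                gcongr
            _ ≤ _ := by norm_num) (by rw [abs_of_nonneg (by positivity)]; exact hq2) (by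
          push_cast
          refine le_trans (le_of_eq ?_) (hRM.trans (by norm_num))
          congr 2; ring)
      omega
  · have he := e2901 n (by omega)
    have hq1 : (q:ℝ) ≤ 12 * 10 ^ 79 := by linarith
    have hq2 : q ≤ 12 * 10 ^ 79 := by exact_mod_cast hq1
    have hRM : Mc * |p * (n * Real.log 2) - q * (n * Real.log Real.goldenRatio) + q * (Real.log 5 / 2)| ≤
          187 * 10 ^ 142 := by
        calc Mc * _ ≤ (Mc:ℝ) * (9 * (173 / 10 ^ 269) * (12 * 10 ^ 79)) := by
              refine mul_le_mul_of_nonneg_left (hR.trans ?_) hM0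
              gcongr
          _ ≤ _ := by rw [Mc_real]; norm_num
    have := good_sound _ _ _ Mc Ac Dc Cc (187 * 10 ^ 142) (13 * 10 ^ 94) (12 * 10 ^ 79) vecC goodC k2 kf k5
        (n * p) (n * q) q (by
          rw [abs_of_nonneg (by positivity)]
          calc (n:ℤ) * q ≤ 103 * 10 ^ 13 * (12 * 10 ^ 79) := by
                have h3 : (n:ℝ) ≤ 103 * 10 ^ 13 := hn'.le.trans (by norm_num)
                have : (n:ℤ) ≤ 103 * 10 ^ 13 := by exact_mod_cast h3
                gcongr
            _ ≤ _ := by norm_num) (by rw [abs_of_nonneg (by positivity)]; exact hq2) (by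
          push_cast
          refine le_trans (le_of_eq ?_) (hRM.trans (by norm_num))
          congr 2; ring)
    omega

end T12


open Finset Matrix

namespace T12

set_option exponentiation.threshold 4000 in
lemma Ac_bounds : 4812 * 10 ^ 326 + 1000 ≤ Ac ∧ Ac + 1000 ≤ 4813 * 10 ^ 326 := by decide +kernel

set_option exponentiation.threshold 4000 in
lemma Cc_bounds : Cc + 1000 ≤ 8050 * 10 ^ 326 ∧ 1000 ≤ Cc := by decide +kernel

set_option exponentiation.threshold 4000 in
lemma log_bounds : 0.4812 ≤ Real.log Real.goldenRatio ∧ Real.log Real.goldenRatio ≤ 0.4813 ∧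
    Real.log 5 / 2 ≤ 0.805 ∧ 0 ≤ Real.log 5 / 2 := by
  obtain ⟨-, kf, k5⟩ := logs
  obtain ⟨a1, a2⟩ := Ac_bounds
  obtain ⟨c1, -⟩ := Cc_bounds
  have a1' : (4812:ℝ) * 10 ^ 326 + 1000 ≤ Ac := by exact_mod_cast a1
  have a2' : (Ac:ℝ) + 1000 ≤ 4813 * 10 ^ 326 := by exact_mod_cast a2
  have c1' : (Cc:ℝ) + 1000 ≤ 8050 * 10 ^ 326 := by exact_mod_cast c1
  have hM : (Mc:ℝ) = 10 ^ 4 * 10 ^ 326 := by rw [Mc_real, ← pow_add]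
  have hT : (0:ℝ) < 10 ^ 326 := by positivity
  generalize (10:ℝ) ^ 326 = T at *
  rw [abs_le] at kf k5
  rw [hM] at kf k5
  have e2 : 0 ≤ Real.log 5 / 2 := by
    have := Real.log_nonneg (show (1:ℝ) ≤ 5 by norm_num)
    linarith
  generalize Real.log Real.goldenRatio = f at *
  generalize Real.log 5 / 2 = g at *
  refine ⟨?_, ?_, ?_, e2⟩
  · refine le_of_mul_le_mul_left ?_ hT; linarith
  · refine le_of_mul_le_mul_left ?_ hT; linarith
  · refine le_of_mul_le_mul_left ?_ hT; linarith

lemma fib_pos_real (n : ℕ) (hn : 1001 ≤ n) : (1:ℝ) ≤ Nat.fib n := by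
  have : 0 < Nat.fib n := Nat.fib_pos.2 (by omega)
  exact_mod_cast this

/-- `log F_n` against `n log φ - log √5` -/
lemma log_fib (n : ℕ) (hn : 1001 ≤ n) :
    |Real.log (Nat.fib n) - (n * Real.log Real.goldenRatio - Real.log 5 / 2)| ≤ 4 * (Nat.fib n : ℝ) / 2 ^ n := by
  have hF := fib_pos_real n hn
  have h5 : Real.sqrt 5 ^ 2 = 5 := Real.sq_sqrt (by norm_num)
  have h50 : 0 < Real.sqrt 5 := by positivity
  obtain ⟨t, ht⟩ : ∃ t, t = -(Real.goldenConj / Real.goldenRatio) ^ n := ⟨_, rfl⟩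
  have hφ := Real.goldenRatio_pos
  have hφ1 := Real.one_lt_goldenRatio
  have hq : |Real.goldenConj / Real.goldenRatio| ≤ 1 / 2 := by
    have h1 := Real.goldenConj_neg
    have h2 := Real.neg_one_lt_goldenConj
    have h3 := Real.goldenRatio_mul_goldenConj
    have h4 := Real.goldenRatio_add_goldenConj
    rw [abs_div, abs_of_neg h1, abs_of_pos hφ, div_le_iff₀ hφ]
    nlinarith
  have ht1 : |t| ≤ (1 / 2) ^ n := by
    rw [ht, abs_neg, abs_pow]; gcongr
  have hhalf : ((1:ℝ) / 2) ^ n ≤ 1 / 2 := by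
    calc ((1:ℝ) / 2) ^ n ≤ (1 / 2) ^ 1 := pow_le_pow_of_le_one (by norm_num) (by norm_num) (by omega)
      _ = _ := by norm_num
  have hl := abs_log_one_add_le t (ht1.trans hhalf)
  have hfib : (Nat.fib n : ℝ) = Real.goldenRatio ^ n / Real.sqrt 5 * |1 + t| := by
    have : 0 ≤ 1 + t := by have := (abs_le.1 (ht1.trans hhalf)).1; linarith
    have hc : (Nat.fib n : ℝ) = (Real.goldenRatio ^ n - Real.goldenConj ^ n) / Real.sqrt 5 := Real.coe_fib_eq n
    rw [abs_of_nonneg this, hc, ht, div_pow Real.goldenConj Real.goldenRatio n]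
    have hφn : Real.goldenRatio ^ n ≠ 0 := by positivity
    have key : ∀ A C s : ℝ, A ≠ 0 → s ≠ 0 → (A - C) / s = A / s * (1 + -(C / A)) := by
      intro A C s hA hs
      field_simp
      ring
    exact key _ _ _ hφn h50.ne'
  have hne : |1 + t| ≠ 0 := by
    intro h; rw [h] at hfib; simp at hfib; linarith
  have hs : Real.log (Real.sqrt 5) = Real.log 5 / 2 := Real.log_sqrt (by norm_num)
  have hlog : Real.log (Nat.fib n) = n * Real.log Real.goldenRatio - Real.log 5 / 2 + Real.log (|1 + t|) := by
    rw [hfib, Real.log_mul (by positivity) hne, Real.log_div (by positivity) (by positivity), Real.log_pow, hs]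
  rw [hlog, add_sub_cancel_left]
  refine hl.trans ?_
  calc 2 * |t| ≤ 2 * (1 / 2) ^ n := by gcongr
    _ = 2 / 2 ^ n := by rw [div_pow, one_pow]; ring
    _ ≤ _ := by gcongr; linarith

/-- log of a number close to `L` or `-L` -/
lemma log_close (X L e : ℝ) (hL : 0 < L) (he : e ≤ 1e-9) (h : |X - L| ≤ e / 2 * L ∨ |X + L| ≤ e / 2 * L) :
    |Real.log (|X|) - Real.log L| ≤ e := by
  wlog hc : |X - L| ≤ e / 2 * L with H
  · have h2 := h.resolve_left hc
    rw [← abs_neg X]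
    apply H (-X) L e hL he
    · left; rw [← abs_neg]; convert h2 using 2; ring
    · rw [← abs_neg]; convert h2 using 2; ring
  obtain ⟨t, ht⟩ : ∃ t, t = (X - L) / L := ⟨_, rfl⟩
  have hX : X = L * (1 + t) := by rw [ht]; field_simp; ring
  have ht1 : |t| ≤ e / 2 := by
    rw [ht, abs_div, abs_of_pos hL, div_le_iff₀ hL]; exact hc
  have hl := abs_log_one_add_le t (by linarith)
  have hne : |1 + t| ≠ 0 := by
    rw [abs_ne_zero]
    have := (abs_le.1 ht1).1
    intro h; linarith
  rw [hX, abs_mul, abs_of_pos hL, Real.log_mul hL.ne' hne, add_sub_cancel_left]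
  linarith

/-- size facts -/
lemma sizes (n : ℕ) (hn : 1001 ≤ n) (l1 l2 e : ℝ) (hl1 : l1 = Real.log (Nat.fib n)) (hl2 : l2 = n * Real.log 2)
    (he : e = 4 * (Nat.fib n : ℝ) / 2 ^ n) :
    693 ≤ l2 ∧ 0.69 * l2 ≤ l1 ∧ l1 ≤ 0.7 * l2 ∧ 0 ≤ e ∧ e ≤ 1e-9 ∧ (8:ℝ) * 2 ^ n ≤ (Nat.fib n : ℝ) ^ 2 ∧
    |l1 - (n * Real.log Real.goldenRatio - Real.log 5 / 2)| ≤ e ∧ Real.log (2 ^ n) = l2 ∧ Real.exp (-l2) ≤ e := by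
  have hF := fib_pos_real n hn
  obtain ⟨f1, f2, g1, g0⟩ := log_bounds
  have hlf := log_fib n hn
  have e9 : e ≤ 1e-9 := by rw [he]; exact (e1001 n hn).trans (by norm_num)
  rw [← he, ← hl1] at hlf
  have hnR : (1001:ℝ) ≤ n := by exact_mod_cast hn
  have t1 := Real.log_two_gt_d9
  have t2 := Real.log_two_lt_d9
  have hlf' := abs_le.1 hlf
  have p1 : (n:ℝ) * 0.4812 ≤ n * Real.log Real.goldenRatio := by gcongr
  have p2 : n * Real.log Real.goldenRatio ≤ (n:ℝ) * 0.4813 := by gcongr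
  have p3 : (n:ℝ) * 0.69314 ≤ l2 := by rw [hl2]; gcongr; linarith
  have p4 : l2 ≤ (n:ℝ) * 0.69316 := by rw [hl2]; gcongr; linarith
  have q1 : 693 ≤ l2 := by linarith
  have q2 : 0.69 * l2 ≤ l1 := by linarith
  have hlog2 : Real.log (2 ^ n) = l2 := by rw [Real.log_pow, hl2]
  refine ⟨q1, q2, by linarith, by rw [he]; positivity, e9, ?_, hlf, hlog2, ?_⟩
  · have h8 : Real.log 8 ≤ 7 := by
      have := Real.log_le_sub_one_of_pos (show (0:ℝ) < 8 by norm_num); linarith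
    rw [← Real.log_le_log_iff (by positivity) (by positivity), Real.log_mul (by norm_num) (by positivity), hlog2,
      Real.log_pow, ← hl1]
    push_cast; linarith
  · rw [← hlog2, Real.exp_neg, Real.exp_log (by positivity), he, inv_eq_one_div]
    gcongr; linarith

/-- location of the roots -/
lemma locate (F B : ℝ) (hF : 1 ≤ F) (hB : 8 * B ≤ F ^ 2) (hFB : 1000 * F ≤ B) (al : Fin 3 → ℝ)
    (hord : al 0 < al 1 ∧ al 1 < al 2) (hroot : ∀ i, al i * (al i - F) * (al i - B) - 1 = 0) :
    (al 0 + al 1 + al 2 = F + B ∧ al 0 * al 1 + al 0 * al 2 + al 1 * al 2 = F * B ∧ al 0 * al 1 * al 2 = 1) ∧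
    0 < al 0 ∧ al 0 < 1 / 2 ∧ F - 1 < al 1 ∧ al 1 < F ∧ B < al 2 ∧ al 2 < B + 1 / 2 := by
  obtain ⟨o1, o2⟩ := hord
  have r0 := hroot 0
  have r1 := hroot 1
  have r2 := hroot 2
  generalize al 0 = x at *
  generalize al 1 = y at *
  generalize al 2 = z at *
  have v1 : x ^ 2 + x * y + y ^ 2 - (F + B) * (x + y) + F * B = 0 := by
    have : (x - y) * (x ^ 2 + x * y + y ^ 2 - (F + B) * (x + y) + F * B) = 0 := by linear_combination r0 - r1
    rcases mul_eq_zero.1 this with h | h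
    · linarith
    · exact h
  have v2 : x ^ 2 + x * z + z ^ 2 - (F + B) * (x + z) + F * B = 0 := by
    have : (x - z) * (x ^ 2 + x * z + z ^ 2 - (F + B) * (x + z) + F * B) = 0 := by linear_combination r0 - r2
    rcases mul_eq_zero.1 this with h | h
    · linarith
    · exact h
  have s1 : x + y + z = F + B := by
    have : (y - z) * (x + y + z - (F + B)) = 0 := by linear_combination v1 - v2
    rcases mul_eq_zero.1 this with h | h
    · linarith
    · linarith
  have s2 : x * y + x * z + y * z = F * B := by
    linear_combination v1 * (-1) + (x + y) * s1
  have s3 : x * y * z = 1 := by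
    linear_combination r0 - x ^ 2 * s1 + x * s2
  have hF0 : 0 < F := by linarith
  have hB0 : 0 < B := by linarith
  -- sign pattern of a root
  have pos : ∀ w, w * (w - F) * (w - B) - 1 = 0 → 0 < w := by
    intro w hw
    by_contra h
    push Not at h
    have h1 : 0 ≤ w * (w - F) := mul_nonneg_of_nonpos_of_nonpos h (by linarith)
    have h2 : w * (w - F) * (w - B) ≤ 0 := mul_nonpos_of_nonneg_of_nonpos h1 (by linarith)
    linarith
  have alt : ∀ w, w * (w - F) * (w - B) - 1 = 0 → w < F ∨ B < w := by
    intro w hw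
    by_contra! h
    have h0 := pos w hw
    have h1 : 0 ≤ w * (w - F) := mul_nonneg h0.le (by linarith)
    have h2 : w * (w - F) * (w - B) ≤ 0 := mul_nonpos_of_nonneg_of_nonpos h1 (by linarith)
    linarith
  have x0 := pos x r0
  have y0 := pos y r1
  have hy : y < F := (alt y r1).resolve_right (fun h => by linarith)
  have hz : B < z := (alt z r2).resolve_left (fun h => by linarith)
  have hF8000 : 8000 ≤ F := by nlinarith
  have hz2 : z < B + 1 / 2 := by
    by_contra! h
    have h1 : 1 ≤ z - F := by linarith
    have h2 : 8 ≤ z := by linarith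
    have h3 : 8 * 1 ≤ z * (z - F) := mul_le_mul h2 h1 (by norm_num) (by linarith)
    have h4 : 8 * 1 * (1 / 2) ≤ z * (z - F) * (z - B) := mul_le_mul h3 (by linarith) (by norm_num) (by linarith)
    linarith
  have hx2 : x < 1 / 2 := by
    by_contra! h
    have h1 : x * 2 < F := by linarith
    have h2 : 2 ≤ F - x := by linarith
    have h3 : 2 ≤ B - x := by linarith
    have h4 : 2 * 2 ≤ (F - x) * (B - x) := mul_le_mul h2 h3 (by norm_num) (by linarith)
    have h5 : 1 / 2 * (2 * 2) ≤ x * ((F - x) * (B - x)) := mul_le_mul h h4 (by norm_num) x0.le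
    have h6 : x * ((F - x) * (B - x)) = 1 := by linear_combination r0
    rw [h6] at h5
    norm_num at h5
  exact ⟨⟨s1, s2, s3⟩, x0, hx2, by linarith, hy, hz, hz2⟩

/-- all the logarithmic estimates -/
lemma logests (F B l1 l2 e : ℝ) (hF : 1 ≤ F) (hB : 8 * B ≤ F ^ 2) (hFB : 1000 * F ≤ B) (al : Fin 3 → ℝ)
    (hord : al 0 < al 1 ∧ al 1 < al 2) (hroot : ∀ i, al i * (al i - F) * (al i - B) - 1 = 0)
    (hl1 : Real.log F = l1) (hl2 : Real.log B = l2) (hee : e = 4 * F / B) (he : e ≤ 1e-9) :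
    (|Real.log (|al 0|) + (l1 + l2)| ≤ 2 * e ∧ |Real.log (|al 0 - F|) - l1| ≤ e ∧ |Real.log (|al 1|) - l1| ≤ e ∧
    |Real.log (|al 1 - F|) + (l1 + l2)| ≤ 2 * e) ∧ |Real.log (|al 2|) - l2| ≤ e ∧ |Real.log (|al 2 - F|) - l2| ≤ e ∧
    |Real.log (|al 0 - al 1|) - l1| ≤ e ∧ |Real.log (|al 0 - al 2|) - l2| ≤ e ∧ |Real.log (|al 1 - al 2|) - l2| ≤ e := by
  obtain ⟨-, a0, a0', a1, a1', a2, a2'⟩ := locate F B hF hB hFB al hord hroot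
  have hB0 : 0 < B := by linarith
  have hF0 : 0 < F := by linarith
  have hF8000 : 8000 ≤ F := by nlinarith
  have eB : e / 2 * B = 2 * F := by rw [hee]; field_simp; norm_num
  have eF : 16 ≤ e / 2 * F := by
    rw [hee, div_div, div_mul_eq_mul_div, le_div_iff₀ (by positivity)]; nlinarith
  have cF : ∀ X, |X - F| ≤ 16 ∨ |X + F| ≤ 16 → |Real.log (|X|) - l1| ≤ e := by
    intro X h
    rw [← hl1]
    exact log_close X F e hF0 he (h.imp (fun h => h.trans eF) (fun h => h.trans eF))
  have cB : ∀ X, |X - B| ≤ 2 * F ∨ |X + B| ≤ 2 * F → |Real.log (|X|) - l2| ≤ e := by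
    intro X h
    rw [← hl2]
    exact log_close X B e hB0 he (by rw [eB]; exact h)
  have prodlog : ∀ X Y Z : ℝ, X * Y * Z = 1 → |Real.log (|Y|) - l1| ≤ e → |Real.log (|Z|) - l2| ≤ e →
      |Real.log (|X|) + (l1 + l2)| ≤ 2 * e := by
    intro X Y Z h h1 h2
    have hX : X ≠ 0 := by rintro rfl; simp at h
    have hY : Y ≠ 0 := by rintro rfl; simp at h
    have hZ : Z ≠ 0 := by rintro rfl; simp at h
    have h3 : Real.log (|X|) + Real.log (|Y|) + Real.log (|Z|) = 0 := by
      rw [← Real.log_mul (by simpa using hX) (by simpa using hY), ← Real.log_mul (by simp [hX, hY]) (by simpa using hZ),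
        ← abs_mul, ← abs_mul, h]
      simp
    rw [abs_le] at h1 h2 ⊢
    constructor <;> linarith
  have r0 := hroot 0
  have r1 := hroot 1
  have q0 : |Real.log (|al 0 - F|) - l1| ≤ e := cF _ (Or.inr (by rw [abs_le]; constructor <;> linarith))
  have p1 : |Real.log (|al 1|) - l1| ≤ e := cF _ (Or.inl (by rw [abs_le]; constructor <;> linarith))
  refine ⟨⟨?_, q0, p1, ?_⟩, ?_, ?_, ?_, ?_, ?_⟩
  · exact prodlog _ _ _ (sub_eq_zero.1 r0) q0 (cB _ (Or.inr (by rw [abs_le]; constructor <;> linarith)))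
  · refine prodlog _ _ _ ?_ p1 (cB (al 1 - B) (Or.inr (by rw [abs_le]; constructor <;> linarith)))
    linear_combination r1
  · exact cB _ (Or.inl (by rw [abs_le]; constructor <;> linarith))
  · exact cB _ (Or.inl (by rw [abs_le]; constructor <;> linarith))
  · exact cF _ (Or.inr (by rw [abs_le]; constructor <;> linarith))
  · exact cB _ (Or.inr (by rw [abs_le]; constructor <;> linarith))
  · exact cB _ (Or.inr (by rw [abs_le]; constructor <;> linarith))

/-- contradiction from a generic datum and a solution -/
theorem finish (n : ℕ) (hn : 1001 ≤ n) (hn' : (n:ℝ) < 1.03e15) (a b : ℤ) (al : Fin 3 → ℝ) (l1 l2 e : ℝ)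
    (hl1 : l1 = Real.log (Nat.fib n)) (hl2 : l2 = n * Real.log 2)
    (he : e = 4 * (Nat.fib n : ℝ) / 2 ^ n) (G : Gen a b al l1 l2 e) (x y : ℤ)
    (hN : |(x - al 0 * y) * (x - al 1 * y) * (x - al 2 * y)| = 1) (hy : 2 ≤ |y|)
    (htype : ∀ i, |(x:ℝ) - al 0 * y| ≤ |(x:ℝ) - al i * y|) : False := by
  obtain ⟨-, -, -, he0, -, -, hlf, -, hel⟩ := sizes n hn l1 l2 e hl1 hl2 he
  obtain ⟨u, v, hu, hv0, hv, hLam⟩ := stepI G x y hN hy htype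
  obtain ⟨p, q, hq, hp, hqu, hR⟩ := relation G u v hu hv0 hv hLam hel
  have t1 := Real.log_two_gt_d9
  have t2 := Real.log_two_lt_d9
  refine reduction n hn hn' u p q hq hp hqu ?_ ?_ ?_
  · intro h
    apply uA G u v hu hv hLam
    have : (n:ℝ) ≤ 2900 := by exact_mod_cast h
    rw [hl2]
    calc n * Real.log 2 ≤ 2900 * 0.6932 := by gcongr; linarith
      _ ≤ _ := by norm_num
  · apply uC G u v hu hv hLam
    rw [hl2]
    calc n * Real.log 2 ≤ 1.03e15 * 0.6932 := by gcongr; linarith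
      _ ≤ _ := by norm_num
  · have hqR : (1:ℝ) ≤ q := by exact_mod_cast hq
    rw [← he, ← hl2]
    have e1 : p * l2 - q * (n * Real.log Real.goldenRatio) + q * (Real.log 5 / 2)
       = (p * l2 - q * l1) + q * (l1 - (n * Real.log Real.goldenRatio - Real.log 5 / 2)) := by ring
    rw [e1]
    have h2 : |q * (l1 - (n * Real.log Real.goldenRatio - Real.log 5 / 2))| ≤ q * e := by
      rw [abs_mul, abs_of_nonneg (by linarith : (0:ℝ) ≤ q)]; gcongr
    refine (abs_add_le _ _).trans ((add_le_add hR h2).trans ?_)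
    have : 0 ≤ e * q := by positivity
    linarith

end T12

theorem no_solutions_type12 (n : ℕ) (hn : 1000 < n) (hn' : (n : ℝ) < 1.03e15)
    (α : Fin 3 → ℝ)
    (hord : α 0 < α 1 ∧ α 1 < α 2)
    (hroot : ∀ i, α i * (α i - (Nat.fib n : ℝ)) * (α i - 2 ^ n) - 1 = 0) :
    ¬ ∃ (x y : ℤ) (j : Fin 3),
        (x * (x - (Nat.fib n : ℤ) * y) * (x - 2 ^ n * y) - y ^ 3 = 1 ∨
         x * (x - (Nat.fib n : ℤ) * y) * (x - 2 ^ n * y) - y ^ 3 = -1) ∧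
        2 ≤ |y| ∧ (j = 0 ∨ j = 1) ∧
        (∀ i : Fin 3, |(x : ℝ) - α j * (y : ℝ)| ≤ |(x : ℝ) - α i * (y : ℝ)|) := by
  rintro ⟨x, y, j, heq, hy, hj, htype⟩
  obtain ⟨l1, hl1⟩ : ∃ l1, l1 = Real.log (Nat.fib n) := ⟨_, rfl⟩
  obtain ⟨l2, hl2⟩ : ∃ l2, l2 = n * Real.log 2 := ⟨_, rfl⟩
  obtain ⟨e, he⟩ : ∃ e, e = 4 * (Nat.fib n : ℝ) / 2 ^ n := ⟨_, rfl⟩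
  obtain ⟨z1, z2, z3, z4, z5, z6, -, z8, -⟩ := T12.sizes n hn l1 l2 e hl1 hl2 he
  have hF := T12.fib_pos_real n hn
  have hFB : 1000 * (Nat.fib n : ℝ) ≤ 2 ^ n := by
    have h3 := z5
    rw [he, div_le_iff₀ (by positivity)] at h3
    linarith
  obtain ⟨⟨s1, s2, s3⟩, a0, a0', a1, a1', a2, a2'⟩ := T12.locate _ _ hF z6 hFB α hord hroot
  obtain ⟨⟨p0, q0, p1, q1⟩, p2, q2, d01, d02, d12⟩ :=
    T12.logests _ _ l1 l2 e hF z6 hFB α hord hroot hl1.symm z8 he z5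
  have hprod : ((x:ℝ) - α 0 * y) * (x - α 1 * y) * (x - α 2 * y) =
      x * (x - (Nat.fib n : ℝ) * y) * (x - 2 ^ n * y) - y ^ 3 := by
    linear_combination (-(x:ℝ) ^ 2 * y) * s1 + x * y ^ 2 * s2 - y ^ 3 * s3
  have hN : |((x:ℝ) - α 0 * y) * (x - α 1 * y) * (x - α 2 * y)| = 1 := by
    rw [hprod]
    rcases heq with h | h
    · have : (x:ℝ) * (x - (Nat.fib n : ℝ) * y) * (x - 2 ^ n * y) - y ^ 3 = 1 := by exact_mod_cast h
      rw [this]; simp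
    · have : (x:ℝ) * (x - (Nat.fib n : ℝ) * y) * (x - 2 ^ n * y) - y ^ 3 = -1 := by exact_mod_cast h
      rw [this]; simp
  rcases hj with rfl | rfl
  · refine T12.finish n hn hn' (Nat.fib n : ℤ) (2 ^ n) α l1 l2 e hl1 hl2 he ?_ x y hN hy htype
    exact {
      s1 := by push_cast; exact s1
      s2 := by push_cast; exact s2
      s3 := s3
      p0 := p0
      q0 := by push_cast; exact q0
      p1 := p1
      q1 := by push_cast; exact q1
      p2 := p2
      q2 := by push_cast; exact q2
      d01 := d01
      d02 := d02
      d12 := d12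
      h0 := by rw [abs_lt]; constructor <;> linarith
      hl2 := z1
      hl1 := z2
      hl1' := z3
      he0 := z4
      he := z5 }
  · obtain ⟨F, hFd⟩ : ∃ F : ℝ, F = (Nat.fib n : ℝ) := ⟨_, rfl⟩
    obtain ⟨γ, hγ⟩ : ∃ γ : Fin 3 → ℝ, γ = ![α 1 - F, α 0 - F, α 2 - F] := ⟨_, rfl⟩
    have g0 : γ 0 = α 1 - F := by rw [hγ]; rfl
    have g1 : γ 1 = α 0 - F := by rw [hγ]; rfl
    have g2 : γ 2 = α 2 - F := by rw [hγ]; rfl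
    rw [← hFd] at s1 s2 a1 a1' q0 q1 q2
    have hxc : ((x - (Nat.fib n : ℤ) * y : ℤ) : ℝ) = x - F * y := by rw [hFd]; push_cast; rfl
    refine T12.finish n hn hn' (-(Nat.fib n : ℤ)) (2 ^ n - (Nat.fib n : ℤ)) γ l1 l2 e hl1 hl2 he ?_
      (x - (Nat.fib n : ℤ) * y) y ?_ hy ?_
    · exact {
        s1 := by push_cast; rw [g0, g1, g2, ← hFd]; linarith
        s2 := by push_cast; rw [g0, g1, g2, ← hFd]; linear_combination s2 - 2 * F * s1
        s3 := by rw [g0, g1, g2]; linear_combination s3 - F * s2 + F ^ 2 * s1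
        p0 := by rw [g0]; exact q1
        q0 := by push_cast; rw [g0, ← hFd, sub_neg_eq_add, sub_add_cancel]; exact p1
        p1 := by rw [g1]; exact q0
        q1 := by push_cast; rw [g1, ← hFd, sub_neg_eq_add, sub_add_cancel]; exact p0
        p2 := by rw [g2]; exact q2
        q2 := by push_cast; rw [g2, ← hFd, sub_neg_eq_add, sub_add_cancel]; exact p2
        d01 := by rw [g0, g1, sub_sub_sub_cancel_right, abs_sub_comm (α 1)]; exact d01
        d02 := by rw [g0, g2, sub_sub_sub_cancel_right]; exact d12
        d12 := by rw [g1, g2, sub_sub_sub_cancel_right]; exact d02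
        h0 := by rw [g0, abs_lt]; constructor <;> linarith
        hl2 := z1
        hl1 := z2
        hl1' := z3
        he0 := z4
        he := z5 }
    · rw [hxc, g0, g1, g2]
      rw [← hN]
      congr 1
      ring
    · intro i
      rw [hxc, g0]
      have e1 : (x:ℝ) - F * y - (α 1 - F) * y = x - α 1 * y := by ring
      rw [e1]
      fin_cases i
      · have e2 : (x:ℝ) - F * y - γ 0 * y = x - α 1 * y := by rw [g0]; ring
        change _ ≤ |(x:ℝ) - F * y - γ 0 * y|
        rw [e2]
      · have e2 : (x:ℝ) - F * y - γ 1 * y = x - α 0 * y := by rw [g1]; ring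
        change _ ≤ |(x:ℝ) - F * y - γ 1 * y|
        rw [e2]; exact htype 0
      · have e2 : (x:ℝ) - F * y - γ 2 * y = x - α 2 * y := by rw [g2]; ring
        change _ ≤ |(x:ℝ) - F * y - γ 2 * y|
        rw [e2]; exact htype 2
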